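/- arXiv:2107.06523 — 6 statements merged into one kernel-verified Lean document; each statement's English description precedes it below -/
import Mathlib

section
/- Let k ≥ 2 be an integer and (x_n)_{n≥1} ⊆ [0,1] a sequence. If (x_n) has Poissonian k-th order correlations, then (x_n) is uniformly distributed modulo 1. -/
open Finset Filter MeasureTheory
open scoped Classical ENNReal NNReal

/-- Distance from `x` to the nearest integer. -/
noncomputable def nint (x : ℝ) : ℝ := |x - round x|

/-- Signed distance from `x` to the origin modulo 1. -/
noncomputable def sdist (x : ℝ) : ℝ :=
  if Int.fract x ≤ 1 / 2 then Int.fract x else Int.fract x - 1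

/-- Number of `k`-tuples of pairwise distinct indices in `{1,…,N}` whose rescaled signed
differences lie in the box `∏ r, [a r, b r]`. -/
noncomputable def corrBoxCount (x : ℕ → ℝ) (k N : ℕ) (a b : Fin (k - 1) → ℝ) : ℕ :=
  ((Fintype.piFinset fun _ : Fin k => Finset.Icc 1 N).filter fun i =>
    Function.Injective i ∧ ∀ r : Fin (k - 1),
      (N : ℝ) * sdist (x (i ⟨0, by have := r.2; omega⟩) - x (i ⟨r.1 + 1, by have := r.2; omega⟩))
        ∈ Set.Icc (a r) (b r)).card

/-- The sequence `x` (indexed by `n ≥ 1`) has Poissonian correlations of order `k`. -/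
def HasPoissonianCorr (x : ℕ → ℝ) (k : ℕ) : Prop :=
  ∀ a b : Fin (k - 1) → ℝ, (∀ r, a r ≤ b r) →
    Tendsto (fun N : ℕ => (corrBoxCount x k N a b : ℝ) / N) atTop
      (nhds (∏ r, (b r - a r)))

/-- The `k`-th order correlation function `R_k(s₁,…,s_{k-1},N)` (pairwise distinct indices). -/
noncomputable def Rcorr (x : ℕ → ℝ) (k N : ℕ) (s : Fin (k - 1) → ℝ) : ℝ :=
  (((Fintype.piFinset fun _ : Fin k => Finset.Icc 1 N).filter fun i =>
    Function.Injective i ∧ ∀ r : Fin (k - 1),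
      nint (x (i ⟨0, by have := r.2; omega⟩) - x (i ⟨r.1 + 1, by have := r.2; omega⟩))
        ≤ s r / N).card : ℝ) / N

/-- The `k`-th order correlation function `R_k^*(s₁,…,s_{k-1},N)` (indices not necessarily
distinct). -/
noncomputable def RcorrStar (x : ℕ → ℝ) (k N : ℕ) (s : Fin (k - 1) → ℝ) : ℝ :=
  (((Fintype.piFinset fun _ : Fin k => Finset.Icc 1 N).filter fun i =>
    ∀ r : Fin (k - 1),
      nint (x (i ⟨0, by have := r.2; omega⟩) - x (i ⟨r.1 + 1, by have := r.2; omega⟩))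
        ≤ s r / N).card : ℝ) / N

/-- On `(-1/2, 1/2)` the signed distance to the nearest integer is the identity. -/
lemma sdist_eq_self {d : ℝ} (hd : |d| < 1 / 2) : sdist d = d := by
  obtain ⟨h1, h2⟩ := abs_lt.mp hd
  unfold sdist
  rcases le_or_gt 0 d with h0 | h0
  · have hf : Int.fract d = d := Int.fract_eq_self.mpr ⟨h0, by linarith⟩
    rw [hf, if_pos (by linarith)]
  · have hf : Int.fract d = d + 1 := by
      rw [Int.fract_eq_iff]
      exact ⟨by linarith, by linarith, -1, by push_cast; ring⟩
    rw [hf, if_neg (by linarith)]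
    ring

/-- The descending factorial of `#S` is at most the number of injective tuples from `S`. -/
lemma descFactorial_card_le_card_injective {α : Type*} (S : Finset α) (k : ℕ) :
    (#S).descFactorial k ≤
      #((Fintype.piFinset fun _ : Fin k => S).filter Function.Injective) := by
  have h : (#S).descFactorial k = #(univ : Finset (Fin k ↪ S)) := by
    simp [Fintype.card_embedding_eq]
  rw [h]
  refine Finset.card_le_card_of_injOn (fun e j => (e j : α)) ?_ ?_
  · intro e _
    simp only [coe_filter, Set.mem_ofPred_eq, Fintype.mem_piFinset]
    exact ⟨fun j => (e j).2, Subtype.val_injective.comp e.injective⟩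
  · intro e _ e' _ h
    ext j
    exact congrFun h j

/-- The graph of `g ↦ g ^ (m + 1)` lies above its tangent line at `c`. -/
lemma tangent_le_pow_succ {g c : ℝ} (hg : 0 ≤ g) (hc : 0 ≤ c) (m : ℕ) :
    (m + 1) * c ^ m * g - m * c ^ (m + 1) ≤ g ^ (m + 1) := by
  induction m with
  | zero => simp
  | succ m ih =>
    have h1 := mul_le_mul_of_nonneg_left ih hg
    have h2 : 0 ≤ ((m : ℝ) + 1) * c ^ m * (g - c) ^ 2 := by positivity
    have h3 : g * ((m + 1) * c ^ m * g - m * c ^ (m + 1)) -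
        ((m + 1 + 1) * c ^ (m + 1) * g - (m + 1) * c ^ (m + 1 + 1)) =
        (m + 1) * c ^ m * (g - c) ^ 2 := by ring
    rw [pow_succ' g (m + 1)]
    push_cast
    linarith

/-- A tangent line lower bound for descending factorials. -/
lemma tangent_le_descFactorial {c : ℝ} (hc : 0 ≤ c) (f m : ℕ) :
    (m + 1) * c ^ m * (f - m) - m * c ^ (m + 1) ≤ (f.descFactorial (m + 1) : ℝ) := by
  have h1 : (((f + 1 - (m + 1) : ℕ) : ℝ)) ^ (m + 1) ≤ (f.descFactorial (m + 1) : ℝ) := by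
    exact_mod_cast Nat.pow_sub_le_descFactorial f (m + 1)
  have h2 : (f : ℝ) - m ≤ ((f + 1 - (m + 1) : ℕ) : ℝ) := by
    rw [Nat.add_sub_add_right, sub_le_iff_le_add]
    exact_mod_cast Nat.sub_le_iff_le_add.mp le_rfl
  refine le_trans ?_ ((tangent_le_pow_succ (Nat.cast_nonneg _) hc m).trans h1)
  gcongr

/-- The indices `n ≤ N` for which `⌊N x n⌋` lies in the window `[t, t + s)`. -/
noncomputable def windowIndices (x : ℕ → ℝ) (N s : ℕ) (t : ℤ) : Finset ℕ :=
  (Finset.Icc 1 N).filter fun n => t ≤ ⌊(N : ℝ) * x n⌋ ∧ ⌊(N : ℝ) * x n⌋ < t + s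

/-- The windows of length `s` that can meet the interval `[a, b]` rescaled by `N`. -/
noncomputable def windowRange (N s : ℕ) (a b : ℝ) : Finset ℤ :=
  Finset.Ioc (⌊(N : ℝ) * a⌋ - s) ⌊(N : ℝ) * b⌋

lemma card_windowRange_le (N s : ℕ) {a b : ℝ} (hab : a ≤ b) :
    (#(windowRange N s a b) : ℝ) ≤ N * (b - a) + s + 1 := by
  have hle : ⌊(N : ℝ) * a⌋ ≤ ⌊(N : ℝ) * b⌋ := Int.floor_le_floor (by gcongr)
  have h : ((#(windowRange N s a b) : ℤ)) = ⌊(N : ℝ) * b⌋ - (⌊(N : ℝ) * a⌋ - s) := by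
    rw [windowRange, Int.card_Ioc, Int.toNat_of_nonneg (by omega)]
  have h' : (#(windowRange N s a b) : ℝ) = ⌊(N : ℝ) * b⌋ - (⌊(N : ℝ) * a⌋ - s) := by
    exact_mod_cast h
  have h1 := Int.floor_le ((N : ℝ) * b)
  have h2 := Int.lt_floor_add_one ((N : ℝ) * a)
  rw [h']
  linarith

/-- Every point of `[a, b]` is seen by exactly `s` windows, all of them in `windowRange`. -/
lemma mul_card_le_sum_card_windowIndices (x : ℕ → ℝ) (N s : ℕ) (a b : ℝ) :
    s * #((Finset.Icc 1 N).filter fun n => x n ∈ Set.Icc a b) ≤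
      ∑ t ∈ windowRange N s a b, #(windowIndices x N s t) := by
  simp only [windowIndices, Finset.card_filter]
  rw [Finset.sum_comm, Finset.mul_sum]
  refine Finset.sum_le_sum fun n _ => ?_
  split_ifs with hn
  · rw [← Finset.card_filter, mul_one]
    have h1 : ⌊(N : ℝ) * a⌋ ≤ ⌊(N : ℝ) * x n⌋ :=
      Int.floor_le_floor (mul_le_mul_of_nonneg_left hn.1 (Nat.cast_nonneg N))
    have h2 : ⌊(N : ℝ) * x n⌋ ≤ ⌊(N : ℝ) * b⌋ :=
      Int.floor_le_floor (mul_le_mul_of_nonneg_left hn.2 (Nat.cast_nonneg N))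
    calc s = #(Finset.Ioc (⌊(N : ℝ) * x n⌋ - s) ⌊(N : ℝ) * x n⌋) := by simp
      _ ≤ _ := Finset.card_le_card fun t ht => by
        simp only [windowRange, Finset.mem_filter, Finset.mem_Ioc] at ht ⊢
        omega
  · simp

/-- Tuples of points sharing a window of length `s` are counted by `s` correlation boxes of
side length `s + 1`. -/
lemma sum_descFactorial_card_windowIndices_le (x : ℕ → ℝ) (m N s : ℕ) (hN : 2 * (s + 1) < N)
    (T : Finset ℤ) :
    ∑ t ∈ T, (#(windowIndices x N s t)).descFactorial (m + 1) ≤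
      ∑ u ∈ Finset.range s,
        corrBoxCount x (m + 1) N (fun _ => (u : ℝ) - s) (fun _ => (u : ℝ) + 1) := by
  refine (Finset.sum_le_sum fun t _ => descFactorial_card_le_card_injective _ _).trans ?_
  unfold corrBoxCount
  rw [← Finset.card_sigma, ← Finset.card_sigma]
  refine Finset.card_le_card_of_injOn
    (fun p => ⟨(⌊(N : ℝ) * x (p.2 0)⌋ - p.1).toNat, p.2⟩) ?_ ?_
  · rintro ⟨t, i⟩ h
    simp only [coe_sigma, Set.mem_sigma_iff, mem_coe, mem_filter, Fintype.mem_piFinset,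
      windowIndices] at h ⊢
    obtain ⟨-, hi, hinj⟩ := h
    have h0 := (hi 0).2
    refine ⟨Finset.mem_range.mpr (by omega), fun j => (hi j).1, hinj, fun r => ?_⟩
    have hu : (((⌊(N : ℝ) * x (i 0)⌋ - t).toNat : ℕ) : ℝ) = ⌊(N : ℝ) * x (i 0)⌋ - t := by
      exact_mod_cast Int.toNat_of_nonneg (by omega)
    set j : Fin (m + 1) := ⟨r.1 + 1, by have := r.2; omega⟩
    have hrj := (hi j).2
    have e1 : (t : ℝ) ≤ ⌊(N : ℝ) * x (i 0)⌋ := by exact_mod_cast h0.1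
    have e2 : (⌊(N : ℝ) * x (i 0)⌋ : ℝ) + 1 ≤ t + s := by exact_mod_cast h0.2
    have e3 : (t : ℝ) ≤ ⌊(N : ℝ) * x (i j)⌋ := by exact_mod_cast hrj.1
    have e4 : (⌊(N : ℝ) * x (i j)⌋ : ℝ) + 1 ≤ t + s := by exact_mod_cast hrj.2
    have e5 := Int.floor_le ((N : ℝ) * x (i 0))
    have e6 := Int.lt_floor_add_one ((N : ℝ) * x (i 0))
    have e7 := Int.floor_le ((N : ℝ) * x (i j))
    have e8 := Int.lt_floor_add_one ((N : ℝ) * x (i j))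
    have hNR : (2 : ℝ) * (s + 1) < N := by exact_mod_cast hN
    have hN0 : (0 : ℝ) < N := by
      have : (0 : ℝ) ≤ s := Nat.cast_nonneg s
      linarith
    have hd : |x (i 0) - x (i j)| < 1 / 2 := by
      refine lt_of_mul_lt_mul_left ?_ hN0.le
      rw [← abs_of_pos hN0, ← abs_mul, abs_of_pos hN0, abs_lt]
      constructor <;> linarith
    change (N : ℝ) * sdist (x (i 0) - x (i j)) ∈ _
    rw [sdist_eq_self hd, hu]
    constructor <;> linarith
  · rintro ⟨t, i⟩ h ⟨t', i'⟩ h' heq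
    simp only [coe_sigma, Set.mem_sigma_iff, mem_coe, mem_filter, Fintype.mem_piFinset,
      windowIndices] at h h'
    simp only [Sigma.mk.injEq, heq_eq_eq] at heq ⊢
    obtain ⟨h1, rfl⟩ := heq
    have h2 := (h.2.1 0).2
    have h3 := (h'.2.1 0).2
    exact ⟨by omega, rfl⟩

/-- The finite-level inequality: points concentrated in `[a, b]` force many close tuples. -/
lemma concentration_le_sum_corrBoxCount (x : ℕ → ℝ) (hx : ∀ n, x n ∈ Set.Icc (0 : ℝ) 1)
    (m N s : ℕ) (hN : 2 * (s + 1) < N) {a b : ℝ} (ha : 0 ≤ a) (hab : a ≤ b) (hb : b ≤ 1)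
    {y : ℝ} (hy : 1 ≤ y) :
    (m + 1) * (s : ℝ) ^ (m + 1) * (y ^ m - 1) *
        #((Finset.Icc 1 N).filter fun n => x n ∈ Set.Icc a b) ≤
      ∑ u ∈ Finset.range s,
        (corrBoxCount x (m + 1) N (fun _ => (u : ℝ) - s) (fun _ => (u : ℝ) + 1) : ℝ)
      - (m + 1) * (s : ℝ) ^ (m + 1) * N
      + (N + (s + 1)) * (m * (m + 1) * (s : ℝ) ^ m + m * (s : ℝ) ^ (m + 1))
      + (N * (b - a) + (s + 1)) *
        (m * (m + 1) * (s : ℝ) ^ m * (y ^ m - 1) + m * (s : ℝ) ^ (m + 1) * (y ^ (m + 1) - 1)) := by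
  set f : ℤ → ℕ := fun t => #(windowIndices x N s t)
  set A := windowRange N s a b
  set T := windowRange N s 0 1
  set P : ℝ := (#((Finset.Icc 1 N).filter fun n => x n ∈ Set.Icc a b) : ℝ) with hP
  have hAT : A ⊆ T := by
    refine Finset.Ioc_subset_Ioc ?_ ?_
    · gcongr
    · gcongr
  have hcount : #((Finset.Icc 1 N).filter fun n => x n ∈ Set.Icc (0 : ℝ) 1) = N := by
    rw [Finset.filter_true_of_mem fun n _ => hx n]
    simp
  have hFT : (s : ℝ) * N ≤ ∑ t ∈ T, (f t : ℝ) := by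
    have := mul_card_le_sum_card_windowIndices x N s 0 1
    rw [hcount] at this
    exact_mod_cast this
  have hFA : (s : ℝ) * P ≤ ∑ t ∈ A, (f t : ℝ) := by
    rw [hP]
    exact_mod_cast mul_card_le_sum_card_windowIndices x N s a b
  have hnT : (#T : ℝ) ≤ N + (s + 1) := by
    have := card_windowRange_le N s (zero_le_one (α := ℝ))
    linarith
  have hnA : (#A : ℝ) ≤ N * (b - a) + (s + 1) := by
    have := card_windowRange_le N s hab
    linarith
  have hup : ∑ t ∈ T, ((f t).descFactorial (m + 1) : ℝ) ≤ ∑ u ∈ Finset.range s,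
      (corrBoxCount x (m + 1) N (fun _ => (u : ℝ) - s) (fun _ => (u : ℝ) + 1) : ℝ) := by
    exact_mod_cast sum_descFactorial_card_windowIndices_le x m N s hN T
  have hsum (c : ℝ) (U : Finset ℤ) :
      ∑ t ∈ U, ((m + 1) * c ^ m * ((f t : ℝ) - m) - m * c ^ (m + 1)) =
        (m + 1) * c ^ m * (∑ t ∈ U, (f t : ℝ)) - #U * (m * (m + 1) * c ^ m + m * c ^ (m + 1)) := by
    rw [Finset.sum_sub_distrib, ← Finset.mul_sum, Finset.sum_sub_distrib]
    simp only [Finset.sum_const, nsmul_eq_mul]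
    ring
  have hs0 : (0 : ℝ) ≤ s := Nat.cast_nonneg s
  have hlow (c : ℝ) (hc : 0 ≤ c) (U : Finset ℤ) :=
    Finset.sum_le_sum fun t (_ : t ∈ U) => tangent_le_descFactorial hc (f t) m
  have h1 := hlow (s * y) (by positivity) A
  have h2 := hlow s hs0 (T \ A)
  rw [hsum] at h1 h2
  have hsplit := Finset.sum_sdiff hAT (f := fun t => ((f t).descFactorial (m + 1) : ℝ))
  have hsplitf := Finset.sum_sdiff hAT (f := fun t => (f t : ℝ))
  have hsplitc : (#(T \ A) : ℝ) + #A = #T := by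
    exact_mod_cast Finset.card_sdiff_add_card_eq_card hAT
  rw [eq_sub_of_add_eq hsplitf, eq_sub_of_add_eq hsplitc] at h2
  have hD : 0 ≤ y ^ m - 1 := sub_nonneg.mpr (one_le_pow₀ hy)
  have hE : 0 ≤ y ^ (m + 1) - 1 := sub_nonneg.mpr (one_le_pow₀ hy)
  have k1 := mul_le_mul_of_nonneg_left hFT (show 0 ≤ (m + 1) * (s : ℝ) ^ m by positivity)
  have k2 := mul_le_mul_of_nonneg_left hFA
    (show 0 ≤ (m + 1) * (s : ℝ) ^ m * (y ^ m - 1) by positivity)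
  have k3 := mul_le_mul_of_nonneg_right hnT
    (show 0 ≤ m * (m + 1) * (s : ℝ) ^ m + m * (s : ℝ) ^ (m + 1) by positivity)
  have k4 := mul_le_mul_of_nonneg_right hnA
    (show 0 ≤ m * (m + 1) * (s : ℝ) ^ m * (y ^ m - 1) +
      m * (s : ℝ) ^ (m + 1) * (y ^ (m + 1) - 1) by positivity)
  simp only [mul_pow] at h1
  have hps : (s : ℝ) ^ (m + 1) = s ^ m * s := pow_succ _ _
  have k1' : (m + 1) * (s : ℝ) ^ m * (s * N) = (m + 1) * (s : ℝ) ^ (m + 1) * N := by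
    rw [hps]; ring
  have k2' : (m + 1) * (s : ℝ) ^ m * (y ^ m - 1) * (s * P) =
      (m + 1) * (s : ℝ) ^ (m + 1) * (y ^ m - 1) * P := by
    rw [hps]; ring
  linarith

/-- The slope comparison at `y = 1` behind the choice of tangent points. -/
lemma exists_tangent_slope {α ε : ℝ} (hε : 0 < ε) {m : ℕ} (hm : 0 < m) :
    ∃ y : ℝ, 1 < y ∧ α * (m * (y ^ (m + 1) - 1)) < (m + 1) * (y ^ m - 1) * (α + ε) := by
  set ψ : ℝ → ℝ := fun y => (m + 1) * (y ^ m - 1) * (α + ε) - α * (m * (y ^ (m + 1) - 1)) with hψ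
  have hder : HasDerivAt ψ (m * (m + 1) * ε) 1 := by
    have h1 := ((((hasDerivAt_pow m (1 : ℝ)).sub_const 1).const_mul ((m : ℝ) + 1)).mul_const
      (α + ε)).sub ((((hasDerivAt_pow (m + 1) (1 : ℝ)).sub_const 1).const_mul (m : ℝ)).const_mul α)
    refine HasDerivAt.congr_deriv (f := ψ) h1 ?_
    push_cast
    simp only [one_pow, mul_one]
    ring
  have hpos : 0 < (m : ℝ) * (m + 1) * ε := by positivity
  have hslope := (hasDerivAt_iff_tendsto_slope.mp hder).eventually (lt_mem_nhds hpos)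
  have hslope' : ∀ᶠ y in nhdsWithin (1 : ℝ) (Set.Ioi 1), 0 < slope ψ 1 y :=
    hslope.filter_mono (nhdsWithin_mono _ fun y (hy : 1 < y) => ne_of_gt hy)
  obtain ⟨y, hy1, hy2⟩ := (hslope'.and self_mem_nhdsWithin).exists
  have hy : (1 : ℝ) < y := hy2
  refine ⟨y, hy, ?_⟩
  have hψ1 : ψ 1 = 0 := by simp [hψ]
  rw [slope_def_field, hψ1, sub_zero, div_pos_iff_of_pos_right (by linarith)] at hy1
  exact sub_pos.mp hy1

/-- Under Poissonian correlations no closed interval asymptotically receives more than its share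
of points. -/
lemma HasPoissonianCorr.eventually_card_div_lt {x : ℕ → ℝ} {m : ℕ} (hm : 0 < m)
    (hx : ∀ n, x n ∈ Set.Icc (0 : ℝ) 1) (hP : HasPoissonianCorr x (m + 1)) {a b : ℝ}
    (ha : 0 ≤ a) (hab : a ≤ b) (hb : b ≤ 1) {ε : ℝ} (hε : 0 < ε) :
    ∀ᶠ N : ℕ in atTop,
      (#((Finset.Icc 1 N).filter fun n => x n ∈ Set.Icc a b) : ℝ) / N < b - a + ε := by
  obtain ⟨y, hy, hys⟩ := exists_tangent_slope (α := b - a) hε hm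
  set D := y ^ m - 1 with hD
  set E := y ^ (m + 1) - 1 with hE
  have hDpos : 0 < D := sub_pos.mpr (one_lt_pow₀ hy hm.ne')
  obtain ⟨s, hs, hs0⟩ : ∃ s : ℕ, (1 + 1 / (s : ℝ)) ^ m - 1 + m * (m + 1) * (1 / (s : ℝ))
      + (b - a) * (m * (m + 1) * D * (1 / (s : ℝ)) + m * E) < (m + 1) * D * (b - a + ε) ∧
      0 < s := by
    have h0 : Tendsto (fun s : ℕ => 1 / (s : ℝ)) atTop (nhds 0) :=
      tendsto_one_div_atTop_nhds_zero_nat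
    have hlim : Tendsto (fun s : ℕ => (1 + 1 / (s : ℝ)) ^ m - 1 + m * (m + 1) * (1 / (s : ℝ))
        + (b - a) * (m * (m + 1) * D * (1 / (s : ℝ)) + m * E)) atTop
        (nhds ((1 + 0) ^ m - 1 + m * (m + 1) * 0 + (b - a) * (m * (m + 1) * D * 0 + m * E))) :=
      ((((h0.const_add 1).pow m).sub_const 1).add (h0.const_mul _)).add
        (((h0.const_mul _).add_const _).const_mul _)
    have hlt : (1 + 0) ^ m - 1 + m * (m + 1) * 0 + (b - a) * (m * (m + 1) * D * 0 + m * E)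
        < (m + 1) * D * (b - a + ε) := by
      simpa only [add_zero, one_pow, sub_self, mul_zero, zero_add] using hys
    exact ((hlim.eventually (gt_mem_nhds hlt)).and (eventually_gt_atTop 0)).exists
  have hsR : (0 : ℝ) < s := by exact_mod_cast hs0
  set K₁ := m * (m + 1) * (s : ℝ) ^ m + m * (s : ℝ) ^ (m + 1) with hK₁
  set K₂ := m * (m + 1) * (s : ℝ) ^ m * D + m * (s : ℝ) ^ (m + 1) * E with hK₂
  have hcorr : Tendsto (fun N : ℕ => ∑ u ∈ Finset.range s,
      (corrBoxCount x (m + 1) N (fun _ => (u : ℝ) - s) (fun _ => (u : ℝ) + 1) : ℝ) / N) atTop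
      (nhds (s * (s + 1 : ℝ) ^ m)) := by
    have h : (s * (s + 1 : ℝ) ^ m) =
        ∑ u ∈ Finset.range s, ∏ _r : Fin (m + 1 - 1), (((u : ℝ) + 1) - (u - s)) := by
      have (u : ℕ) : ((u : ℝ) + 1) - (u - s) = s + 1 := by ring
      simp [this]
    rw [h]
    exact tendsto_finsetSum _ fun u _ => hP _ _ fun _ => by linarith
  have hinv : Tendsto (fun N : ℕ => ((s : ℝ) + 1) / N) atTop (nhds 0) :=
    tendsto_const_div_atTop_nhds_zero_nat _
  have hlim := ((hcorr.sub_const ((m + 1) * (s : ℝ) ^ (m + 1))).add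
    ((hinv.const_add 1).mul_const K₁)).add ((hinv.const_add (b - a)).mul_const K₂)
  have hlt : s * (s + 1 : ℝ) ^ m - (m + 1) * (s : ℝ) ^ (m + 1) + (1 + 0) * K₁ + (b - a + 0) * K₂
      < (m + 1) * (s : ℝ) ^ (m + 1) * D * (b - a + ε) := by
    have h := mul_lt_mul_of_pos_left hs (pow_pos hsR (m + 1))
    have e1 : (s : ℝ) ^ (m + 1) * (1 + 1 / (s : ℝ)) ^ m = s * (s + 1) ^ m := by
      have : (s : ℝ) + 1 = s * (1 + 1 / s) := by field_simp
      rw [this, mul_pow]; ring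
    have e2 : (s : ℝ) ^ (m + 1) * (1 / (s : ℝ)) = s ^ m := by
      rw [pow_succ]; field_simp
    rw [hK₁, hK₂, ← e1, ← e2]
    linarith
  filter_upwards [hlim.eventually (gt_mem_nhds hlt), eventually_gt_atTop (2 * (s + 1))]
    with N h1 hN
  have hNpos : (0 : ℝ) < N := by exact_mod_cast (Nat.zero_le _).trans_lt hN
  have h2 := concentration_le_sum_corrBoxCount x hx m N s hN ha hab hb hy.le
  rw [← Finset.sum_div] at h1
  have h3 := div_le_div_of_nonneg_right h2 hNpos.le
  have hc : 0 < (m + 1) * (s : ℝ) ^ (m + 1) * D := by positivity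
  refine lt_of_mul_lt_mul_left (lt_of_le_of_lt ?_ h1) hc.le
  rw [← mul_div_assoc]
  refine h3.trans (le_of_eq ?_)
  rw [hK₁, hK₂, hD, hE]
  field_simp

/-- If a sequence in `[0,1]` has Poissonian `k`-th order correlations for some
`k ≥ 2`, then it is uniformly distributed. -/
theorem poissonian_corr_implies_uniform_distribution
    (k : ℕ) (hk : 2 ≤ k) (x : ℕ → ℝ) (hx : ∀ n, x n ∈ Set.Icc (0 : ℝ) 1)
    (hP : HasPoissonianCorr x k) :
    ∀ a b : ℝ, 0 ≤ a → a < b → b ≤ 1 →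
      Tendsto (fun N : ℕ =>
          (((Finset.Icc 1 N).filter fun n => x n ∈ Set.Icc a b).card : ℝ) / N)
        atTop (nhds (b - a)) := by
  intro a b ha hab hb
  obtain ⟨m, rfl⟩ : ∃ m, k = m + 1 := ⟨k - 1, by omega⟩
  have hm : 0 < m := by omega
  rw [Metric.tendsto_nhds]
  intro ε hε
  filter_upwards [hP.eventually_card_div_lt hm hx ha hab.le hb hε,
    hP.eventually_card_div_lt hm hx le_rfl ha (hab.le.trans hb) (half_pos hε),
    hP.eventually_card_div_lt hm hx (ha.trans hab.le) hb le_rfl (half_pos hε),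
    eventually_gt_atTop 0] with N h1 h2 h3 hN
  have hNpos : (0 : ℝ) < N := by exact_mod_cast hN
  have hcover : Finset.Icc 1 N ⊆ ((Finset.Icc 1 N).filter fun n => x n ∈ Set.Icc a b) ∪
      (((Finset.Icc 1 N).filter fun n => x n ∈ Set.Icc 0 a) ∪
        ((Finset.Icc 1 N).filter fun n => x n ∈ Set.Icc b 1)) := by
    intro n hn
    simp only [Finset.mem_union, Finset.mem_filter, Set.mem_Icc, hn, true_and]
    have := hx n
    rcases le_total a (x n) with h | h
    · rcases le_total (x n) b with h' | h'
      · exact Or.inl ⟨h, h'⟩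
      · exact Or.inr (Or.inr ⟨h', this.2⟩)
    · exact Or.inr (Or.inl ⟨this.1, h⟩)
  have hcard := (Finset.card_le_card hcover).trans ((Finset.card_union_le _ _).trans
    (Nat.add_le_add_left (Finset.card_union_le _ _) _))
  rw [Nat.card_Icc, Nat.add_sub_cancel] at hcard
  have hcardR : (N : ℝ) ≤ #((Finset.Icc 1 N).filter fun n => x n ∈ Set.Icc a b) +
      (#((Finset.Icc 1 N).filter fun n => x n ∈ Set.Icc 0 a) +
        #((Finset.Icc 1 N).filter fun n => x n ∈ Set.Icc b 1)) := by
    exact_mod_cast hcard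
  have h4 := div_le_div_of_nonneg_right hcardR hNpos.le
  rw [div_self hNpos.ne', add_div, add_div] at h4
  rw [Real.dist_eq, abs_lt]
  constructor <;> linarith
end

section
/- Let k ≥ 2, (x_n)_{n≥1} ⊆ [0,1], and let G : [0,1] → ℝ be an asymptotic distribution function of (x_n) along a strictly increasing sequence (N_j) of positive integers. If G is not absolutely continuous on [0,1], then for every s > 0 one has lim_{j→∞} R_k(s,N_j) = ∞ (the correlation function tends to infinity along the subsequence). -/
open Finset Filter MeasureTheory
open scoped Classical ENNReal NNReal

/-- `G` is absolutely continuous on the unit interval: for every `ε > 0` there is `δ > 0` such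
that for every finite family of non-overlapping subintervals of `[0,1]` of total length `< δ`,
the total variation of `G` over them is `< ε`. -/
def AbsContOnUnitInterval (G : ℝ → ℝ) : Prop :=
  ∀ ε > (0 : ℝ), ∃ δ > (0 : ℝ), ∀ (n : ℕ) (a b : Fin n → ℝ),
    (∀ i, 0 ≤ a i ∧ a i ≤ b i ∧ b i ≤ 1) →
    (∀ i j, i ≠ j → Disjoint (Set.Ioo (a i) (b i)) (Set.Ioo (a j) (b j))) →
    ∑ i, (b i - a i) < δ → ∑ i, |G (b i) - G (a i)| < ε

theorem nint_le_abs (y : ℝ) : nint y ≤ |y| := by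
  simpa [nint] using round_le y 0

/-- A linear lower bound for the falling factorial of order at least two. -/
theorem mul_sub_le_descFactorial {k : ℕ} (hk : 2 ≤ k) (L m : ℕ) :
    (L : ℝ) * (m - (L + k)) ≤ (m.descFactorial k : ℝ) := by
  rcases le_or_gt (L + k) m with h | h
  · have h₁ : (m + 1 - k) ^ 2 ≤ m.descFactorial k :=
      (Nat.pow_le_pow_right (by omega) hk).trans (Nat.pow_sub_le_descFactorial m k)
    have h₂ : ((m + 1 - k : ℕ) : ℝ) = m + 1 - k := by
      rw [Nat.cast_sub (by omega)]; push_cast; ring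
    have h₃ : ((m : ℝ) + 1 - k) ^ 2 ≤ (m.descFactorial k : ℝ) := by
      rw [← h₂]; exact_mod_cast h₁
    have h₄ : (L : ℝ) + k ≤ m := by exact_mod_cast h
    have h₅ : (0 : ℝ) ≤ L := L.cast_nonneg
    nlinarith
  · have h₁ : (m : ℝ) < L + k := by exact_mod_cast h
    have h₂ : (0 : ℝ) ≤ L := L.cast_nonneg
    have h₃ : (0 : ℝ) ≤ (m.descFactorial k : ℝ) := Nat.cast_nonneg _
    nlinarith

/-- Counting injective `k`-tuples on which a labelling `f` is constant. -/
theorem sum_descFactorial_le_card {α β : Type*} {k : ℕ} (hk : 0 < k) (S : Finset α)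
    (T : Finset β) (f : α → β) :
    ∑ t ∈ T, (S.filter fun a => f a = t).card.descFactorial k ≤
      ((Fintype.piFinset fun _ : Fin k => S).filter fun i =>
        Function.Injective i ∧ ∀ r r', f (i r) = f (i r')).card := by
  have hcard : ∑ t ∈ T, (S.filter fun a => f a = t).card.descFactorial k =
      (T.sigma fun t =>
        (Finset.univ : Finset (Fin k ↪ {a // a ∈ S.filter fun a => f a = t}))).card := by
    rw [Finset.card_sigma]
    refine Finset.sum_congr rfl fun t _ => ?_
    rw [Finset.card_univ, Fintype.card_embedding_eq, Fintype.card_coe, Fintype.card_fin]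
  rw [hcard]
  refine Finset.card_le_card_of_injOn (fun p r => (p.2 r : α)) ?_ ?_
  · rintro ⟨t, e⟩ -
    have he : ∀ r, (e r : α) ∈ S ∧ f (e r) = t := fun r => Finset.mem_filter.1 (e r).2
    simp only [Finset.coe_filter, Set.mem_ofPred_eq, Fintype.mem_piFinset]
    exact ⟨fun r => (he r).1, Subtype.val_injective.comp e.injective,
      fun r r' => (he r).2.trans (he r').2.symm⟩
  · rintro ⟨t, e⟩ - ⟨t', e'⟩ - h
    have hr : ∀ r, (e r : α) = e' r := fun r => congrFun h r
    have ht : t = t' := by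
      rw [← (Finset.mem_filter.1 (e ⟨0, hk⟩).2).2, hr,
        (Finset.mem_filter.1 (e' ⟨0, hk⟩).2).2]
    subst ht
    congr 1
    ext r
    exact hr r

/-- If the points with indices in `S` are labelled so that equally labelled points lie within
`s / N` of each other, then few labels force a large correlation function. -/
theorem mul_sub_le_Rcorr {β : Type*} {k N : ℕ} (hk : 2 ≤ k) (hN : 1 ≤ N) (L : ℕ) (x : ℕ → ℝ)
    {s : ℝ} {S : Finset ℕ} (hS : S ⊆ Finset.Icc 1 N) (T : Finset β) (f : ℕ → β)
    (hf : ∀ n ∈ S, f n ∈ T)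
    (hclose : ∀ n ∈ S, ∀ m ∈ S, f n = f m → |x n - x m| ≤ s / N) :
    (L : ℝ) * (S.card - T.card * (L + k)) / N ≤ Rcorr x k N fun _ => s := by
  unfold Rcorr
  gcongr
  calc (L : ℝ) * (S.card - T.card * (L + k))
      = ∑ t ∈ T, (L : ℝ) * ((S.filter fun a => f a = t).card - (L + k)) := by
        rw [← Finset.mul_sum, Finset.sum_sub_distrib, Finset.card_eq_sum_card_fiberwise hf]
        push_cast
        rw [Finset.sum_const, nsmul_eq_mul]
    _ ≤ ∑ t ∈ T, ((S.filter fun a => f a = t).card.descFactorial k : ℝ) :=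
        Finset.sum_le_sum fun t _ => mul_sub_le_descFactorial hk _ _
    _ ≤ _ := by
        norm_cast
        refine (sum_descFactorial_le_card (by omega) S T f).trans (Finset.card_le_card ?_)
        intro i hi
        simp only [Finset.mem_filter, Fintype.mem_piFinset] at hi ⊢
        refine ⟨fun r => hS (hi.1 r), hi.2.1, fun r => (nint_le_abs _).trans ?_⟩
        exact hclose _ (hi.1 _) _ (hi.1 _) (hi.2.2 _ _)

/-- The number of `n ≤ N` for which `x n` lies in a half-open interval, in terms of the counting
function of `x`. -/
theorem card_filter_Ioc_eq (x : ℕ → ℝ) (N : ℕ) {a b : ℝ} (hab : a ≤ b) :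
    (((Finset.Icc 1 N).filter fun n => x n ∈ Set.Ioc a b).card : ℝ) =
      |(((Finset.Icc 1 N).filter fun n => x n ≤ b).card : ℝ) -
        ((Finset.Icc 1 N).filter fun n => x n ≤ a).card| := by
  have hsub : ((Finset.Icc 1 N).filter fun n => x n ≤ a) ⊆
      (Finset.Icc 1 N).filter fun n => x n ≤ b :=
    Finset.monotone_filter_right _ fun n _ h => le_trans h hab
  have hsdiff : ((Finset.Icc 1 N).filter fun n => x n ∈ Set.Ioc a b) =
      ((Finset.Icc 1 N).filter fun n => x n ≤ b) \ (Finset.Icc 1 N).filter fun n => x n ≤ a := by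
    ext n
    simp only [Finset.mem_filter, Finset.mem_sdiff, Set.mem_Ioc, not_and, not_le]
    tauto
  have hle : (((Finset.Icc 1 N).filter fun n => x n ≤ a).card : ℝ) ≤
      ((Finset.Icc 1 N).filter fun n => x n ≤ b).card := by
    exact_mod_cast Finset.card_le_card hsub
  rw [hsdiff, Finset.card_sdiff_of_subset hsub, Nat.cast_sub (Finset.card_le_card hsub),
    abs_of_nonneg (sub_nonneg.2 hle)]

/-- A lower bound for the correlation function in terms of the number of points in a finite
family of non-overlapping intervals and the total length of the family. -/
theorem mul_sub_le_Rcorr_of_intervals {k N n : ℕ} (hk : 2 ≤ k) (hN : 1 ≤ N) (L : ℕ) (x : ℕ → ℝ)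
    {s : ℝ} (hs : 0 < s) (a b : Fin n → ℝ) (hab : ∀ i, a i ≤ b i)
    (hdisj : ∀ i j, i ≠ j → Disjoint (Set.Ioo (a i) (b i)) (Set.Ioo (a j) (b j))) :
    (L : ℝ) * (∑ i, (((Finset.Icc 1 N).filter fun m => x m ∈ Set.Ioc (a i) (b i)).card : ℝ) -
      ((∑ i, (b i - a i)) * N / s + n) * (L + k)) / N ≤ Rcorr x k N fun _ => s := by
  have hN' : (0 : ℝ) < N := by exact_mod_cast hN
  have hdisj' : ∀ i j, i ≠ j → Disjoint (Set.Ioc (a i) (b i)) (Set.Ioc (a j) (b j)) := by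
    intro i j hij
    have h := hdisj i j hij
    rw [Set.Ioo_disjoint_Ioo] at h
    rwa [Set.Ioc_disjoint_Ioc]
  set S : Finset ℕ := Finset.univ.biUnion fun i =>
    (Finset.Icc 1 N).filter fun m => x m ∈ Set.Ioc (a i) (b i) with hSdef
  have hScard : (S.card : ℝ) =
      ∑ i, (((Finset.Icc 1 N).filter fun m => x m ∈ Set.Ioc (a i) (b i)).card : ℝ) := by
    rw [hSdef, Finset.card_biUnion, Nat.cast_sum]
    intro i _ j _ hij
    refine Finset.disjoint_filter.2 fun m _ hi hj => Set.disjoint_left.1 (hdisj' i j hij) hi hj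
  have hSmem : ∀ m, m ∈ S → m ∈ Finset.Icc 1 N ∧ ∃ i, x m ∈ Set.Ioc (a i) (b i) := by
    intro m hm
    simp only [hSdef, Finset.mem_biUnion, Finset.mem_filter] at hm
    obtain ⟨i, -, h₁, h₂⟩ := hm
    exact ⟨h₁, i, h₂⟩
  have hidx : ∀ m, ∃ o : Option (Fin n), m ∈ S → ∃ i, o = some i ∧ x m ∈ Set.Ioc (a i) (b i) := by
    intro m
    by_cases hm : m ∈ S
    · obtain ⟨i, hi⟩ := (hSmem m hm).2
      exact ⟨some i, fun _ => ⟨i, rfl, hi⟩⟩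
    · exact ⟨none, fun h => absurd h hm⟩
  choose o ho using hidx
  let cell : Fin n → ℝ → ℕ := fun i y => ⌊(y - a i) * N / s⌋₊
  let T : Finset (Fin n × ℕ) := Finset.univ.biUnion fun i =>
    (Finset.range (cell i (b i) + 1)).image fun q => (i, q)
  have hT : (T.card : ℝ) ≤ (∑ i, (b i - a i)) * N / s + n := by
    have h₁ : T.card ≤ ∑ i, (cell i (b i) + 1) :=
      Finset.card_biUnion_le.trans <| Finset.sum_le_sum fun i _ =>
        Finset.card_image_le.trans (Finset.card_range _).le
    calc (T.card : ℝ) ≤ ∑ i, ((cell i (b i) : ℝ) + 1) := by exact_mod_cast h₁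
      _ ≤ ∑ i, ((b i - a i) * N / s + 1) := by
        refine Finset.sum_le_sum fun i _ => add_le_add_left (Nat.floor_le ?_) 1
        have := sub_nonneg.2 (hab i)
        positivity
      _ = _ := by
        rw [Finset.sum_add_distrib, Finset.sum_mul, Finset.sum_div]
        simp
  let f : ℕ → Option (Fin n × ℕ) := fun m => (o m).map fun i => (i, cell i (x m))
  have hmain := mul_sub_le_Rcorr (s := s) hk hN L x (fun m hm => (hSmem m hm).1)
    (T.map Function.Embedding.some) f ?_ ?_
  · refine le_trans ?_ hmain
    rw [hScard, Finset.card_map]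
    gcongr
  · intro m hm
    obtain ⟨i, hi, hxi⟩ := ho m hm
    simp only [f, hi, Option.map_some, Finset.mem_map, Function.Embedding.some_apply]
    refine ⟨_, ?_, rfl⟩
    simp only [T, Finset.mem_biUnion, Finset.mem_univ, true_and, Finset.mem_image,
      Finset.mem_range]
    refine ⟨i, cell i (x m), Nat.lt_succ_of_le (Nat.floor_le_floor ?_), rfl⟩
    have := hxi.2
    gcongr
  · intro m hm m' hm' hff
    obtain ⟨i, hi, hxi⟩ := ho m hm
    obtain ⟨i', hi', hxi'⟩ := ho m' hm'
    simp only [f, hi, hi', Option.map_some, Option.some.injEq, Prod.mk.injEq] at hff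
    obtain ⟨rfl, hc⟩ := hff
    have h₁ : 0 ≤ (x m - a i) * N / s := by
      have := sub_nonneg.2 hxi.1.le
      positivity
    have h₂ : 0 ≤ (x m' - a i) * N / s := by
      have := sub_nonneg.2 hxi'.1.le
      positivity
    have hc' : ((cell i (x m) : ℕ) : ℝ) = cell i (x m') := by rw [hc]
    have e₁ := Nat.floor_le h₁
    have e₂ := Nat.floor_le h₂
    have e₃ := Nat.lt_floor_add_one ((x m - a i) * N / s)
    have e₄ := Nat.lt_floor_add_one ((x m' - a i) * N / s)
    simp only [cell] at hc'
    have e₅ : |(x m - a i) * N / s - (x m' - a i) * N / s| ≤ 1 := by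
      rw [abs_le]; constructor <;> linarith
    have e₆ : (x m - a i) * N / s - (x m' - a i) * N / s = (x m - x m') * (N / s) := by ring
    rw [e₆, abs_mul, abs_of_pos (div_pos hN' hs)] at e₅
    rwa [← le_div_iff₀ (div_pos hN' hs), one_div_div] at e₅

/-- If `G` is an asymptotic distribution function of `(x_n)` along `(N_j)` and
`G` is not absolutely continuous on `[0,1]`, then `R_k(s, N_j) → ∞` for every `s > 0`. -/
theorem not_absolutelyContinuous_implies_Rk_tendsto_infinity
    (k : ℕ) (hk : 2 ≤ k) (x : ℕ → ℝ) (hx : ∀ n, x n ∈ Set.Icc (0 : ℝ) 1)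
    (Nj : ℕ → ℕ) (hmono : StrictMono Nj) (hpos : ∀ j, 1 ≤ Nj j)
    (G : ℝ → ℝ)
    (hG : ∀ t ∈ Set.Icc (0 : ℝ) 1,
      Tendsto (fun j : ℕ =>
          (((Finset.Icc 1 (Nj j)).filter fun n => x n ≤ t).card : ℝ) / (Nj j))
        atTop (nhds (G t)))
    (hnotAC : ¬ AbsContOnUnitInterval G) :
    ∀ s : ℝ, 0 < s →
      Tendsto (fun j : ℕ => Rcorr x k (Nj j) fun _ => s) atTop atTop := by
  intro s hs
  unfold AbsContOnUnitInterval at hnotAC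
  push Not at hnotAC
  obtain ⟨ε, hε, hbad⟩ := hnotAC
  rw [tendsto_atTop]
  intro K
  obtain ⟨L, hL⟩ := exists_nat_gt (K * 4 / ε)
  have hLk : (0 : ℝ) < L + k := by
    have : (0 : ℝ) < k := by exact_mod_cast (by omega : 0 < k)
    positivity
  obtain ⟨n, a, b, hab, hdisj, hlen, hvar⟩ := hbad (s * ε / (8 * (L + k))) (by positivity)
  have hlim : Tendsto (fun j => ∑ i, (((Finset.Icc 1 (Nj j)).filter fun m =>
      x m ∈ Set.Ioc (a i) (b i)).card : ℝ) / Nj j) atTop (nhds (∑ i, |G (b i) - G (a i)|)) := by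
    refine tendsto_finsetSum _ fun i _ => ?_
    obtain ⟨h₀, h₁, h₂⟩ := hab i
    refine Tendsto.congr (fun j => ?_)
      ((hG (b i) ⟨h₀.trans h₁, h₂⟩).sub (hG (a i) ⟨h₀, h₁.trans h₂⟩)).abs
    rw [card_filter_Ioc_eq x _ h₁, ← sub_div, abs_div, Nat.abs_cast]
  have hNj : Tendsto (fun j => (n : ℝ) * (L + k) / Nj j) atTop (nhds 0) :=
    (tendsto_natCast_atTop_atTop.comp hmono.tendsto_atTop).const_div_atTop _
  filter_upwards [hlim.eventually_const_lt (show ε * (3 / 4) < _ by linarith),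
    hNj.eventually_lt_const (show 0 < ε / 8 by positivity)] with j hj₁ hj₂
  refine le_trans ?_
    (mul_sub_le_Rcorr_of_intervals hk (hpos j) L x hs a b (fun i => (hab i).2.1) hdisj)
  have hN : (0 : ℝ) < Nj j := by exact_mod_cast hpos j
  rw [← Finset.sum_div] at hj₁
  set C := ∑ i, (((Finset.Icc 1 (Nj j)).filter fun m => x m ∈ Set.Ioc (a i) (b i)).card : ℝ)
  set ℓ := ∑ i, (b i - a i)
  have hℓ : ℓ * (L + k) / s < ε / 8 := by
    rw [lt_div_iff₀ (by positivity)] at hlen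
    rw [div_lt_iff₀ hs]
    linarith
  have hrw : (L : ℝ) * (C - (ℓ * Nj j / s + n) * (L + k)) / Nj j =
      L * (C / Nj j - (ℓ * (L + k) / s + n * (L + k) / Nj j)) := by
    field_simp
  rw [hrw]
  rw [div_lt_iff₀ hε] at hL
  calc K ≤ L * (ε / 4) := by linarith
    _ ≤ _ := by gcongr; linarith
end

section
/- Let k ≥ 2, (x_n)_{n≥1} ⊆ [0,1], and let G : [0,1] → ℝ be an asymptotic distribution function of (x_n) along a strictly increasing sequence (N_j) of positive integers. Suppose G is absolutely continuous with G(x) = ∫_0^x g(u) du for a nonnegative measurable density g. Then limsup_{s→∞} (limsup_{j→∞} R_k(s,N_j)) / (2s)^{k-1} ≥ ∫_0^1 g(x)^k dx; that is, for every real number c < ∫_0^1 g(x)^k dx (the integral possibly being +∞) and every S > 0 there exists s > S with limsup_{j→∞} R_k(s,N_j) ≥ c·(2s)^{k-1}. -/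
open Finset Filter MeasureTheory
open scoped Classical ENNReal NNReal

theorem sq_card_mul_le_sum_card_close {ι : Type*} (T : Finset ι) (f : ι → ℤ) (A B : ℤ)
    (hA : ∀ i ∈ T, A ≤ f i) (hB : ∀ i ∈ T, f i ≤ B) (M : ℕ) (hAB : A ≤ B) :
    ((M : ℝ) * T.card) ^ 2 ≤
      ((B : ℝ) - A + M) * ∑ m ∈ Finset.Icc 1 M, ∑ i ∈ T,
        ((T.filter fun j => |f i - f j| < (m : ℤ)).card : ℝ) := by
  set Q : Finset ℤ := Finset.Ioc (A - M) B with hQ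
  have hwin : ∀ i ∈ T, Finset.Ioc (f i - M) (f i) ⊆ Q := fun i hi =>
    Finset.Ioc_subset_Ioc (by linarith [hA i hi]) (hB i hi)
  have hind : ∀ i ∈ T, ∑ t ∈ Q, (if t ∈ Finset.Ioc (f i - M) (f i) then (1 : ℝ) else 0) = M := by
    intro i hi
    rw [← Finset.sum_filter, Finset.filter_mem_eq_inter, Finset.inter_eq_right.2 (hwin i hi)]
    simp
  have hpair : ∀ i ∈ T, ∀ j ∈ T,
      ∑ t ∈ Q, (if t ∈ Finset.Ioc (f i - M) (f i) then (1 : ℝ) else 0) *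
        (if t ∈ Finset.Ioc (f j - M) (f j) then (1 : ℝ) else 0) =
      ∑ m ∈ Finset.Icc 1 M, (if |f i - f j| < (m : ℤ) then (1 : ℝ) else 0) := by
    intro i hi j hj
    have h1 : ∀ t : ℤ, (if t ∈ Finset.Ioc (f i - M) (f i) then (1 : ℝ) else 0) *
        (if t ∈ Finset.Ioc (f j - M) (f j) then (1 : ℝ) else 0) =
        if t ∈ Finset.Ioc (f i - M) (f i) ∩ Finset.Ioc (f j - M) (f j) then 1 else 0 := by
      intro t
      simp only [Finset.mem_inter]
      split_ifs <;> simp_all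
    simp only [h1]
    rw [← Finset.sum_filter, ← Finset.sum_filter, Finset.filter_mem_eq_inter,
      Finset.inter_eq_right.2 (Finset.inter_subset_left.trans (hwin i hi))]
    have h2 : (Finset.Icc 1 M).filter (fun m : ℕ => |f i - f j| < (m : ℤ)) =
        Finset.Ioc (f i - f j).natAbs M := by
      ext m
      simp only [Finset.mem_filter, Finset.mem_Icc, Finset.mem_Ioc, Int.abs_eq_natAbs]
      omega
    have h3 : Finset.Ioc (f i - M) (f i) ∩ Finset.Ioc (f j - M) (f j) =
        Finset.Ioc (max (f i) (f j) - M) (min (f i) (f j)) := by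
      ext t
      simp only [Finset.mem_inter, Finset.mem_Ioc]
      omega
    rw [h2, h3]
    simp only [Finset.sum_const, Int.card_Ioc, Nat.card_Ioc, nsmul_eq_mul, mul_one]
    congr 1
    omega
  have hsum : ∑ t ∈ Q, ∑ i ∈ T, (if t ∈ Finset.Ioc (f i - M) (f i) then (1 : ℝ) else 0) =
      M * T.card := by
    rw [Finset.sum_comm, Finset.sum_congr rfl hind]
    simp [mul_comm]
  have hsq : ∑ t ∈ Q, (∑ i ∈ T, (if t ∈ Finset.Ioc (f i - M) (f i) then (1 : ℝ) else 0)) ^ 2 =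
      ∑ m ∈ Finset.Icc 1 M, ∑ i ∈ T,
        ((T.filter fun j => |f i - f j| < (m : ℤ)).card : ℝ) := by
    simp only [sq, Finset.sum_mul_sum]
    rw [Finset.sum_comm, Finset.sum_comm (s := Finset.Icc 1 M)]
    refine Finset.sum_congr rfl fun i hi => ?_
    rw [Finset.sum_comm]
    rw [Finset.sum_congr rfl fun j hj => hpair i hi j hj, Finset.sum_comm]
    refine Finset.sum_congr rfl fun m _ => ?_
    simp
  have hcard : (Q.card : ℝ) = (B : ℝ) - A + M := by
    have : ((Q.card : ℤ) : ℝ) = ((B - A + M : ℤ) : ℝ) := by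
      rw [hQ, Int.card_Ioc, Int.toNat_of_nonneg (by omega)]
      congr 1
      ring
    simpa using this
  rw [← hsum, ← hsq, ← hcard]
  exact sq_sum_le_card_mul_sum_sq

theorem sum_Icc_one_natCast (M : ℕ) :
    ∑ m ∈ Finset.Icc 1 M, (m : ℝ) = (M : ℝ) * (M + 1) / 2 := by
  induction M with
  | zero => simp
  | succ n ih =>
    rw [Finset.sum_Icc_succ_top (by omega), ih]
    push_cast
    ring

theorem weighted_jensen {ι : Type*} (T : Finset ι) (M q : ℕ) (y : ℕ → ι → ℝ)
    (hy : ∀ m i, 0 ≤ y m i) (v : ℝ) (hv : 0 ≤ v)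
    (h : v * (T.card * ((M : ℝ) * (M + 1) / 2)) ≤ ∑ m ∈ Finset.Icc 1 M, ∑ i ∈ T, y m i) :
    (T.card * ((M : ℝ) * (M + 1) / 2)) * v ^ q ≤
      ∑ m ∈ Finset.Icc 1 M, (m : ℝ) * ∑ i ∈ T, (y m i / m) ^ q := by
  set W : ℝ := T.card * ((M : ℝ) * (M + 1) / 2) with hW
  have hW0 : 0 ≤ W := by positivity
  have hrhs : 0 ≤ ∑ m ∈ Finset.Icc 1 M, (m : ℝ) * ∑ i ∈ T, (y m i / m) ^ q :=
    Finset.sum_nonneg fun m _ => mul_nonneg (by positivity) (Finset.sum_nonneg fun i _ =>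
      pow_nonneg (div_nonneg (hy m i) (by positivity)) _)
  rcases hW0.eq_or_lt with h0 | hWpos
  · rw [← h0, zero_mul]
    exact hrhs
  have hw : ∑ z ∈ Finset.Icc 1 M ×ˢ T, (z.1 : ℝ) / W = 1 := by
    rw [← Finset.sum_div, Finset.sum_product]
    simp only [Finset.sum_const, nsmul_eq_mul]
    rw [← Finset.mul_sum, sum_Icc_one_natCast, div_self hWpos.ne']
  have hj := Real.pow_arith_mean_le_arith_mean_pow (Finset.Icc 1 M ×ˢ T)
    (fun z => (z.1 : ℝ) / W) (fun z => y z.1 z.2 / z.1) (fun z _ => by positivity) hw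
    (fun z _ => div_nonneg (hy _ _) (by positivity)) q
  have hmean : v ≤ ∑ z ∈ Finset.Icc 1 M ×ˢ T, (z.1 : ℝ) / W * (y z.1 z.2 / z.1) := by
    have : ∑ z ∈ Finset.Icc 1 M ×ˢ T, (z.1 : ℝ) / W * (y z.1 z.2 / z.1) =
        (∑ m ∈ Finset.Icc 1 M, ∑ i ∈ T, y m i) / W := by
      rw [← Finset.sum_product', Finset.sum_div]
      refine Finset.sum_congr rfl fun z hz => ?_
      have : (z.1 : ℝ) ≠ 0 := by
        have := (Finset.mem_Icc.1 (Finset.mem_product.1 hz).1).1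
        positivity
      field_simp
    rw [this, le_div_iff₀ hWpos]
    exact h
  have hfin := (pow_le_pow_left₀ hv hmean q).trans hj
  calc W * v ^ q ≤ W * ∑ z ∈ Finset.Icc 1 M ×ˢ T, (z.1 : ℝ) / W * (y z.1 z.2 / z.1) ^ q := by
        gcongr
    _ = _ := by
        simp only [Finset.mul_sum]
        rw [← Finset.sum_product']
        refine Finset.sum_congr rfl fun z _ => ?_
        field_simp

theorem sum_pow_card_le_card_injective_tuples (q N : ℕ) (R : ℕ → ℕ → Prop) [DecidableRel R] (C : ℕ → Finset ℕ)
    (hC : ∀ i ∈ Finset.Icc 1 N, ∀ j ∈ C i, j ∈ Finset.Icc 1 N ∧ R i j) :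
    ∑ i ∈ Finset.Icc 1 N, ((C i).card - q) ^ q ≤
      ((Fintype.piFinset fun _ : Fin (q + 1) => Finset.Icc 1 N).filter fun i : Fin (q + 1) → ℕ =>
        Function.Injective i ∧ ∀ r : Fin q, R (i 0) (i r.succ)).card := by
  have h1 : ∀ i, ((C i).card - q) ^ q ≤ Fintype.card (Fin q ↪ ↥((C i).erase i)) := by
    intro i
    rw [Fintype.card_embedding_eq, Fintype.card_fin, Fintype.card_coe]
    refine le_trans (Nat.pow_le_pow_left ?_ q) (Nat.pow_sub_le_descFactorial _ q)
    have := Finset.pred_card_le_card_erase (s := C i) (a := i)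
    omega
  calc ∑ i ∈ Finset.Icc 1 N, ((C i).card - q) ^ q
      ≤ ∑ i ∈ Finset.Icc 1 N, Fintype.card (Fin q ↪ ↥((C i).erase i)) :=
        Finset.sum_le_sum fun i _ => h1 i
    _ = ((Finset.Icc 1 N).sigma fun i =>
          (Finset.univ : Finset (Fin q ↪ ↥((C i).erase i)))).card := by
        rw [Finset.card_sigma]
        rfl
    _ ≤ _ := by
        refine Finset.card_le_card_of_injOn
          (fun z => (Fin.cons z.1 (fun r => (z.2 r : ℕ)) : Fin (q + 1) → ℕ)) ?_ ?_
        · rintro ⟨i, e⟩ hz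
          have hi : i ∈ Finset.Icc 1 N := (Finset.mem_sigma.1 hz).1
          have he : ∀ r, (e r : ℕ) ≠ i ∧ (e r : ℕ) ∈ C i := fun r =>
            Finset.mem_erase.1 (e r).2
          simp only [Finset.coe_filter, Set.mem_ofPred_eq, Fintype.mem_piFinset, Fin.cons_zero,
            Fin.cons_succ]
          refine ⟨fun a => ?_, ?_, fun r => (hC i hi _ (he r).2).2⟩
          · refine Fin.cases ?_ (fun r => ?_) a
            · simpa using hi
            · simpa using (hC i hi _ (he r).2).1
          · rw [Fin.cons_injective_iff]
            refine ⟨?_, fun a b hab => e.injective (Subtype.ext hab)⟩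
            rintro ⟨r, hr⟩
            exact (he r).1 hr
        · rintro ⟨i, e⟩ - ⟨i', e'⟩ - h
          obtain ⟨rfl, h2⟩ := Fin.cons_inj.1 h
          congr 1
          ext r
          exact congrFun h2 r

theorem sum_cell_pow_le_sum_Rcorr (q n L M N : ℕ) (hn : 1 ≤ n) (hL : 1 ≤ L)
    (hN : 1 ≤ N) (x : ℕ → ℝ) :
    ((M : ℝ) * (M + 1) / 2) * ∑ l ∈ Finset.range n,
      ((((Finset.Icc 1 N).filter fun i => ⌈x i * n⌉₊ = l + 1).card : ℝ) / N) *
        (max 0 (2 / (M + 1) *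
          (M * ((Finset.Icc 1 N).filter fun i => ⌈x i * n⌉₊ = l + 1).card /
            ((N : ℝ) / (n * L) + M + 1) - q))) ^ q ≤
      ∑ m ∈ Finset.Icc 1 M, (m : ℝ) * (Rcorr x (q + 1) N (fun _ => m * L) / (m : ℝ) ^ q) := by
  set T : ℕ → Finset ℕ := fun l => (Finset.Icc 1 N).filter fun i => ⌈x i * n⌉₊ = l + 1 with hT
  set f : ℕ → ℤ := fun i => ⌊x i * N / L⌋ with hf
  set D : ℝ := (N : ℝ) / (n * L) + M + 1 with hD
  have hn0 : (0 : ℝ) < n := by positivity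
  have hL0 : (0 : ℝ) < L := by positivity
  have hN0 : (0 : ℝ) < N := by positivity
  have hD0 : 0 < D := by positivity
  set C : ℕ → ℕ → Finset ℕ := fun m i =>
    (Finset.Icc 1 N).filter fun j => ⌈x j * n⌉₊ = ⌈x i * n⌉₊ ∧ |f i - f j| < (m : ℤ) with hC
  have hCT : ∀ l, ∀ m : ℕ, ∀ i ∈ T l, (T l).filter (fun j => |f i - f j| < (m : ℤ)) = C m i := by
    intro l m i hi
    have : ⌈x i * n⌉₊ = l + 1 := (Finset.mem_filter.1 hi).2
    ext j
    simp only [hT, hC, Finset.mem_filter, this]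
    tauto
  have hcell : ∀ l, (T l).card * ((M : ℝ) * (M + 1) / 2) *
      (max 0 (2 / (M + 1) * (M * (T l).card / D - q))) ^ q ≤
      ∑ m ∈ Finset.Icc 1 M, (m : ℝ) * ∑ i ∈ T l, ((((C m i).card - q : ℕ) : ℝ) / m) ^ q := by
    intro l
    have hmem : ∀ i ∈ T l, (l : ℝ) < x i * n ∧ x i * n ≤ l + 1 := by
      intro i hi
      have h := (Nat.ceil_eq_iff (by omega)).1 (Finset.mem_filter.1 hi).2
      simpa using h
    have hfe := sq_card_mul_le_sum_card_close (T l) f ⌊(l : ℝ) / n * N / L⌋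
      ⌊((l : ℝ) + 1) / n * N / L⌋
      (fun i hi => Int.floor_le_floor (by
        have := (hmem i hi).1
        have h2 : (l : ℝ) / n ≤ x i := by rw [div_le_iff₀ hn0]; exact this.le
        gcongr))
      (fun i hi => Int.floor_le_floor (by
        have := (hmem i hi).2
        have h2 : x i ≤ ((l : ℝ) + 1) / n := by rw [le_div_iff₀ hn0]; exact this
        gcongr)) M (Int.floor_le_floor (by gcongr; linarith))
    have hcong : ∑ m ∈ Finset.Icc 1 M, ∑ i ∈ T l,
        (((T l).filter fun j => |f i - f j| < (m : ℤ)).card : ℝ) =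
        ∑ m ∈ Finset.Icc 1 M, ∑ i ∈ T l, ((C m i).card : ℝ) :=
      Finset.sum_congr rfl fun m _ => Finset.sum_congr rfl fun i hi => by rw [hCT l m i hi]
    rw [hcong] at hfe
    have hDle : ((⌊((l : ℝ) + 1) / n * N / L⌋ : ℤ) : ℝ) - (⌊(l : ℝ) / n * N / L⌋ : ℤ) + M ≤ D := by
      have h1 := Int.floor_le (((l : ℝ) + 1) / n * N / L)
      have h2 := Int.lt_floor_add_one ((l : ℝ) / n * N / L)
      have h3 : ((l : ℝ) + 1) / n * N / L = (l : ℝ) / n * N / L + (N : ℝ) / (n * L) := by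
        field_simp
      rw [hD]
      linarith
    have hfe2 : ((M : ℝ) * (T l).card) ^ 2 / D ≤
        ∑ m ∈ Finset.Icc 1 M, ∑ i ∈ T l, ((C m i).card : ℝ) := by
      rw [div_le_iff₀' hD0]
      refine hfe.trans (mul_le_mul_of_nonneg_right hDle ?_)
      exact Finset.sum_nonneg fun m _ => Finset.sum_nonneg fun i _ => Nat.cast_nonneg _
    have hlow : ∑ m ∈ Finset.Icc 1 M, ∑ i ∈ T l, ((C m i).card : ℝ) - q * (M * (T l).card) ≤
        ∑ m ∈ Finset.Icc 1 M, ∑ i ∈ T l, (((C m i).card - q : ℕ) : ℝ) := by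
      have : (q : ℝ) * (M * (T l).card) = ∑ m ∈ Finset.Icc 1 M, ∑ i ∈ T l, (q : ℝ) := by
        simp
        ring
      rw [this, ← Finset.sum_sub_distrib]
      refine Finset.sum_le_sum fun m _ => ?_
      rw [← Finset.sum_sub_distrib]
      refine Finset.sum_le_sum fun i _ => ?_
      rw [sub_le_iff_le_add]
      exact_mod_cast (by omega : (C m i).card ≤ (C m i).card - q + q)
    refine weighted_jensen (T l) M q (fun m i => (((C m i).card - q : ℕ) : ℝ))
      (fun _ _ => Nat.cast_nonneg _) _ (le_max_left _ _) ?_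
    rw [max_mul_of_nonneg _ _ (by positivity), zero_mul]
    refine max_le (by positivity) (le_trans (le_of_eq ?_) ((sub_le_sub_right hfe2 _).trans hlow))
    field_simp
  have hR : ∀ m, ∑ l ∈ Finset.range n, ∑ i ∈ T l, (((C m i).card - q : ℕ) : ℝ) ^ q ≤
      N * Rcorr x (q + 1) N (fun _ => m * L) := by
    intro m
    have h1 : ∑ l ∈ Finset.range n, ∑ i ∈ T l, (((C m i).card - q : ℕ) : ℝ) ^ q ≤
        ∑ i ∈ Finset.Icc 1 N, (((C m i).card - q : ℕ) : ℝ) ^ q := by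
      rw [← Finset.sum_biUnion]
      · refine Finset.sum_le_sum_of_subset_of_nonneg ?_ fun _ _ _ => by positivity
        intro i hi
        obtain ⟨l, -, hl⟩ := Finset.mem_biUnion.1 hi
        exact (Finset.mem_filter.1 hl).1
      · intro l _ l' _ hne
        refine Finset.disjoint_left.2 fun i hi hi' => hne ?_
        have := (Finset.mem_filter.1 hi).2
        have := (Finset.mem_filter.1 hi').2
        omega
    have h2 := sum_pow_card_le_card_injective_tuples q N
      (fun i j => nint (x i - x j) ≤ (m * L : ℝ) / N) (C m) (by
        intro i _ j hj
        obtain ⟨hj1, -, hj2⟩ := Finset.mem_filter.1 hj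
        refine ⟨hj1, ?_⟩
        have hr : nint (x i - x j) ≤ |x i - x j| := by
          simpa [nint] using round_le (x i - x j) 0
        refine hr.trans ?_
        have a1 := Int.floor_le (x i * N / L)
        have a2 := Int.lt_floor_add_one (x i * N / L)
        have b1 := Int.floor_le (x j * N / L)
        have b2 := Int.lt_floor_add_one (x j * N / L)
        obtain ⟨c1, c2⟩ := abs_lt.1 hj2
        have c1' : -(m : ℝ) + 1 ≤ (f i : ℝ) - f j := by
          exact_mod_cast (by omega : -(m : ℤ) + 1 ≤ f i - f j)
        have c2' : (f i : ℝ) - f j + 1 ≤ m := by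
          exact_mod_cast (by omega : f i - f j + 1 ≤ (m : ℤ))
        have key : |(x i - x j) * N / L| ≤ m := by
          have : (x i - x j) * N / L = x i * N / L - x j * N / L := by ring
          rw [this, abs_le]
          simp only [hf] at c1' c2'
          constructor <;> linarith
        rw [abs_div, abs_mul, abs_of_pos hN0, abs_of_pos hL0, div_le_iff₀ hL0] at key
        rwa [le_div_iff₀ hN0])
    refine h1.trans ?_
    have h3 : (N : ℝ) * Rcorr x (q + 1) N (fun _ => m * L) =
      (((Fintype.piFinset fun _ : Fin (q + 1) => Finset.Icc 1 N).filter
        fun i : Fin (q + 1) → ℕ => Function.Injective i ∧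
          ∀ r : Fin q, nint (x (i 0) - x (i r.succ)) ≤ (m * L : ℝ) / N).card : ℝ) := by
      rw [Rcorr, mul_div_cancel₀ _ hN0.ne']
      rfl
    rw [h3]
    exact_mod_cast h2
  have hpull : ∀ m ∈ Finset.Icc 1 M, ∑ l ∈ Finset.range n,
      (m : ℝ) * ∑ i ∈ T l, ((((C m i).card - q : ℕ) : ℝ) / m) ^ q ≤
      N * ((m : ℝ) * (Rcorr x (q + 1) N (fun _ => m * L) / (m : ℝ) ^ q)) := by
    intro m _
    simp only [div_pow]
    simp only [← Finset.sum_div, ← Finset.mul_sum]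
    calc (m : ℝ) * ((∑ l ∈ Finset.range n, ∑ i ∈ T l, (((C m i).card - q : ℕ) : ℝ) ^ q) /
          (m : ℝ) ^ q)
        ≤ (m : ℝ) * ((N * Rcorr x (q + 1) N (fun _ => m * L)) / (m : ℝ) ^ q) := by
          gcongr
          exact hR m
      _ = _ := by ring
  refine le_of_mul_le_mul_left ?_ hN0
  calc (N : ℝ) * (((M : ℝ) * (M + 1) / 2) * ∑ l ∈ Finset.range n,
        (((T l).card : ℝ) / N) * (max 0 (2 / (M + 1) * (M * (T l).card / D - q))) ^ q)
      = ∑ l ∈ Finset.range n, (T l).card * ((M : ℝ) * (M + 1) / 2) *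
        (max 0 (2 / (M + 1) * (M * (T l).card / D - q))) ^ q := by
        simp only [Finset.mul_sum]
        refine Finset.sum_congr rfl fun l _ => ?_
        field_simp
    _ ≤ ∑ l ∈ Finset.range n, ∑ m ∈ Finset.Icc 1 M,
          (m : ℝ) * ∑ i ∈ T l, ((((C m i).card - q : ℕ) : ℝ) / m) ^ q :=
        Finset.sum_le_sum fun l _ => hcell l
    _ ≤ _ := by
        rw [Finset.sum_comm, Finset.mul_sum]
        exact Finset.sum_le_sum hpull

theorem lintegral_cell_average_pow_le (q : ℕ) (g : ℝ → ℝ) (N : ℕ) (hN : 1 ≤ N) :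
    ∫⁻ t in Set.Ioc (0 : ℝ) 1, ENNReal.ofReal
        ((N * ∫ u in (((⌈t * N⌉ : ℤ) : ℝ) - 1) / N..((⌈t * N⌉ : ℤ) : ℝ) / N, g u) ^ q) ≤
      ∑ l ∈ Finset.range N, ENNReal.ofReal
        ((N * ∫ u in (l : ℝ) / N..((l : ℝ) + 1) / N, g u) ^ q) * ENNReal.ofReal (1 / N) := by
  have hN0 : (0 : ℝ) < N := by positivity
  have hsub : Set.Ioc (0 : ℝ) 1 ⊆
      ⋃ l : Fin N, Set.Ioc (((l : ℕ) : ℝ) / N) ((((l : ℕ) : ℝ) + 1) / N) := by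
    intro t ht
    have h1 : 0 < ⌈t * N⌉₊ := Nat.ceil_pos.2 (mul_pos ht.1 hN0)
    have h2 : ⌈t * N⌉₊ ≤ N := Nat.ceil_le.2 (by nlinarith [ht.2])
    refine Set.mem_iUnion.2 ⟨⟨⌈t * N⌉₊ - 1, by omega⟩, ?_⟩
    have h3 := (Nat.ceil_eq_iff h1.ne').1 (rfl : ⌈t * N⌉₊ = ⌈t * N⌉₊)
    refine ⟨by rw [div_lt_iff₀ hN0]; exact h3.1, ?_⟩
    rw [le_div_iff₀ hN0]
    have h4 : (((⌈t * N⌉₊ - 1 : ℕ) : ℝ)) + 1 = ⌈t * N⌉₊ := by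
      exact_mod_cast (by omega : ⌈t * N⌉₊ - 1 + 1 = ⌈t * N⌉₊)
    simp only [h4]
    exact h3.2
  refine (lintegral_mono_set hsub).trans ((lintegral_iUnion_le _ _).trans ?_)
  rw [tsum_fintype, Finset.sum_range (fun l : ℕ => ENNReal.ofReal
        ((N * ∫ u in (l : ℝ) / N..((l : ℝ) + 1) / N, g u) ^ q) * ENNReal.ofReal (1 / N))]
  refine Finset.sum_le_sum fun l _ => le_of_eq ?_
  have hc : ∀ t ∈ Set.Ioc (((l : ℕ) : ℝ) / N) ((((l : ℕ) : ℝ) + 1) / N),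
      ENNReal.ofReal
        ((N * ∫ u in (((⌈t * N⌉ : ℤ) : ℝ) - 1) / N..((⌈t * N⌉ : ℤ) : ℝ) / N, g u) ^ q) =
      ENNReal.ofReal
        ((N * ∫ u in ((l : ℕ) : ℝ) / N..(((l : ℕ) : ℝ) + 1) / N, g u) ^ q) := by
    intro t ht
    have : ⌈t * N⌉ = ((l : ℕ) : ℤ) + 1 := by
      rw [Int.ceil_eq_iff]
      have h1 := ht.1
      have h2 := ht.2
      rw [div_lt_iff₀ hN0] at h1
      rw [le_div_iff₀ hN0] at h2
      push_cast
      exact ⟨by linarith, h2⟩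
    rw [this]
    push_cast
    rw [add_sub_cancel_right]
  rw [setLIntegral_congr_fun measurableSet_Ioc hc, lintegral_const, Measure.restrict_apply_univ,
    Real.volume_Ioc]
  congr 2
  ring

theorem ae_tendsto_cell_average (g : ℝ → ℝ) (hg : LocallyIntegrable g volume) :
    ∀ᵐ t : ℝ, Tendsto (fun n : ℕ => ((n + 1 : ℕ) : ℝ) *
      ∫ u in (((⌈t * (n + 1 : ℕ)⌉ : ℤ) : ℝ) - 1) / (n + 1 : ℕ)..
        ((⌈t * (n + 1 : ℕ)⌉ : ℤ) : ℝ) / (n + 1 : ℕ), g u) atTop (nhds (g t)) := by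
  filter_upwards [IsUnifLocDoublingMeasure.ae_tendsto_average volume hg 1] with t ht
  have hball : ∀ n : ℕ, Metric.closedBall
      ((((⌈t * (n + 1 : ℕ)⌉ : ℤ) : ℝ) - 1 / 2) / (n + 1 : ℕ)) (1 / 2 / (n + 1 : ℕ)) =
      Set.Icc ((((⌈t * (n + 1 : ℕ)⌉ : ℤ) : ℝ) - 1) / (n + 1 : ℕ))
        (((⌈t * (n + 1 : ℕ)⌉ : ℤ) : ℝ) / (n + 1 : ℕ)) := by
    intro n
    rw [Real.closedBall_eq_Icc]
    congr 1 <;> ring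
  have hlim := ht (l := atTop)
    (fun n : ℕ => (((⌈t * (n + 1 : ℕ)⌉ : ℤ) : ℝ) - 1 / 2) / (n + 1 : ℕ))
    (fun n : ℕ => 1 / 2 / ((n + 1 : ℕ) : ℝ)) (by
      refine tendsto_nhdsWithin_iff.2 ⟨?_, Eventually.of_forall fun n => by
        simp only [Set.mem_Ioi]; positivity⟩
      exact (tendsto_const_div_atTop_nhds_zero_nat (1 / 2 : ℝ)).comp (tendsto_add_atTop_nat 1)) (by
      refine Eventually.of_forall fun n => ?_
      rw [one_mul, hball]
      have h0 : (0 : ℝ) < ((n + 1 : ℕ) : ℝ) := by positivity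
      have h1 := Int.ceil_lt_add_one (t * (n + 1 : ℕ))
      have h2 := Int.le_ceil (t * (n + 1 : ℕ))
      exact ⟨by rw [div_le_iff₀ h0]; linarith, by rw [le_div_iff₀ h0]; exact h2⟩)
  refine hlim.congr fun n => ?_
  have h0 : (0 : ℝ) < ((n + 1 : ℕ) : ℝ) := by positivity
  have hle : (((⌈t * (n + 1 : ℕ)⌉ : ℤ) : ℝ) - 1) / (n + 1 : ℕ) ≤
      ((⌈t * (n + 1 : ℕ)⌉ : ℤ) : ℝ) / (n + 1 : ℕ) := by
    gcongr
    linarith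
  rw [hball, setAverage_eq, intervalIntegral.integral_of_le hle, integral_Icc_eq_integral_Ioc,
    Real.volume_real_Icc_of_le hle, smul_eq_mul]
  congr 1
  rw [← sub_div, sub_sub_cancel, one_div, inv_inv]

theorem exists_lt_sum_cell_pow (q : ℕ) (g : ℝ → ℝ) (hg_nonneg : ∀ u, 0 ≤ g u)
    (hg_int : IntegrableOn g (Set.Icc (0 : ℝ) 1)) (c : ℝ)
    (hc : (c : EReal) <
      ((∫⁻ u in Set.Icc (0:ℝ) 1, ENNReal.ofReal (g u ^ (q + 1)) : ℝ≥0∞) : EReal)) :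
    ∃ n : ℕ, 1 ≤ n ∧ c < ∑ l ∈ Finset.range n,
      (∫ u in (l : ℝ) / n..((l : ℝ) + 1) / n, g u) *
        (n * ∫ u in (l : ℝ) / n..((l : ℝ) + 1) / n, g u) ^ q := by
  by_contra! hcon
  set h : ℝ → ℝ := (Set.Icc (0 : ℝ) 1).indicator g with hh
  have h_int : Integrable h := hg_int.integrable_indicator measurableSet_Icc
  have hp : ∀ n l : ℕ, 0 ≤ ∫ u in (l : ℝ) / n..((l : ℝ) + 1) / n, g u := fun n l =>
    intervalIntegral.integral_nonneg_of_forall (by gcongr; linarith) hg_nonneg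
  have hc0 : 0 ≤ c := le_trans (Finset.sum_nonneg fun l _ =>
    mul_nonneg (hp 1 l) (pow_nonneg (mul_nonneg (by positivity) (hp 1 l)) _)) (hcon 1 le_rfl)
  have hgh : ∀ N : ℕ, 1 ≤ N → ∀ l ∈ Finset.range N,
      ∫ u in (l : ℝ) / N..((l : ℝ) + 1) / N, h u = ∫ u in (l : ℝ) / N..((l : ℝ) + 1) / N, g u := by
    intro N hN l hl
    have hN0 : (0 : ℝ) < N := by positivity
    refine intervalIntegral.integral_congr fun u hu => Set.indicator_of_mem ?_ g
    rw [Set.uIcc_of_le (by gcongr; linarith)] at hu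
    refine ⟨le_trans (by positivity) hu.1, hu.2.trans ?_⟩
    rw [div_le_one hN0]
    exact_mod_cast Finset.mem_range.1 hl
  set φ : ℕ → ℝ → ℝ≥0∞ := fun n t => ENNReal.ofReal
    ((((n + 1 : ℕ) : ℝ) * ∫ u in (((⌈t * (n + 1 : ℕ)⌉ : ℤ) : ℝ) - 1) / (n + 1 : ℕ)..
        ((⌈t * (n + 1 : ℕ)⌉ : ℤ) : ℝ) / (n + 1 : ℕ), h u) ^ (q + 1)) with hφ
  have hbound : ∀ n, ∫⁻ t in Set.Ioc (0 : ℝ) 1, φ n t ≤ ENNReal.ofReal c := by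
    intro n
    have hN0 : (0 : ℝ) < (n + 1 : ℕ) := by positivity
    refine (lintegral_cell_average_pow_le (q + 1) h (n + 1) (by omega)).trans ?_
    refine le_trans (le_of_eq ?_) (ENNReal.ofReal_le_ofReal (hcon (n + 1) (by omega)))
    rw [ENNReal.ofReal_sum_of_nonneg fun l _ =>
      mul_nonneg (hp _ l) (pow_nonneg (mul_nonneg (by positivity) (hp _ l)) _)]
    refine Finset.sum_congr rfl fun l hl => ?_
    rw [hgh (n + 1) (by omega) l hl, ← ENNReal.ofReal_mul
      (pow_nonneg (mul_nonneg (by positivity) (hp _ l)) _)]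
    congr 1
    rw [pow_succ]
    field_simp
  have hmeas : ∀ n, Measurable (φ n) := by
    intro n
    have h1 : Measurable fun t : ℝ => ⌈t * (n + 1 : ℕ)⌉ :=
      Int.measurable_ceil.comp (measurable_id.mul_const _)
    exact (measurable_from_top (f := fun z : ℤ => ENNReal.ofReal
      ((((n + 1 : ℕ) : ℝ) * ∫ u in ((z : ℝ) - 1) / (n + 1 : ℕ)..
        (z : ℝ) / (n + 1 : ℕ), h u) ^ (q + 1)))).comp h1
  have hlim : ∀ᵐ t ∂(volume.restrict (Set.Ioc (0 : ℝ) 1)),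
      ENNReal.ofReal (g t ^ (q + 1)) = liminf (fun n => φ n t) atTop := by
    filter_upwards [ae_restrict_of_ae (ae_tendsto_cell_average h h_int.locallyIntegrable),
      ae_restrict_mem measurableSet_Ioc] with t ht htm
    have h1 : h t = g t := Set.indicator_of_mem (Set.Ioc_subset_Icc_self htm) g
    rw [h1] at ht
    exact ((ENNReal.tendsto_ofReal (ht.pow (q + 1))).liminf_eq).symm
  have hle : ∫⁻ u in Set.Icc (0:ℝ) 1, ENNReal.ofReal (g u ^ (q + 1)) ≤ ENNReal.ofReal c := by
    rw [← restrict_Ioc_eq_restrict_Icc, lintegral_congr_ae hlim]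
    refine (lintegral_liminf_le hmeas).trans ?_
    refine (liminf_le_liminf (Eventually.of_forall hbound)).trans ?_
    simp
  have := hc.trans_le (EReal.coe_ennreal_le_coe_ennreal_iff.2 hle)
  rw [EReal.coe_ennreal_ofReal, max_eq_left hc0] at this
  exact lt_irrefl _ this

theorem tendsto_card_cell (x : ℕ → ℝ) (Nj : ℕ → ℕ) (G g : ℝ → ℝ)
    (hg_int : IntegrableOn g (Set.Icc (0 : ℝ) 1))
    (hGg : ∀ t ∈ Set.Icc (0 : ℝ) 1, G t = ∫ u in (0:ℝ)..t, g u)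
    (hG : ∀ t ∈ Set.Icc (0 : ℝ) 1,
      Tendsto (fun j : ℕ =>
          (((Finset.Icc 1 (Nj j)).filter fun n => x n ≤ t).card : ℝ) / (Nj j))
        atTop (nhds (G t)))
    (n l : ℕ) (hl : l < n) :
    Tendsto (fun j : ℕ =>
        (((Finset.Icc 1 (Nj j)).filter fun i => ⌈x i * n⌉₊ = l + 1).card : ℝ) / (Nj j))
      atTop (nhds (∫ u in (l : ℝ) / n..((l : ℝ) + 1) / n, g u)) := by
  have hn0 : (0 : ℝ) < n := by
    have : 0 < n := by omega
    positivity
  have hab : (l : ℝ) / n ≤ ((l : ℝ) + 1) / n := by gcongr; linarith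
  have hb : ((l : ℝ) + 1) / n ∈ Set.Icc (0 : ℝ) 1 := by
    refine ⟨by positivity, ?_⟩
    rw [div_le_one hn0]
    exact_mod_cast hl
  have ha : (l : ℝ) / n ∈ Set.Icc (0 : ℝ) 1 := ⟨by positivity, hab.trans hb.2⟩
  have hii : ∀ t ∈ Set.Icc (0 : ℝ) 1, IntervalIntegrable g volume 0 t := fun t ht =>
    (intervalIntegrable_iff_integrableOn_Icc_of_le ht.1).2
      (hg_int.mono_set (Set.Icc_subset_Icc_right ht.2))
  rw [← intervalIntegral.integral_interval_sub_left (hii _ hb) (hii _ ha), ← hGg _ hb, ← hGg _ ha]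
  refine ((hG _ hb).sub (hG _ ha)).congr fun j => ?_
  rw [← sub_div]
  congr 1
  have hsdiff : ((Finset.Icc 1 (Nj j)).filter fun i => ⌈x i * n⌉₊ = l + 1) =
      ((Finset.Icc 1 (Nj j)).filter fun i => x i ≤ ((l : ℝ) + 1) / n) \
        ((Finset.Icc 1 (Nj j)).filter fun i => x i ≤ (l : ℝ) / n) := by
    ext i
    simp only [Finset.mem_filter, Finset.mem_sdiff, not_and, not_le,
      Nat.ceil_eq_iff (Nat.succ_ne_zero l), le_div_iff₀ hn0]
    push_cast
    tauto
  have hsub : ((Finset.Icc 1 (Nj j)).filter fun i => x i ≤ (l : ℝ) / n) ⊆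
      ((Finset.Icc 1 (Nj j)).filter fun i => x i ≤ ((l : ℝ) + 1) / n) :=
    Finset.monotone_filter_right _ fun i _ hi => le_trans hi hab
  rw [hsdiff, Finset.cast_card_sdiff hsub]

/-- If `G` is an asymptotic distribution function of `(x_n)` along `(N_j)` and
`G` is absolutely continuous with nonnegative density `g`, then
`limsup_{s→∞} (limsup_j R_k(s,N_j))/(2s)^{k-1} ≥ ∫_0^1 g^k`: for every real `c` smaller than
`∫_0^1 g(x)^k dx` (possibly `+∞`) and every `S > 0` there is `s > S` with
`limsup_j R_k(s,N_j) ≥ c·(2s)^{k-1}`. -/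
theorem limsup_Rk_ge_integral_density_pow
    (k : ℕ) (hk : 2 ≤ k) (x : ℕ → ℝ) (hx : ∀ n, x n ∈ Set.Icc (0 : ℝ) 1)
    (Nj : ℕ → ℕ) (hmono : StrictMono Nj) (hpos : ∀ j, 1 ≤ Nj j)
    (G : ℝ → ℝ) (g : ℝ → ℝ) (hg_meas : Measurable g) (hg_nonneg : ∀ u, 0 ≤ g u)
    (hg_int : IntegrableOn g (Set.Icc (0 : ℝ) 1))
    (hGg : ∀ t ∈ Set.Icc (0 : ℝ) 1, G t = ∫ u in (0:ℝ)..t, g u)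
    (hG : ∀ t ∈ Set.Icc (0 : ℝ) 1,
      Tendsto (fun j : ℕ =>
          (((Finset.Icc 1 (Nj j)).filter fun n => x n ≤ t).card : ℝ) / (Nj j))
        atTop (nhds (G t))) :
    ∀ c : ℝ,
      (c : EReal) < ((∫⁻ u in Set.Icc (0:ℝ) 1, ENNReal.ofReal (g u ^ k) : ℝ≥0∞) : EReal) →
      ∀ S : ℝ, 0 < S → ∃ s : ℝ, S < s ∧
        ENNReal.ofReal (c * (2 * s) ^ (k - 1)) ≤
          Filter.limsup (fun j : ℕ => ENNReal.ofReal (Rcorr x k (Nj j) fun _ => s)) atTop := by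
  obtain ⟨q, rfl⟩ : ∃ q, k = q + 1 := ⟨k - 1, by omega⟩
  simp only [Nat.add_sub_cancel]
  intro c hc S hS
  obtain ⟨n, hn, hcn⟩ := exists_lt_sum_cell_pow q g hg_nonneg hg_int c hc
  set p : ℕ → ℝ := fun l => ∫ u in (l : ℝ) / n..((l : ℝ) + 1) / n, g u with hp
  obtain ⟨L, hSL⟩ := exists_nat_gt S
  have hL0 : (0 : ℝ) < L := hS.trans hSL
  have hL : 1 ≤ L := by exact_mod_cast hL0
  have hn0 : (0 : ℝ) < n := by positivity
  have hp0 : ∀ l, 0 ≤ p l := fun l =>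
    intervalIntegral.integral_nonneg_of_forall (by gcongr; linarith) hg_nonneg
  obtain ⟨M, hM, hM1⟩ : ∃ M : ℕ, c * (2 * (L : ℝ)) ^ q < ∑ l ∈ Finset.range n,
      p l * (max 0 (2 / ((M : ℝ) + 1) * (M * p l / (1 / ((n : ℝ) * L)) - q))) ^ q ∧ 1 ≤ M := by
    have hlim : Tendsto (fun M : ℕ => ∑ l ∈ Finset.range n,
        p l * (max 0 (2 / ((M : ℝ) + 1) * (M * p l / (1 / ((n : ℝ) * L)) - q))) ^ q) atTop
        (nhds (∑ l ∈ Finset.range n, p l * (max 0 (2 * (p l * (n * L)) * 1 - 2 * q * 0)) ^ q)) := by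
      refine tendsto_finsetSum _ fun l _ => Tendsto.const_mul _ (Tendsto.pow
        (tendsto_const_nhds.max ?_) _)
      have h1 := (tendsto_natCast_div_add_atTop (1 : ℝ)).const_mul (2 * (p l * (n * L)))
      have h2 := (tendsto_one_div_add_atTop_nhds_zero_nat (𝕜 := ℝ)).const_mul (2 * (q : ℝ))
      refine (h1.sub h2).congr fun M => ?_
      field_simp
    have hval : c * (2 * (L : ℝ)) ^ q <
        ∑ l ∈ Finset.range n, p l * (max 0 (2 * (p l * (n * L)) * 1 - 2 * q * 0)) ^ q := by
      refine (mul_lt_mul_of_pos_right hcn (by positivity : 0 < (2 * (L : ℝ)) ^ q)).trans_le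
        (le_of_eq ?_)
      rw [Finset.sum_mul]
      refine Finset.sum_congr rfl fun l _ => ?_
      have := hp0 l
      rw [mul_one, mul_zero, sub_zero, max_eq_right (by positivity), mul_assoc, ← mul_pow]
      congr 2
      ring
    exact ((hlim.eventually_const_lt hval).and (eventually_ge_atTop 1)).exists
  by_contra! hcon
  have hev : ∀ᶠ j in atTop, ∀ m ∈ Finset.Icc 1 M,
      Rcorr x (q + 1) (Nj j) (fun _ => m * L) < c * (2 * (m * L)) ^ q := by
    rw [Filter.eventually_all_finset]
    intro m hm
    have hm1 : (1 : ℝ) ≤ m := by exact_mod_cast (Finset.mem_Icc.1 hm).1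
    have h := hcon (m * L) (hSL.trans_le (le_mul_of_one_le_left hL0.le hm1))
    filter_upwards [eventually_lt_of_limsup_lt h] with j hj
    exact (ENNReal.ofReal_lt_ofReal_iff'.1 hj).1
  have hNlim : Tendsto (fun j => ((Nj j : ℕ) : ℝ)) atTop atTop :=
    tendsto_natCast_atTop_atTop.comp hmono.tendsto_atTop
  have hlimj : Tendsto (fun j : ℕ => ∑ l ∈ Finset.range n,
      ((((Finset.Icc 1 (Nj j)).filter fun i => ⌈x i * n⌉₊ = l + 1).card : ℝ) / (Nj j)) *
        (max 0 (2 / ((M : ℝ) + 1) *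
          (M * ((Finset.Icc 1 (Nj j)).filter fun i => ⌈x i * n⌉₊ = l + 1).card /
            ((Nj j : ℝ) / (n * L) + M + 1) - q))) ^ q) atTop
      (nhds (∑ l ∈ Finset.range n,
        p l * (max 0 (2 / ((M : ℝ) + 1) * (M * p l / (1 / ((n : ℝ) * L)) - q))) ^ q)) := by
    refine tendsto_finsetSum _ fun l hl => ?_
    have hcell := tendsto_card_cell x Nj G g hg_int hGg hG n l (Finset.mem_range.1 hl)
    refine hcell.mul (Tendsto.pow (tendsto_const_nhds.max (Tendsto.const_mul _
      (Tendsto.sub_const ?_ _))) _)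
    have hden : Tendsto (fun j => 1 / ((n : ℝ) * L) + ((M : ℝ) + 1) / (Nj j)) atTop
        (nhds (1 / ((n : ℝ) * L))) := by
      simpa using (hNlim.const_div_atTop ((M : ℝ) + 1)).const_add (1 / ((n : ℝ) * L))
    refine ((hcell.const_mul (M : ℝ)).div hden (by positivity)).congr fun j => ?_
    have hN0 : (0 : ℝ) < Nj j := by
      have := hpos j
      positivity
    simp only [Pi.div_apply]
    generalize ((Finset.Icc 1 (Nj j)).filter fun i => ⌈x i * n⌉₊ = l + 1).card = P
    field_simp
    ring
  obtain ⟨j, hj1, hj2⟩ := (hev.and (hlimj.eventually_const_lt hM)).exists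
  have hkey := sum_cell_pow_le_sum_Rcorr q n L M (Nj j) hn hL (hpos j) x
  have hupper : ∑ m ∈ Finset.Icc 1 M,
      (m : ℝ) * (Rcorr x (q + 1) (Nj j) (fun _ => m * L) / (m : ℝ) ^ q) ≤
      ((M : ℝ) * (M + 1) / 2) * (c * (2 * (L : ℝ)) ^ q) := by
    rw [← sum_Icc_one_natCast, Finset.sum_mul]
    refine Finset.sum_le_sum fun m hm => ?_
    have hm0 : (0 : ℝ) < m := by exact_mod_cast (Finset.mem_Icc.1 hm).1
    gcongr
    rw [div_le_iff₀ (by positivity)]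
    refine (hj1 m hm).le.trans (le_of_eq ?_)
    rw [mul_assoc, ← mul_pow]
    congr 2
    ring
  have hMpos : (0 : ℝ) < (M : ℝ) * (M + 1) / 2 := by positivity
  exact absurd (hkey.trans hupper) (not_le.2 (mul_lt_mul_of_pos_left hj2 hMpos))
end

section
/- There exists a strictly increasing sequence 𝒜 = (a_n)_{n≥1} of positive integers with additive energy E(𝒜_N) = o(N^3) as N → ∞, such that for Lebesgue almost all x ∈ [0,1] and for every integer k ≥ 2, the sequence ({a_n x})_{n≥1} of fractional parts does not have Poissonian k-th order correlations. -/
open Finset Filter MeasureTheory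
open scoped Classical ENNReal NNReal

/-- The additive energy of the first `N` elements `a 1, …, a N` of the sequence `a`. -/
def addEnergy (a : ℕ → ℕ) (N : ℕ) : ℕ :=
  (((Finset.Icc 1 N) ×ˢ (Finset.Icc 1 N) ×ˢ (Finset.Icc 1 N) ×ˢ (Finset.Icc 1 N)).filter
    fun q => a q.1 + a q.2.1 = a q.2.2.1 + a q.2.2.2).card

/-- The points `x` for which some `q ≤ Q` has `q x` just above an integer. -/
def nearRational (m Q : ℕ) : Set ℝ :=
  {x | ∃ q : ℕ, 1 ≤ q ∧ q ≤ Q ∧ Int.fract ((q : ℝ) * x) < 1 / ((m : ℝ) * Q)}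

lemma measurableSet_nearRational (m Q : ℕ) : MeasurableSet (nearRational m Q) := by
  have : nearRational m Q = ⋃ q ∈ Set.Icc 1 Q,
      (fun x : ℝ => Int.fract ((q : ℝ) * x)) ⁻¹' Set.Iio (1 / ((m : ℝ) * Q)) := by
    ext x; simp [nearRational, and_assoc]
  rw [this]
  refine MeasurableSet.biUnion (Set.to_countable _) fun q _ => ?_
  exact (measurable_fract.comp (measurable_const_mul _)) measurableSet_Iio

lemma add_int_mem_nearRational_iff (m Q : ℕ) (x : ℝ) (z : ℤ) :
    x + z ∈ nearRational m Q ↔ x ∈ nearRational m Q := by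
  have h (q : ℕ) : Int.fract ((q : ℝ) * (x + z)) = Int.fract ((q : ℝ) * x) := by
    rw [mul_add, show (q : ℝ) * (z : ℝ) = ((q * z : ℤ) : ℝ) by push_cast; ring,
      Int.fract_add_intCast]
  simp only [nearRational, Set.mem_ofPred_eq, h]

lemma volume_Ico_int_inter {B : Set ℝ} (hB : ∀ (x : ℝ) (z : ℤ), x + z ∈ B ↔ x ∈ B) (z : ℤ) :
    volume (Set.Ico (z : ℝ) (z + 1) ∩ B) = volume (Set.Ico (0 : ℝ) 1 ∩ B) := by
  rw [← measure_preimage_add_right volume (z : ℝ) (Set.Ico (z : ℝ) (z + 1) ∩ B)]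
  congr 1
  ext x
  simp only [Set.mem_preimage, Set.mem_inter_iff, Set.mem_Ico, hB]
  constructor <;> rintro ⟨⟨h1, h2⟩, h3⟩ <;> exact ⟨⟨by linarith, by linarith⟩, h3⟩

lemma one_div_den_mul_den_le_sub {r s : ℚ} (h : r < s) :
    1 / ((r.den : ℝ) * s.den) ≤ (s : ℝ) - r := by
  have hr : (0 : ℝ) < r.den := by exact_mod_cast r.pos
  have hs : (0 : ℝ) < s.den := by exact_mod_cast s.pos
  have h1 : r.num * s.den + 1 ≤ s.num * r.den := (Rat.lt_iff r s).1 h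
  have h2 : (r.num : ℝ) * s.den + 1 ≤ s.num * r.den := by exact_mod_cast h1
  rw [Rat.cast_def r, Rat.cast_def s, div_sub_div _ _ hs.ne' hr.ne', mul_comm (s.den : ℝ) r.den,
    div_le_div_iff_of_pos_right (by positivity)]
  linarith

lemma finite_setOf_den_le (Q : ℕ) : {r : ℚ | 0 ≤ r ∧ r ≤ 1 ∧ r.den ≤ Q}.Finite := by
  refine ((range (Q + 1) ×ˢ range (Q + 1)).image
    fun p : ℕ × ℕ => (p.1 : ℚ) / p.2).finite_toSet.subset ?_
  rintro r ⟨h0, h1, hQ⟩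
  have hn : 0 ≤ r.num := Rat.num_nonneg.2 h0
  have hle : r.num ≤ r.den := by
    have := (Rat.le_iff r 1).1 h1
    simpa using this
  simp only [coe_image, Set.mem_image, mem_coe, mem_product, mem_range, Prod.exists]
  refine ⟨r.num.toNat, r.den, ⟨by omega, by omega⟩, ?_⟩
  have : ((r.num.toNat : ℕ) : ℚ) = (r.num : ℚ) := by
    exact_mod_cast congrArg (Int.cast : ℤ → ℚ) (Int.toNat_of_nonneg hn)
  rw [this, Rat.num_div_den]

lemma Ico_subset_iUnion_closedBall (Q : ℕ) (hQ : 0 < Q) :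
    Set.Ico (0 : ℝ) 1 ⊆ ⋃ r ∈ (finite_setOf_den_le Q).toFinset,
      Metric.closedBall (r : ℝ) (1 / ((Q + 1) * r.den)) := by
  intro y hy
  obtain ⟨r, hr, hd⟩ := Real.exists_rat_abs_sub_le_and_den_le y hQ
  have hden : (0 : ℝ) < r.den := by exact_mod_cast r.pos
  have hQ' : (0 : ℝ) < Q := by exact_mod_cast hQ
  have hlt : 1 / (((Q : ℝ) + 1) * r.den) < 1 / r.den :=
    one_div_lt_one_div_of_lt hden (by nlinarith)
  have hnum : (r : ℝ) * r.den = r.num := by exact_mod_cast Rat.mul_den_eq_num r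
  have hab := abs_le.1 hr
  have h0 : 0 ≤ r := by
    have : (-1 : ℝ) < r.num := by
      rw [← hnum]
      have : -(1 / (r.den : ℝ)) < r := by linarith [hy.1]
      calc (-1 : ℝ) = -(1 / (r.den : ℝ)) * r.den := by field_simp
        _ < _ := by gcongr
    have : -1 < r.num := by exact_mod_cast this
    exact Rat.num_nonneg.1 (by omega)
  have h1 : r ≤ 1 := by
    have : (r.num : ℝ) < r.den + 1 := by
      rw [← hnum]
      have : (r : ℝ) < 1 + 1 / (r.den : ℝ) := by linarith [hy.2]
      calc (r : ℝ) * r.den < (1 + 1 / (r.den : ℝ)) * r.den := by gcongr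
        _ = _ := by field_simp
    have : r.num < r.den + 1 := by exact_mod_cast this
    refine (Rat.le_iff r 1).2 ?_
    simp; omega
  simp only [Set.mem_iUnion]
  refine ⟨r, by simpa using ⟨h0, h1, hd⟩, ?_⟩
  rwa [Metric.mem_closedBall, Real.dist_eq]

lemma volume_nearRational_ge (m Q : ℕ) (hm : 0 < m) (hQ : 0 < Q) :
    1 / (4 * (m : ℝ)) ≤ volume.real (Set.Ico (0 : ℝ) 1 ∩ nearRational m Q) := by
  set F := (finite_setOf_den_le Q).toFinset with hF
  have hQ' : (1 : ℝ) ≤ Q := by exact_mod_cast hQ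
  have hm' : (1 : ℝ) ≤ m := by exact_mod_cast hm
  have hden (r : ℚ) : (1 : ℝ) ≤ r.den := by exact_mod_cast r.pos
  let J : ℚ → Set ℝ := fun r => Set.Ico (r : ℝ) (r + 1 / (m * Q * r.den))
  have hJsub : (⋃ r ∈ F, J r) ⊆ (Set.Ico (0 : ℝ) 1 ∩ nearRational m Q) ∪
      (Set.Ico (1 : ℝ) (1 + 1) ∩ nearRational m Q) := by
    simp only [Set.iUnion_subset_iff]
    intro r hr x hx
    have hr' : 0 ≤ r ∧ r ≤ 1 ∧ r.den ≤ Q := by simpa [hF] using hr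
    have hd := hden r
    have h0 : (0 : ℝ) ≤ r := by exact_mod_cast hr'.1
    have h1 : (r : ℝ) ≤ 1 := by exact_mod_cast hr'.2.1
    have hlen : 1 / ((m : ℝ) * Q * r.den) ≤ 1 := by
      rw [div_le_one (by positivity)]
      exact one_le_mul_of_one_le_of_one_le (one_le_mul_of_one_le_of_one_le hm' hQ') hd
    have hnum : (r : ℝ) * r.den = r.num := by exact_mod_cast Rat.mul_den_eq_num r
    have hmem : x ∈ nearRational m Q := by
      refine ⟨r.den, r.pos, hr'.2.2, ?_⟩
      have hlo : (r.num : ℝ) ≤ r.den * x := by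
        rw [← hnum, mul_comm]; exact mul_le_mul_of_nonneg_left hx.1 (by linarith)
      have hhi : r.den * x < (r.num : ℝ) + 1 / (m * Q) := by
        have : r.den * x < r.den * (r + 1 / (m * Q * r.den)) :=
          mul_lt_mul_of_pos_left hx.2 (by linarith)
        rw [← hnum]
        refine this.trans_eq ?_
        field_simp
      have hfl : (r.num : ℝ) ≤ ⌊(r.den : ℝ) * x⌋ := by exact_mod_cast Int.le_floor.2 hlo
      rw [Int.fract]; linarith
    by_cases hx1 : x < 1
    · exact Or.inl ⟨⟨h0.trans hx.1, hx1⟩, hmem⟩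
    · exact Or.inr ⟨⟨not_lt.1 hx1, by linarith [hx.2]⟩, hmem⟩
  have hdisj : (F : Set ℚ).PairwiseDisjoint J := by
    have key (r s : ℚ) (hs : s.den ≤ Q) (h : r < s) : Disjoint (J r) (J s) := by
      rw [Set.disjoint_left]
      intro x hx hx'
      have h1 := one_div_den_mul_den_le_sub h
      have h2 : 1 / ((m : ℝ) * Q * r.den) ≤ 1 / ((r.den : ℝ) * s.den) := by
        have h3 : (s.den : ℝ) ≤ Q := by exact_mod_cast hs
        have := hden r
        have := hden s
        refine one_div_le_one_div_of_le (by positivity) ?_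
        calc (r.den : ℝ) * s.den ≤ r.den * (m * Q) := by
              gcongr; nlinarith
          _ = _ := by ring
      linarith [hx.2, hx'.1]
    intro r hr s hs hne
    have hr' : 0 ≤ r ∧ r ≤ 1 ∧ r.den ≤ Q := by simpa [hF] using hr
    have hs' : 0 ≤ s ∧ s ≤ 1 ∧ s.den ≤ Q := by simpa [hF] using hs
    rcases lt_or_gt_of_ne hne with h | h
    · exact key r s hs'.2.2 h
    · exact (key s r hr'.2.2 h).symm
  have hJvol : volume (⋃ r ∈ F, J r) = ∑ r ∈ F, volume (J r) :=
    measure_biUnion_finset hdisj fun r _ => measurableSet_Ico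
  have hcover : (1 : ℝ≥0∞) ≤ ∑ r ∈ F, ENNReal.ofReal (2 * (1 / ((Q + 1) * r.den))) := by
    calc (1 : ℝ≥0∞) = volume (Set.Ico (0 : ℝ) 1) := by simp
      _ ≤ volume (⋃ r ∈ F, Metric.closedBall (r : ℝ) (1 / ((Q + 1) * r.den))) :=
        measure_mono (Ico_subset_iUnion_closedBall Q hQ)
      _ ≤ ∑ r ∈ F, volume (Metric.closedBall (r : ℝ) (1 / ((Q + 1) * r.den))) :=
        measure_biUnion_finset_le _ _
      _ = _ := by simp only [Real.volume_closedBall]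
  have hle : (1 : ℝ≥0∞) ≤ ENNReal.ofReal (2 * m) * ∑ r ∈ F, volume (J r) := by
    refine hcover.trans ?_
    rw [Finset.mul_sum]
    refine Finset.sum_le_sum fun r _ => ?_
    simp only [J, Real.volume_Ico, add_sub_cancel_left]
    rw [← ENNReal.ofReal_mul (by positivity)]
    refine ENNReal.ofReal_le_ofReal ?_
    have := hden r
    rw [mul_one_div, mul_one_div, div_le_div_iff₀ (by positivity) (by positivity)]
    have : 0 ≤ (m : ℝ) * r.den := by positivity
    nlinarith
  have hper := volume_Ico_int_inter (add_int_mem_nearRational_iff m Q) 1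
  simp only [Int.cast_one] at hper
  have hfin : volume (Set.Ico (0 : ℝ) 1 ∩ nearRational m Q) ≠ ∞ :=
    ((measure_mono Set.inter_subset_left).trans_lt (by simp)).ne
  have hfinal : (1 : ℝ≥0∞) ≤
      ENNReal.ofReal (2 * m) * (volume (Set.Ico (0 : ℝ) 1 ∩ nearRational m Q) +
        volume (Set.Ico (0 : ℝ) 1 ∩ nearRational m Q)) := by
    refine hle.trans ?_
    gcongr
    rw [← hJvol]
    refine (measure_mono hJsub).trans ((measure_union_le _ _).trans ?_)
    rw [hper]
  have := ENNReal.toReal_mono (by finiteness) hfinal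
  rw [ENNReal.toReal_mul, ENNReal.toReal_add hfin hfin, ENNReal.toReal_ofReal (by positivity)]
    at this
  simp only [ENNReal.toReal_one] at this
  rw [div_le_iff₀ (by positivity), Measure.real]
  linarith

/-- Membership in `P` depends only on the cell `[a/d, (a+1)/d)` containing the point. -/
def IsCellular (d : ℕ) (P : Set ℝ) : Prop :=
  ∀ x y : ℝ, ⌊(d : ℝ) * x⌋ = ⌊(d : ℝ) * y⌋ → (x ∈ P ↔ y ∈ P)

lemma fract_mul_lt_one_div_iff {d e K f : ℕ} (hK : 0 < K) (hf : 0 < f) (hd : d = K * e * f)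
    (x : ℝ) : Int.fract ((e : ℝ) * x) < 1 / (K : ℝ) ↔
      ∃ p : ℤ, p * K * f ≤ ⌊(d : ℝ) * x⌋ ∧ ⌊(d : ℝ) * x⌋ < (p * K + 1) * f := by
  have hK' : (1 : ℝ) ≤ K := by exact_mod_cast hK
  have hf' : (0 : ℝ) < f := by exact_mod_cast hf
  have hdx : (d : ℝ) * x = K * f * (e * x) := by rw [hd]; push_cast; ring
  have hiff (p : ℤ) : (p * K * f ≤ ⌊(d : ℝ) * x⌋ ∧ ⌊(d : ℝ) * x⌋ < (p * K + 1) * f) ↔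
      ((p : ℝ) ≤ e * x ∧ e * x < p + 1 / K) := by
    rw [Int.le_floor, Int.floor_lt, hdx]
    push_cast
    rw [show (p : ℝ) * K * f = K * f * p by ring,
      show ((p : ℝ) * K + 1) * f = K * f * (p + 1 / K) by field_simp,
      mul_le_mul_iff_right₀ (by positivity), mul_lt_mul_iff_right₀ (by positivity)]
  simp only [hiff]
  constructor
  · intro h
    exact ⟨⌊(e : ℝ) * x⌋, Int.floor_le _, by rw [Int.fract] at h; linarith⟩
  · rintro ⟨p, h1, h2⟩
    have : (p : ℝ) ≤ ⌊(e : ℝ) * x⌋ := by exact_mod_cast Int.le_floor.2 h1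
    rw [Int.fract]; linarith

lemma isCellular_preimage_nearRational {m Q d e : ℕ} (hm : 0 < m) (hQ : 0 < Q) (hd : 0 < d)
    (h : e * (m * Q * Q.factorial) ∣ d) :
    IsCellular d {x | (e : ℝ) * x ∈ nearRational m Q} := by
  intro x y hxy
  simp only [nearRational, Set.mem_ofPred_eq]
  refine exists_congr fun q => and_congr_right fun hq1 => and_congr_right fun hq2 => ?_
  have hdvd : m * Q * (q * e) ∣ d := by
    refine Dvd.dvd.trans ?_ h
    calc m * Q * (q * e) ∣ m * Q * (Q.factorial * e) :=
          mul_dvd_mul_left _ (mul_dvd_mul_right (Nat.dvd_factorial hq1 hq2) _)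
      _ = e * (m * Q * Q.factorial) := by ring
  obtain ⟨f, hf⟩ := hdvd
  have hf0 : 0 < f := Nat.pos_of_ne_zero fun h0 => by simp [h0] at hf; omega
  have := fract_mul_lt_one_div_iff (Nat.mul_pos hm hQ) hf0 hf
  have hx := this x
  have hy := this y
  rw [← hxy, ← hx] at hy
  push_cast at hy
  simpa only [mul_assoc] using hy.symm

lemma volume_inter_preimage_mul {d : ℕ} (hd : 0 < d) {P B : Set ℝ} (hP : IsCellular d P)
    (hPm : MeasurableSet P) (hBm : MeasurableSet B)
    (hB : ∀ (x : ℝ) (z : ℤ), x + z ∈ B ↔ x ∈ B) :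
    volume (Set.Ico (0 : ℝ) 1 ∩ P ∩ {x | (d : ℝ) * x ∈ B}) =
      volume (Set.Ico (0 : ℝ) 1 ∩ P) * volume (Set.Ico (0 : ℝ) 1 ∩ B) := by
  have hd' : (0 : ℝ) < d := by exact_mod_cast hd
  let cell : ℕ → Set ℝ := fun a => {x | ⌊(d : ℝ) * x⌋ = a}
  have hcellm (a : ℕ) : MeasurableSet (cell a) :=
    (Int.measurable_floor.comp (measurable_const_mul (d : ℝ))) (measurableSet_singleton (a : ℤ))
  have hcover : Set.Ico (0 : ℝ) 1 = ⋃ a ∈ range d, cell a := by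
    ext x
    simp only [Set.mem_iUnion, mem_range, exists_prop, cell, Set.mem_ofPred_eq, Set.mem_Ico]
    constructor
    · rintro ⟨h0, h1⟩
      have hfl : 0 ≤ ⌊(d : ℝ) * x⌋ := Int.floor_nonneg.2 (by positivity)
      have hlt : ⌊(d : ℝ) * x⌋ < d := Int.floor_lt.2 (by push_cast; nlinarith)
      exact ⟨⌊(d : ℝ) * x⌋.toNat, by omega, by omega⟩
    · rintro ⟨a, had, ha⟩
      obtain ⟨h1, h2⟩ := Int.floor_eq_iff.1 ha
      push_cast at h1 h2
      have h3 : (a : ℝ) + 1 ≤ d := by exact_mod_cast had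
      exact ⟨nonneg_of_mul_nonneg_right (le_trans (by positivity) h1) hd',
        by by_contra! h; nlinarith⟩
  have hsplit (S : Set ℝ) (hS : MeasurableSet S) :
      volume (Set.Ico (0 : ℝ) 1 ∩ S) = ∑ a ∈ range d, volume (cell a ∩ S) := by
    rw [hcover, Set.iUnion₂_inter]
    refine measure_biUnion_finset ?_ fun a _ => (hcellm a).inter hS
    intro a _ b _ hab
    refine Set.disjoint_left.2 fun x hx hx' => hab ?_
    exact_mod_cast hx.1.symm.trans hx'.1
  have hcellB (a : ℕ) (C : Set ℝ) (hC : ∀ (x : ℝ) (z : ℤ), x + z ∈ C ↔ x ∈ C) :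
      volume (cell a ∩ {x | (d : ℝ) * x ∈ C}) =
        ENNReal.ofReal (d : ℝ)⁻¹ * volume (Set.Ico (0 : ℝ) 1 ∩ C) := by
    have : cell a ∩ {x | (d : ℝ) * x ∈ C} =
        ((d : ℝ) * ·) ⁻¹' (Set.Ico (((a : ℤ) : ℝ)) ((a : ℤ) + 1) ∩ C) := by
      ext x
      simp [cell, Int.floor_eq_iff]
    rw [this, Real.volume_preimage_mul_left hd'.ne', abs_of_pos (inv_pos.2 hd'),
      volume_Ico_int_inter hC]
  have hdBm : MeasurableSet {x | (d : ℝ) * x ∈ B} := measurable_const_mul (d : ℝ) hBm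
  rw [Set.inter_assoc, hsplit _ (hPm.inter hdBm), hsplit _ hPm, Finset.sum_mul]
  refine Finset.sum_congr rfl fun a _ => ?_
  by_cases ha : ∃ x ∈ cell a, x ∈ P
  · obtain ⟨x, hxa, hxP⟩ := ha
    have hsub : cell a ⊆ P := fun y hy => (hP x y (hxa.trans hy.symm)).1 hxP
    have hvol : volume (cell a) = ENNReal.ofReal (d : ℝ)⁻¹ := by
      have := hcellB a Set.univ (by simp)
      simpa using this
    rw [← Set.inter_assoc, Set.inter_eq_left.2 hsub, hcellB a B hB, hvol]
  · have hempty : cell a ∩ P = ∅ := by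
      ext x; simp only [Set.mem_inter_iff, Set.mem_empty_iff_false, iff_false]
      exact fun h => ha ⟨x, h.1, h.2⟩
    rw [← Set.inter_assoc, hempty]; simp

/-- The length of the clusters created at stage `j`. -/
def clusterSize (j : ℕ) : ℕ := 2 ^ Nat.log 8 j

/-- The largest denominator of the rationals used at stage `j`. -/
def denomBound (j : ℕ) : ℕ := 2 ^ (j - (2 * Nat.log 8 j + 1))

/-- The length of the arithmetic progressions making up stage `j`. -/
def blockLength (j : ℕ) : ℕ := 2 ^ (j - Nat.log 8 j)

/-- The common difference of the arithmetic progressions making up stage `j`. -/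
def blockStep (j : ℕ) : ℕ :=
  ∏ i ∈ range j, (4 * clusterSize i ^ 3 * denomBound i * (denomBound i).factorial)

/-- A sequence made, on `[2 ^ j, 2 ^ (j + 1))`, of arithmetic progressions of length
`blockLength j` and difference `blockStep j`, each starting above twice the previous term. -/
def blockSeq : ℕ → ℕ
  | 0 => 1
  | n + 1 => if blockLength (Nat.log 2 (n + 1)) ∣ n + 1 then 2 * blockSeq n + 1
      else blockSeq n + blockStep (Nat.log 2 (n + 1))

lemma clusterSize_pos (j : ℕ) : 0 < clusterSize j := by unfold clusterSize; positivity

lemma denomBound_pos (j : ℕ) : 0 < denomBound j := by unfold denomBound; positivity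

lemma blockLength_pos (j : ℕ) : 0 < blockLength j := by unfold blockLength; positivity

lemma blockStep_pos (j : ℕ) : 0 < blockStep j := by
  refine Finset.prod_pos fun i _ => ?_
  have := clusterSize_pos i
  have := denomBound_pos i
  positivity

lemma clusterSize_pow_three_le (j : ℕ) : clusterSize j ^ 3 ≤ j + 1 := by
  rw [clusterSize, ← pow_mul, mul_comm, pow_mul]
  rcases Nat.eq_zero_or_pos j with rfl | hj
  · simp
  · exact (Nat.pow_log_le_self 8 hj.ne').trans (Nat.le_succ j)

lemma two_mul_log_add_one_le {j : ℕ} (hj : 0 < j) : 2 * Nat.log 8 j + 1 ≤ j := by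
  have h1 : 8 ^ Nat.log 8 j ≤ j := Nat.pow_log_le_self 8 hj.ne'
  have h2 : ∀ t : ℕ, 2 * t + 1 ≤ 8 ^ t := fun t => by
    induction t with
    | zero => simp
    | succ t ih => rw [pow_succ]; omega
  exact (h2 _).trans h1

lemma blockLength_eq {j : ℕ} (hj : 0 < j) :
    blockLength j = 2 * (clusterSize j * denomBound j) := by
  have := two_mul_log_add_one_le hj
  rw [blockLength, clusterSize, denomBound, ← pow_add, ← pow_succ']
  congr 1; omega

lemma clusterSize_mul_blockLength (j : ℕ) : clusterSize j * blockLength j = 2 ^ j := by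
  rw [blockLength, clusterSize, ← pow_add]
  congr 1
  have := Nat.log_le_self 8 j
  omega

lemma tendsto_clusterSize : Tendsto clusterSize atTop atTop := by
  have h : Tendsto (fun j => Nat.log 8 j) atTop atTop :=
    tendsto_atTop_atTop.2 fun b => ⟨8 ^ b, fun a ha => Nat.le_log_of_pow_le (by norm_num) ha⟩
  exact (tendsto_pow_atTop_atTop_of_one_lt (by norm_num : 1 < 2)).comp h

lemma blockSeq_strictMono : StrictMono blockSeq := by
  refine strictMono_nat_of_lt_succ fun n => ?_
  rw [blockSeq]
  split_ifs
  · omega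
  · have := blockStep_pos (Nat.log 2 (n + 1)); omega

lemma blockSeq_pos (n : ℕ) : 0 < blockSeq n :=
  lt_of_lt_of_le (by simp [blockSeq]) (blockSeq_strictMono.monotone (Nat.zero_le n))

/-- The dyadic stage of `n` and the position of its block within that stage. -/
def blockIndex (n : ℕ) : ℕ × ℕ := (Nat.log 2 n, n / blockLength (Nat.log 2 n))

lemma two_mul_blockSeq_lt {m n : ℕ} (hmn : m < n) (h : blockIndex m ≠ blockIndex n) :
    2 * blockSeq m < blockSeq n := by
  have key (s : ℕ) (hms : m < s) (hsn : s ≤ n) (hs : blockLength (Nat.log 2 s) ∣ s) :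
      2 * blockSeq m < blockSeq n := by
    obtain ⟨t, rfl⟩ : ∃ t, s = t + 1 := ⟨s - 1, by omega⟩
    have h1 : blockSeq (t + 1) = 2 * blockSeq t + 1 := by rw [blockSeq, if_pos hs]
    have h2 := blockSeq_strictMono.monotone hsn
    have h3 := blockSeq_strictMono.monotone (show m ≤ t by omega)
    omega
  have hle : Nat.log 2 m ≤ Nat.log 2 n := Nat.log_mono_right hmn.le
  rcases hle.lt_or_eq with hlt | heq
  · refine key (2 ^ Nat.log 2 n) ?_ (Nat.pow_log_le_self 2 (by omega)) ?_
    · exact Nat.lt_pow_of_log_lt (by norm_num) hlt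
    · rw [Nat.log_pow (by norm_num)]
      exact pow_dvd_pow 2 (Nat.sub_le _ _)
  · set j := Nat.log 2 n with hj
    have hB := blockLength_pos j
    have hdiv : m / blockLength j < n / blockLength j := by
      refine lt_of_le_of_ne (Nat.div_le_div_right hmn.le) fun h' => h ?_
      simp only [blockIndex, heq, ← hj, h']
    have hms : m < n / blockLength j * blockLength j := (Nat.div_lt_iff_lt_mul hB).1 hdiv
    have hsn : n / blockLength j * blockLength j ≤ n := Nat.div_mul_le_self _ _
    refine key _ hms hsn ?_
    have hlog : Nat.log 2 (n / blockLength j * blockLength j) = j :=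
      le_antisymm (Nat.log_mono_right hsn) (heq.symm.le.trans (Nat.log_mono_right hms.le))
    rw [hlog]
    exact dvd_mul_left _ _

lemma blockSeq_add {j u s : ℕ} (hu : clusterSize j ≤ u) (hu' : u < 2 * clusterSize j)
    (hs : s < blockLength j) :
    blockSeq (u * blockLength j + s) = blockSeq (u * blockLength j) + s * blockStep j := by
  induction s with
  | zero => simp
  | succ s ih =>
    have hB := clusterSize_mul_blockLength j
    have hlog : Nat.log 2 (u * blockLength j + s + 1) = j := by
      rw [Nat.log_eq_iff (Or.inr ⟨by norm_num, by omega⟩), pow_succ, ← hB]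
      constructor <;> nlinarith
    have hnd : ¬ blockLength j ∣ u * blockLength j + s + 1 := by
      rw [add_assoc, Nat.dvd_add_right (dvd_mul_left _ _)]
      exact Nat.not_dvd_of_pos_of_lt (by omega) hs
    rw [← add_assoc, blockSeq, hlog, if_neg hnd, ih (by omega)]
    ring

lemma blockIndex_eq_of_add_eq_add {p q r s : ℕ}
    (h : blockSeq p + blockSeq q = blockSeq r + blockSeq s) :
    blockIndex p = blockIndex r ∨ blockIndex p = blockIndex s ∨
      blockIndex q = blockIndex r ∨ blockIndex q = blockIndex s := by
  have key (p q r s : ℕ) (h : blockSeq p + blockSeq q = blockSeq r + blockSeq s)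
      (hrp : r ≤ p) (hsp : s ≤ p) : blockIndex p = blockIndex r ∨ blockIndex p = blockIndex s := by
    by_contra! hne
    have h1 := two_mul_blockSeq_lt (lt_of_le_of_ne hrp fun e => hne.1 (by rw [e])) hne.1.symm
    have h2 := two_mul_blockSeq_lt (lt_of_le_of_ne hsp fun e => hne.2 (by rw [e])) hne.2.symm
    omega
  have h1 := key p q r s h
  have h2 := key q p r s (by omega)
  have h3 := key r s p q h.symm
  have h4 := key s r p q (by omega)
  simp only [eq_comm (a := blockIndex r), eq_comm (a := blockIndex s)] at h3 h4
  by_cases hr : r ≤ p <;> by_cases hs : s ≤ p <;> by_cases hr' : r ≤ q <;> by_cases hs' : s ≤ q <;>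
    by_cases hrs : r ≤ s <;> grind

lemma card_blockIndex_eq_le (n N : ℕ) :
    ((Icc 1 N).filter fun m => blockIndex n = blockIndex m).card ≤
      blockLength (Nat.log 2 n) := by
  set B := blockLength (Nat.log 2 n) with hB
  have hsub : ((Icc 1 N).filter fun m => blockIndex n = blockIndex m) ⊆
      Ico (n / B * B) (n / B * B + B) := by
    intro m hm
    simp only [mem_filter, blockIndex, Prod.mk.injEq] at hm
    obtain ⟨-, h1, h2⟩ := hm
    rw [← h1, ← hB] at h2
    have h3 := Nat.div_add_mod m B
    have h4 := Nat.mod_lt m (blockLength_pos (Nat.log 2 n))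
    rw [← hB] at h4
    rw [mem_Ico, h2, mul_comm]
    omega
  simpa using Finset.card_le_card hsub

lemma addEnergy_blockSeq_le (N : ℕ) :
    addEnergy blockSeq N ≤ 4 * (N * ∑ n ∈ Icc 1 N, blockLength (Nat.log 2 n)) := by
  set I := Icc 1 N
  let P : Finset (ℕ × ℕ) := (I ×ˢ I).filter fun p => blockIndex p.1 = blockIndex p.2
  have hP : P.card ≤ ∑ n ∈ I, blockLength (Nat.log 2 n) := by
    simp only [P]
    rw [Finset.card_filter, Finset.sum_product]
    refine Finset.sum_le_sum fun n _ => ?_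
    rw [← Finset.card_filter]
    exact card_blockIndex_eq_le n N
  set S := (I ×ˢ I ×ˢ I ×ˢ I).filter fun q =>
    blockSeq q.1 + blockSeq q.2.1 = blockSeq q.2.2.1 + blockSeq q.2.2.2 with hS
  have hSmem (q) (hq : q ∈ S) : (q.1 ∈ I ∧ q.2.1 ∈ I ∧ q.2.2.1 ∈ I ∧ q.2.2.2 ∈ I) ∧
      blockSeq q.1 + blockSeq q.2.1 = blockSeq q.2.2.1 + blockSeq q.2.2.2 := by
    simpa [hS] using hq
  have inj := blockSeq_strictMono.injective
  have bound (f g h : ℕ × ℕ × ℕ × ℕ → ℕ)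
      (hmem : ∀ q ∈ S, f q ∈ I ∧ g q ∈ I ∧ h q ∈ I)
      (hinj : ∀ q ∈ S, ∀ q' ∈ S, f q = f q' → g q = g q' → h q = h q' → q = q') :
      (S.filter fun q => blockIndex (g q) = blockIndex (h q)).card ≤ N * P.card := by
    have : N * P.card = (I ×ˢ P).card := by simp [I]
    rw [this]
    refine Finset.card_le_card_of_injOn (fun q => (f q, g q, h q)) ?_ ?_
    · intro q hq
      have hq' := mem_filter.1 hq
      have := hmem q hq'.1
      simp only [P, mem_coe, mem_product, mem_filter]
      exact ⟨this.1, this.2, hq'.2⟩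
    · intro q hq q' hq' e
      simp only [Prod.mk.injEq] at e
      exact hinj q (mem_filter.1 hq).1 q' (mem_filter.1 hq').1 e.1 e.2.1 e.2.2
  have b1 := bound (fun q => q.2.1) (fun q => q.1) (fun q => q.2.2.1)
    (fun q hq => by have := hSmem q hq; tauto) (by
      rintro ⟨a, b, c, e⟩ hq ⟨a', b', c', e'⟩ hq' rfl rfl rfl
      have h1 := (hSmem _ hq).2; have h2 := (hSmem _ hq').2
      simp only at h1 h2 ⊢
      rw [inj (show blockSeq e = blockSeq e' by omega)])
  have b2 := bound (fun q => q.2.1) (fun q => q.1) (fun q => q.2.2.2)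
    (fun q hq => by have := hSmem q hq; tauto) (by
      rintro ⟨a, b, c, e⟩ hq ⟨a', b', c', e'⟩ hq' rfl rfl rfl
      have h1 := (hSmem _ hq).2; have h2 := (hSmem _ hq').2
      simp only at h1 h2 ⊢
      rw [inj (show blockSeq c = blockSeq c' by omega)])
  have b3 := bound (fun q => q.1) (fun q => q.2.1) (fun q => q.2.2.1)
    (fun q hq => by have := hSmem q hq; tauto) (by
      rintro ⟨a, b, c, e⟩ hq ⟨a', b', c', e'⟩ hq' rfl rfl rfl
      have h1 := (hSmem _ hq).2; have h2 := (hSmem _ hq').2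
      simp only at h1 h2 ⊢
      rw [inj (show blockSeq e = blockSeq e' by omega)])
  have b4 := bound (fun q => q.1) (fun q => q.2.1) (fun q => q.2.2.2)
    (fun q hq => by have := hSmem q hq; tauto) (by
      rintro ⟨a, b, c, e⟩ hq ⟨a', b', c', e'⟩ hq' rfl rfl rfl
      have h1 := (hSmem _ hq).2; have h2 := (hSmem _ hq').2
      simp only at h1 h2 ⊢
      rw [inj (show blockSeq c = blockSeq c' by omega)])
  have hcover : S ⊆ (S.filter fun q => blockIndex q.1 = blockIndex q.2.2.1) ∪
      (S.filter fun q => blockIndex q.1 = blockIndex q.2.2.2) ∪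
      (S.filter fun q => blockIndex q.2.1 = blockIndex q.2.2.1) ∪
      (S.filter fun q => blockIndex q.2.1 = blockIndex q.2.2.2) := by
    intro q hq
    have := blockIndex_eq_of_add_eq_add (hSmem q hq).2
    simp only [mem_union, mem_filter]
    tauto
  have hcard := (Finset.card_le_card hcover).trans ((Finset.card_union_le _ _).trans
    (Nat.add_le_add_right ((Finset.card_union_le _ _).trans
      (Nat.add_le_add_right (Finset.card_union_le _ _) _)) _))
  have hE : addEnergy blockSeq N = S.card := by
    unfold _root_.addEnergy
    rw [hS]
  have := Nat.mul_le_mul_left N hP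
  rw [hE]
  omega

lemma tendsto_addEnergy_blockSeq :
    Tendsto (fun N : ℕ => (addEnergy blockSeq N : ℝ) / (N : ℝ) ^ 3) atTop (nhds 0) := by
  have hlog : Tendsto (fun n : ℕ => Nat.log 2 (n + 1)) atTop atTop :=
    tendsto_atTop_atTop.2 fun b => ⟨2 ^ b, fun a ha =>
      Nat.le_log_of_pow_le (by norm_num) (ha.trans (Nat.le_succ a))⟩
  have hu : Tendsto (fun n : ℕ => ((clusterSize (Nat.log 2 (n + 1)) : ℝ))⁻¹) atTop (nhds 0) :=
    tendsto_inv_atTop_zero.comp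
      (tendsto_natCast_atTop_atTop.comp (tendsto_clusterSize.comp hlog))
  have h4 := hu.cesaro.const_mul 4
  rw [mul_zero] at h4
  refine squeeze_zero (fun N => by positivity) (fun N => ?_) h4
  rcases Nat.eq_zero_or_pos N with rfl | hN
  · simp
  have hN' : (0 : ℝ) < N := by exact_mod_cast hN
  have hE : (addEnergy blockSeq N : ℝ) ≤
      4 * (N * ∑ n ∈ Icc 1 N, (blockLength (Nat.log 2 n) : ℝ)) := by
    exact_mod_cast addEnergy_blockSeq_le N
  have hsum : ∑ n ∈ Icc 1 N, (blockLength (Nat.log 2 n) : ℝ) ≤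
      N * ∑ n ∈ range N, ((clusterSize (Nat.log 2 (n + 1)) : ℝ))⁻¹ := by
    rw [Finset.mul_sum, Finset.range_eq_Ico,
      Finset.sum_Ico_add' (fun n => (N : ℝ) * ((clusterSize (Nat.log 2 n) : ℝ))⁻¹) 0 N 1]
    have : Ico (0 + 1) (N + 1) = Icc 1 N := by ext; simp
    rw [this]
    refine Finset.sum_le_sum fun n hn => ?_
    rw [mem_Icc] at hn
    have hC : (0 : ℝ) < clusterSize (Nat.log 2 n) := by exact_mod_cast clusterSize_pos _
    rw [← div_eq_mul_inv, le_div_iff₀ hC]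
    have h1 := clusterSize_mul_blockLength (Nat.log 2 n)
    have h2 := Nat.pow_log_le_self 2 (show n ≠ 0 by omega)
    have : blockLength (Nat.log 2 n) * clusterSize (Nat.log 2 n) ≤ N := by
      rw [mul_comm]; omega
    exact_mod_cast this
  rw [div_le_iff₀ (by positivity)]
  refine hE.trans ?_
  calc 4 * (N * ∑ n ∈ Icc 1 N, (blockLength (Nat.log 2 n) : ℝ))
      ≤ 4 * (N * (N * ∑ n ∈ range N, ((clusterSize (Nat.log 2 (n + 1)) : ℝ))⁻¹)) := by gcongr
    _ = _ := by field_simp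

/-- The points which `x ↦ blockStep j * x` moves close to rationals of small denominator. -/
def clusterSet (j : ℕ) : Set ℝ :=
  {x | (blockStep j : ℝ) * x ∈ nearRational (4 * clusterSize j ^ 3) (denomBound j)}

lemma measurableSet_clusterSet (j : ℕ) : MeasurableSet (clusterSet j) :=
  measurable_const_mul (blockStep j : ℝ) (measurableSet_nearRational _ _)

lemma isCellular_clusterSet {i j : ℕ} (hij : i < j) :
    IsCellular (blockStep j) (clusterSet i) := by
  have hC := clusterSize_pos i
  refine isCellular_preimage_nearRational (by positivity) (denomBound_pos i) (blockStep_pos j) ?_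
  have : blockStep i * (4 * clusterSize i ^ 3 * denomBound i * (denomBound i).factorial) =
      blockStep (i + 1) := by rw [blockStep, blockStep, Finset.prod_range_succ]
  rw [this]
  exact Finset.prod_dvd_prod_of_subset _ _ _ (by simpa using hij)

/-- The points avoiding the cluster sets with indices in `[m, n)`. -/
def avoidSet (m n : ℕ) : Set ℝ := {x | ∀ j, m ≤ j → j < n → x ∉ clusterSet j}

lemma volume_avoidSet_le (m n : ℕ) (hmn : m ≤ n) :
    volume (Set.Ico (0 : ℝ) 1 ∩ avoidSet m n) ≤
      ENNReal.ofReal (Real.exp (-∑ j ∈ Ico m n, 1 / (16 * ((j : ℝ) + 1)))) := by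
  induction n, hmn using Nat.le_induction with
  | base => exact (measure_mono Set.inter_subset_left).trans (by simp)
  | succ n hmn ih =>
    set G := nearRational (4 * clusterSize n ^ 3) (denomBound n) with hG
    have hstep : avoidSet m (n + 1) = avoidSet m n ∩ {x | (blockStep n : ℝ) * x ∈ Gᶜ} := by
      ext x
      simp only [avoidSet, Set.mem_inter_iff, Set.mem_ofPred_eq]
      constructor
      · exact fun h => ⟨fun j h1 h2 => h j h1 (by omega), h n hmn (by omega)⟩
      · rintro ⟨h1, h2⟩ j hj hj'
        rcases Nat.lt_succ_iff_lt_or_eq.1 hj' with h | rfl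
        · exact h1 j hj h
        · exact h2
    have hcell : IsCellular (blockStep n) (avoidSet m n) := by
      intro x y hxy
      simp only [avoidSet, Set.mem_ofPred_eq]
      exact forall_congr' fun j => forall_congr' fun _ => forall_congr' fun hj =>
        not_congr (isCellular_clusterSet hj x y hxy)
    have hmeas : MeasurableSet (avoidSet m n) := by
      have : avoidSet m n = ⋂ j ∈ Set.Ico m n, (clusterSet j)ᶜ := by
        ext x; simp [avoidSet]
      rw [this]
      exact MeasurableSet.biInter (Set.to_countable _) fun j _ => (measurableSet_clusterSet j).compl
    have hGm : MeasurableSet G := measurableSet_nearRational _ _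
    have hC := clusterSize_pos n
    have hle : volume (Set.Ico (0 : ℝ) 1 ∩ Gᶜ) ≤
        ENNReal.ofReal (Real.exp (-(1 / (16 * ((n : ℝ) + 1))))) := by
      have hge := volume_nearRational_ge (4 * clusterSize n ^ 3) (denomBound n) (by positivity)
        (denomBound_pos n)
      have hsplit : volume.real (Set.Ico (0 : ℝ) 1 ∩ G) + volume.real (Set.Ico (0 : ℝ) 1 ∩ Gᶜ) =
          1 := by
        have := measureReal_inter_add_sdiff (μ := volume) (s := Set.Ico (0 : ℝ) 1) hGm (by simp)
        rw [Set.sdiff_eq] at this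
        rw [this]; simp
      have h1 : 1 / (16 * ((n : ℝ) + 1)) ≤ 1 / (4 * ((4 * clusterSize n ^ 3 : ℕ) : ℝ)) := by
        have : ((clusterSize n : ℝ)) ^ 3 ≤ n + 1 := by exact_mod_cast clusterSize_pow_three_le n
        have hC' : (0 : ℝ) < clusterSize n := by exact_mod_cast hC
        refine one_div_le_one_div_of_le (by positivity) ?_
        push_cast; linarith
      have h2 := Real.add_one_le_exp (-(1 / (16 * ((n : ℝ) + 1))))
      have hfin : volume (Set.Ico (0 : ℝ) 1 ∩ Gᶜ) ≠ ∞ :=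
        ((measure_mono Set.inter_subset_left).trans_lt (by simp)).ne
      rw [← ENNReal.ofReal_toReal hfin]
      refine ENNReal.ofReal_le_ofReal ?_
      change volume.real _ ≤ _
      linarith
    have hper (x : ℝ) (z : ℤ) : x + z ∈ Gᶜ ↔ x ∈ Gᶜ :=
      not_congr (add_int_mem_nearRational_iff _ _ x z)
    rw [hstep, ← Set.inter_assoc,
      volume_inter_preimage_mul (blockStep_pos n) hcell hmeas hGm.compl hper,
      Finset.sum_Ico_succ_top hmn, neg_add, Real.exp_add, ENNReal.ofReal_mul (Real.exp_nonneg _)]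
    exact mul_le_mul' ih hle

lemma ae_frequently_mem_clusterSet :
    ∀ᵐ x ∂(volume.restrict (Set.Icc (0 : ℝ) 1)), ∃ᶠ j in atTop, x ∈ clusterSet j := by
  rw [← restrict_Ico_eq_restrict_Icc, ae_restrict_iff' measurableSet_Ico]
  have hnull (m : ℕ) : volume (Set.Ico (0 : ℝ) 1 ∩ ⋂ n, avoidSet m n) = 0 := by
    have hsum : Tendsto (fun n => ∑ j ∈ Ico m n, 1 / (16 * ((j : ℝ) + 1))) atTop atTop := by
      have h1 := (Real.tendsto_sum_range_one_div_nat_succ_atTop.const_mul_atTop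
        (show (0 : ℝ) < 1 / 16 by norm_num))
      have h2 := tendsto_atTop_add_const_right atTop
        (-∑ j ∈ range m, 1 / (16 * ((j : ℝ) + 1))) h1
      refine h2.congr' ?_
      filter_upwards [eventually_ge_atTop m] with n hn
      rw [Finset.sum_Ico_eq_sub _ hn, sub_eq_add_neg, Finset.mul_sum]
      congr 1
      refine Finset.sum_congr rfl fun j _ => ?_
      rw [one_div_mul_one_div]
    have hlim : Tendsto (fun n => ENNReal.ofReal
        (Real.exp (-∑ j ∈ Ico m n, 1 / (16 * ((j : ℝ) + 1))))) atTop (nhds 0) := by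
      rw [← ENNReal.ofReal_zero]
      exact ENNReal.tendsto_ofReal
        (Real.tendsto_exp_atBot.comp (tendsto_neg_atTop_atBot.comp hsum))
    refine le_antisymm (ge_of_tendsto hlim ?_) zero_le
    filter_upwards [eventually_ge_atTop m] with n hn
    exact (measure_mono (Set.inter_subset_inter_right _ (Set.iInter_subset _ n))).trans
      (volume_avoidSet_le m n hn)
  rw [ae_iff]
  refine measure_mono_null ?_ (measure_iUnion_null hnull)
  intro x hx
  simp only [Set.mem_ofPred_eq, Classical.not_imp, not_frequently, eventually_atTop] at hx
  obtain ⟨hx1, m, hm⟩ := hx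
  exact Set.mem_iUnion.2 ⟨m, hx1, Set.mem_iInter.2 fun n j hj _ => hm j hj⟩

lemma sdist_fract_sub_fract {α β φ : ℝ} {z : ℤ} (h : α - β = φ + z) (h0 : 0 ≤ φ)
    (h1 : φ ≤ 1 / 2) : sdist (Int.fract α - Int.fract β) = φ := by
  have : Int.fract (Int.fract α - Int.fract β) = φ := by
    refine Int.fract_eq_iff.2 ⟨h0, by linarith, z - ⌊α⌋ + ⌊β⌋, ?_⟩
    simp only [Int.fract]
    push_cast
    linarith
  rw [sdist, this, if_pos h1]

lemma le_corrBoxCount_of_mem_clusterSet {j k : ℕ} (hj : 0 < j) (hk : 2 ≤ k) {x : ℝ}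
    (hx : x ∈ clusterSet j) :
    2 ^ (j - 1) * (clusterSize j - k) ≤
      corrBoxCount (fun n => Int.fract ((blockSeq n : ℝ) * x)) k (2 ^ (j + 1))
        (fun _ => 0) (fun _ => 1) := by
  obtain ⟨q, hq1, hqQ, hq⟩ := hx
  set C := clusterSize j with hC
  set Q := denomBound j with hQ
  set B := blockLength j with hB
  set d := blockStep j
  have hC0 : 0 < C := clusterSize_pos j
  have hQ0 : 0 < Q := denomBound_pos j
  have hBeq : B = 2 * (C * Q) := blockLength_eq hj
  have hCB : C * B = 2 ^ j := clusterSize_mul_blockLength j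
  have hCq : C * q ≤ C * Q := Nat.mul_le_mul_left _ hqQ
  have hcard : (Ico C (2 * C) ×ˢ range (C * Q) ×ˢ range (C - k)).card = 2 ^ (j - 1) * (C - k) := by
    have : C * (C * Q) = 2 ^ (j - 1) := by
      have : 2 * (C * (C * Q)) = 2 * 2 ^ (j - 1) := by
        rw [← pow_succ', Nat.sub_add_cancel hj, ← hCB, hBeq]; ring
      omega
    simp only [card_product, Nat.card_Ico, card_range]
    rw [show 2 * C - C = C by omega, ← mul_assoc, this]
  rw [← hcard, corrBoxCount]
  let off : ℕ → Fin k → ℕ := fun v r => if r.1 = 0 then 0 else v + r.1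
  have hoff (v : ℕ) (hv : v < C - k) (r : Fin k) : off v r * q ≤ C * q := by
    refine Nat.mul_le_mul_right _ ?_
    have := r.2
    simp only [off]; split_ifs <;> omega
  refine Finset.card_le_card_of_injOn
    (fun p r => p.1 * B + (C * Q + p.2.1 - off p.2.2 r * q)) ?_ ?_
  · rintro ⟨u, s, v⟩ hp
    simp only [coe_product, Set.mem_prod, mem_coe, mem_Ico, mem_range] at hp
    obtain ⟨⟨hu1, hu2⟩, hs, hv⟩ := hp
    have hval (r : Fin k) : (blockSeq (u * B + (C * Q + s - off v r * q)) : ℝ) =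
        blockSeq (u * B) + ((C * Q + s : ℝ) - off v r * q) * d := by
      have := hoff v hv r
      rw [blockSeq_add hu1 hu2 (by omega)]
      push_cast [Nat.cast_sub (show off v r * q ≤ C * Q + s by omega)]
      ring
    simp only [coe_filter, Fintype.mem_piFinset, mem_Icc, Set.mem_ofPred_eq]
    refine ⟨fun r => ?_, fun r r' hrr => ?_, fun r => ?_⟩
    · have := hoff v hv r
      have h1 : 0 < u * B := Nat.mul_pos (by omega) (by omega)
      have h2 : u * B + B ≤ 2 * C * B := by nlinarith
      have h3 : 2 * C * B = 2 ^ (j + 1) := by rw [pow_succ, ← hCB]; ring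
      omega
    · have h1 := hoff v hv r
      have h2 := hoff v hv r'
      have h3 : off v r * q = off v r' * q := by simp only at hrr; omega
      have h4 : off v r = off v r' := Nat.eq_of_mul_eq_mul_right hq1 h3
      simp only [off] at h4
      ext
      split_ifs at h4 <;> omega
    · set i := v + (r.1 + 1) with hi
      have hiC : (i : ℝ) ≤ C := by
        have := r.2
        exact_mod_cast (by omega : i ≤ C)
      set f := Int.fract ((q : ℝ) * (d * x)) with hf
      have hf0 : 0 ≤ f := Int.fract_nonneg _
      have hC' : (0 : ℝ) < C := by exact_mod_cast hC0
      have hQ' : (0 : ℝ) < Q := by exact_mod_cast hQ0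
      have hN : (2 : ℝ) ^ (j + 1) = 4 * C * C * Q := by
        have : 2 ^ (j + 1) = 4 * C * C * Q := by rw [pow_succ, ← hCB, hBeq]; ring
        exact_mod_cast this
      have hNf : (2 : ℝ) ^ (j + 1) * (i * f) ≤ 1 := by
        have h1 : (i : ℝ) * f ≤ C * (1 / ((4 * C ^ 3 : ℕ) * (Q : ℝ))) := by
          gcongr
        calc (2 : ℝ) ^ (j + 1) * (i * f) ≤
              4 * C * C * Q * (C * (1 / ((4 * C ^ 3 : ℕ) * (Q : ℝ)))) := by rw [hN]; gcongr
          _ = 1 := by push_cast; field_simp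
      have hif : 0 ≤ (i : ℝ) * f := by positivity
      have h2 : (2 : ℝ) ≤ 2 ^ (j + 1) := by
        calc (2 : ℝ) = 2 ^ 1 := by norm_num
          _ ≤ 2 ^ (j + 1) := pow_le_pow_right₀ (by norm_num) (by omega)
      have hsd : sdist (Int.fract ((blockSeq (u * B + (C * Q + s - off v ⟨0, by omega⟩ * q)) : ℝ) * x)
          - Int.fract ((blockSeq (u * B + (C * Q + s - off v ⟨r.1 + 1, by omega⟩ * q)) : ℝ) * x)) =
          i * f := by
        refine sdist_fract_sub_fract (z := i * ⌊(q : ℝ) * (d * x)⌋) ?_ hif (by nlinarith)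
        rw [hval, hval]
        have hfr : (⌊(q : ℝ) * (d * x)⌋ : ℝ) + f = q * (d * x) := Int.floor_add_fract _
        simp only [off, if_true, Nat.add_eq_zero_iff, one_ne_zero, and_false, if_false]
        push_cast [hi]
        linear_combination (-((v : ℝ) + (r.1 + 1))) * hfr
      push_cast
      rw [hsd]
      exact ⟨by positivity, hNf⟩
  · rintro ⟨u, s, v⟩ hp ⟨u', s', v'⟩ hp' h
    simp only [coe_product, Set.mem_prod, mem_coe, mem_Ico, mem_range] at hp hp'
    have h0 := congrFun h ⟨0, by omega⟩
    have h1 := congrFun h ⟨1, by omega⟩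
    have hv := hoff v hp.2.2 ⟨1, by omega⟩
    have hv' := hoff v' hp'.2.2 ⟨1, by omega⟩
    simp only [off, if_true, zero_mul, Nat.sub_zero, one_ne_zero, if_false] at h0 h1 hv hv'
    have hu : u = u' := by
      have e (w t : ℕ) (ht : t < C * Q) : (w * B + (C * Q + t)) / B = w := by
        rw [mul_comm, Nat.mul_add_div (by omega), Nat.div_eq_of_lt (by omega), add_zero]
      rw [← e u s hp.2.1, h0, e u' s' hp'.2.1]
    subst hu
    have hs : s = s' := by omega
    subst hs
    have : (v + 1) * q = (v' + 1) * q := by omega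
    have := Nat.eq_of_mul_eq_mul_right hq1 this
    simp only [Prod.mk.injEq, true_and]
    omega

lemma not_hasPoissonianCorr_of_frequently {x : ℝ} (hx : ∃ᶠ j in atTop, x ∈ clusterSet j) {k : ℕ}
    (hk : 2 ≤ k) : ¬ HasPoissonianCorr (fun n => Int.fract ((blockSeq n : ℝ) * x)) k := by
  intro h
  have hlim := h (fun _ => 0) (fun _ => 1) fun _ => zero_le_one
  simp only [sub_zero, prod_const_one] at hlim
  have hpow : Tendsto (fun j => 2 ^ (j + 1)) atTop (atTop : Filter ℕ) :=
    (tendsto_pow_atTop_atTop_of_one_lt (by norm_num : 1 < 2)).comp (tendsto_add_atTop_nat 1)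
  have hev := (hlim.comp hpow).eventually_lt_const (show (1 : ℝ) < 2 by norm_num)
  obtain ⟨j, hxj, hj, hlt, hC⟩ := (hx.and_eventually ((eventually_gt_atTop 0).and
    (hev.and (tendsto_clusterSize.eventually_ge_atTop (k + 8))))).exists
  have hcount := le_corrBoxCount_of_mem_clusterSet hj hk hxj
  have hge : 2 * 2 ^ (j + 1) ≤ 2 ^ (j - 1) * (clusterSize j - k) := by
    have : 2 * 2 ^ (j + 1) = 2 ^ (j - 1) * 8 := by
      obtain ⟨i, rfl⟩ : ∃ i, j = i + 1 := ⟨j - 1, by omega⟩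
      rw [Nat.add_sub_cancel]; ring
    rw [this]
    exact Nat.mul_le_mul_left _ (by omega)
  have hge' := hge.trans hcount
  simp only [Function.comp_apply] at hlt
  rw [div_lt_iff₀ (by positivity)] at hlt
  exact hge'.not_gt (by exact_mod_cast hlt)

/-- There is a strictly increasing sequence of positive integers with additive
energy `o(N³)` such that for almost every `x ∈ [0,1]` the sequence of fractional parts
`({a_n x})` has Poissonian correlations of no order `k ≥ 2`. -/
theorem exists_small_energy_sequence_nowhere_poissonian :
    ∃ a : ℕ → ℕ, StrictMono a ∧ (∀ n, 0 < a n) ∧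
      Tendsto (fun N : ℕ => (addEnergy a N : ℝ) / (N : ℝ) ^ 3) atTop (nhds 0) ∧
      (∀ᵐ x ∂(volume.restrict (Set.Icc (0:ℝ) 1)),
        ∀ k : ℕ, 2 ≤ k → ¬ HasPoissonianCorr (fun n => Int.fract ((a n : ℝ) * x)) k) := by
  refine ⟨blockSeq, blockSeq_strictMono, blockSeq_pos, tendsto_addEnergy_blockSeq, ?_⟩
  filter_upwards [ae_frequently_mem_clusterSet] with x hx k hk
  exact not_hasPoissonianCorr_of_frequently hx hk
end

section
/- Let 𝒜 = (a_n)_{n≥1} be a strictly increasing sequence of positive integers whose additive energy satisfies E(𝒜_N) = Ω(N^3) as N → ∞, i.e. there is a constant c > 0 with E(𝒜_N) ≥ c·N^3 for infinitely many N. Then the set of x ∈ [0,1] for which the sequence ({a_n x})_{n≥1} of fractional parts does not have Poissonian triple correlations (correlations of order k = 3) has positive Lebesgue measure. -/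
open Finset Filter MeasureTheory
open scoped Classical ENNReal NNReal

theorem sdist_eq_self_s5 {y : ℝ} (hy : |y| < 1 / 2) : sdist y = y := by
  obtain ⟨h1, h2⟩ := abs_lt.mp hy
  unfold sdist
  rcases le_or_gt 0 y with h | h
  · have : Int.fract y = y := Int.fract_eq_self.mpr ⟨h, by linarith⟩
    rw [this, if_pos h2.le]
  · have : Int.fract y = y + 1 := by
      rw [← Int.fract_add_one]
      exact Int.fract_eq_self.mpr ⟨by linarith, by linarith⟩
    rw [this, if_neg (by linarith)]
    ring

theorem sdist_congr {y z : ℝ} (h : Int.fract y = Int.fract z) : sdist y = sdist z := by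
  simp only [sdist, h]

theorem fract_fract_sub_fract (y z : ℝ) :
    Int.fract (Int.fract y - Int.fract z) = Int.fract (y - z) := by
  rw [Int.fract_eq_fract]
  refine ⟨⌊z⌋ - ⌊y⌋, ?_⟩
  simp only [Int.fract]
  push_cast
  ring

theorem abs_sub_lt_of_floor_mul_eq {M : ℕ} (hM : 0 < M) {y z : ℝ} (hy : 0 ≤ y) (hz : 0 ≤ z)
    (h : ⌊(M : ℝ) * y⌋₊ = ⌊(M : ℝ) * z⌋₊) : |y - z| < 1 / M := by
  have hM' : (0 : ℝ) < M := by exact_mod_cast hM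
  have h1 := Nat.floor_le (mul_nonneg hM'.le hy)
  have h2 := Nat.floor_le (mul_nonneg hM'.le hz)
  have h3 := Nat.lt_floor_add_one ((M : ℝ) * y)
  have h4 := Nat.lt_floor_add_one ((M : ℝ) * z)
  rw [h] at h1 h3
  rw [abs_lt]
  constructor
  · rw [← neg_div, div_lt_iff₀ hM']
    linarith
  · rw [lt_div_iff₀ hM']
    linarith

/-- Two points of `[0,1)` in the same cell of a partition into `M` cells of equal length, where
`N / M ≤ s`, have rescaled signed difference in `[-s, s]`. -/
theorem mul_sdist_mem_of_floor_mul_eq {M N : ℕ} (hM : 2 ≤ M) {s : ℝ} (hs : (N : ℝ) ≤ s * M)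
    {y z : ℝ} (hy : 0 ≤ y) (hz : 0 ≤ z) (h : ⌊(M : ℝ) * y⌋₊ = ⌊(M : ℝ) * z⌋₊) :
    (N : ℝ) * sdist (y - z) ∈ Set.Icc (-s) s := by
  have hM2 : (2 : ℝ) ≤ M := by exact_mod_cast hM
  have hlt := abs_sub_lt_of_floor_mul_eq (by omega) hy hz h
  have hhalf : |y - z| < 1 / 2 :=
    hlt.trans_le (one_div_le_one_div_of_le (by norm_num) hM2)
  rw [sdist_eq_self_s5 hhalf, Set.mem_Icc, ← abs_le, abs_mul, Nat.abs_cast]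
  calc (N : ℝ) * |y - z| ≤ (N : ℝ) * (1 / M) := by gcongr
    _ = N / M := by ring
    _ ≤ s := by rwa [div_le_iff₀ (by linarith)]

theorem card_le_corrBoxCount (x : ℕ → ℝ) (N : ℕ) (u v : Fin 2 → ℝ) (S : Finset (ℕ × ℕ × ℕ))
    (hS : ∀ t ∈ S, (t.1 ∈ Icc 1 N ∧ t.2.1 ∈ Icc 1 N ∧ t.2.2 ∈ Icc 1 N) ∧
      (t.1 ≠ t.2.1 ∧ t.1 ≠ t.2.2 ∧ t.2.1 ≠ t.2.2) ∧
      (N : ℝ) * sdist (x t.1 - x t.2.1) ∈ Set.Icc (u 0) (v 0) ∧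
      (N : ℝ) * sdist (x t.1 - x t.2.2) ∈ Set.Icc (u 1) (v 1)) :
    S.card ≤ corrBoxCount x 3 N u v := by
  unfold corrBoxCount
  refine Finset.card_le_card_of_injOn (fun t => ![t.1, t.2.1, t.2.2]) ?_ ?_
  · intro t ht
    obtain ⟨⟨h1, h2, h3⟩, ⟨d1, d2, d3⟩, b1, b2⟩ := hS t ht
    simp only [Finset.coe_filter, Set.mem_ofPred_eq, Fintype.mem_piFinset]
    refine ⟨?_, ?_, ?_⟩
    · intro i
      fin_cases i
      exacts [h1, h2, h3]
    · intro i j hij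
      fin_cases i <;> fin_cases j <;> simp_all
    · intro r
      change Fin 2 at r
      fin_cases r
      exacts [b1, b2]
  · rintro ⟨t1, t2, t3⟩ - ⟨w1, w2, w3⟩ - h
    have h0 := congrFun h 0
    have h1 := congrFun h 1
    have h2 := congrFun h 2
    simp_all

theorem HasPoissonianCorr.eventually_card_le {x : ℕ → ℝ} (h : HasPoissonianCorr x 3)
    {u v u' v' η : ℝ} (huv : u ≤ v) (huv' : u' ≤ v') (hη : 0 < η) :
    ∀ᶠ N : ℕ in atTop, ∀ S : Finset (ℕ × ℕ × ℕ),
      (∀ t ∈ S, (t.1 ∈ Icc 1 N ∧ t.2.1 ∈ Icc 1 N ∧ t.2.2 ∈ Icc 1 N) ∧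
        (t.1 ≠ t.2.1 ∧ t.1 ≠ t.2.2 ∧ t.2.1 ≠ t.2.2) ∧
        (N : ℝ) * sdist (x t.1 - x t.2.1) ∈ Set.Icc u v ∧
        (N : ℝ) * sdist (x t.1 - x t.2.2) ∈ Set.Icc u' v') →
      (S.card : ℝ) ≤ ((v - u) * (v' - u') + η) * N := by
  have key := h ![u, u'] ![v, v'] (by
    intro r
    change Fin 2 at r
    fin_cases r
    exacts [huv, huv'])
  have hprod : ∏ r : Fin (3 - 1), ((![v, v'] : Fin 2 → ℝ) r - (![u, u'] : Fin 2 → ℝ) r) =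
      (v - u) * (v' - u') := by
    change ∏ r : Fin 2, _ = _
    simp [Fin.prod_univ_two]
  have hlt := (key.eventually_lt_const (u := (v - u) * (v' - u') + η)
    (by rw [hprod]; linarith))
  filter_upwards [hlt, eventually_gt_atTop 0] with N hN hpos S hS
  have hNpos : (0 : ℝ) < N := by exact_mod_cast hpos
  rw [div_lt_iff₀ hNpos] at hN
  have hcard : (S.card : ℝ) ≤ corrBoxCount x 3 N ![u, u'] ![v, v'] := by
    exact_mod_cast card_le_corrBoxCount x N ![u, u'] ![v, v'] S hS
  linarith

/-- If `g` takes at most `M` values, then coincidences of `h` are at most `M` times as many as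
joint coincidences of `h` and `g`. -/
theorem card_coincidences_le {α β : Type*} [DecidableEq β] (P : Finset α) (h : α → β)
    (g : α → ℕ) (M : ℕ)
    (hg : ∀ p ∈ P, g p < M) :
    ((P ×ˢ P).filter fun q => h q.1 = h q.2).card ≤
      M * ((P ×ˢ P).filter fun q => h q.1 = h q.2 ∧ g q.1 = g q.2).card := by
  have h1 : ((P ×ˢ P).filter fun q => h q.1 = h q.2).card =
      ∑ b ∈ P.image h, (P.filter fun p => h p = b).card ^ 2 := by
    rw [Finset.card_eq_sum_card_fiberwise (f := fun q => h q.1) (t := P.image h)]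
    · refine Finset.sum_congr rfl fun b _ => ?_
      rw [sq, ← Finset.card_product]
      congr 1
      ext ⟨p, q⟩
      simp only [Finset.mem_filter, Finset.mem_product]
      grind
    · intro q hq
      simp only [Finset.coe_filter, Set.mem_ofPred_eq, Finset.mem_product] at hq
      exact Finset.mem_coe.mpr (Finset.mem_image_of_mem h hq.1.1)
  have h2 : ((P ×ˢ P).filter fun q => h q.1 = h q.2 ∧ g q.1 = g q.2).card =
      ∑ b ∈ P.image h, ∑ m ∈ range M, (P.filter fun p => h p = b ∧ g p = m).card ^ 2 := by
    rw [← Finset.sum_product',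
      Finset.card_eq_sum_card_fiberwise (f := fun q => (h q.1, g q.1))
        (t := P.image h ×ˢ range M)]
    · refine Finset.sum_congr rfl fun b _ => ?_
      rw [sq, ← Finset.card_product]
      congr 1
      ext ⟨p, q⟩
      simp only [Finset.mem_filter, Finset.mem_product, Prod.ext_iff]
      grind
    · intro q hq
      simp only [Finset.coe_filter, Set.mem_ofPred_eq, Finset.mem_product] at hq
      simp only [Finset.mem_coe, Finset.mem_product, Finset.mem_range]
      exact ⟨Finset.mem_image_of_mem h hq.1.1, hg _ hq.1.1⟩
  rw [h1, h2, Finset.mul_sum]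
  refine Finset.sum_le_sum fun b _ => ?_
  have h3 : (P.filter fun p => h p = b).card =
      ∑ m ∈ range M, (P.filter fun p => h p = b ∧ g p = m).card := by
    rw [Finset.card_eq_sum_card_fiberwise (f := g) (t := range M)]
    · simp only [Finset.filter_filter]
    · intro p hp
      simp only [Finset.coe_filter, Set.mem_ofPred_eq] at hp
      exact Finset.mem_coe.mpr (Finset.mem_range.mpr (hg p hp.1))
  rw [h3]
  simpa using sq_sum_le_card_mul_sum_sq (s := range M)
    (f := fun m => (P.filter fun p => h p = b ∧ g p = m).card)

/-- Number of pairs of indices in `{1,…,N}` whose difference of terms is `a i - a k`. -/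
noncomputable def differenceCount (a : ℕ → ℕ) (N i k : ℕ) : ℕ :=
  ((Icc 1 N ×ˢ Icc 1 N).filter fun p => a i + a p.2 = a k + a p.1).card

/-- A colouring of the indices by `M` colours bounds the additive energy by the representation
counts of the differences of monochromatic pairs. -/
theorem addEnergy_le (a : ℕ → ℕ) (ha : Function.Injective a) (f : ℕ → ℕ) (M N : ℕ)
    (hf : ∀ n, f n < M) :
    _root_.addEnergy a N ≤ M * (N ^ 2 +
      ∑ p ∈ (Icc 1 N ×ˢ Icc 1 N).filter (fun p => p.1 ≠ p.2 ∧ f p.1 = f p.2),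
        differenceCount a N p.1 p.2) := by
  have h1 : addEnergy a N = (((Icc 1 N ×ˢ Icc 1 N) ×ˢ (Icc 1 N ×ˢ Icc 1 N)).filter
      fun q => a q.1.1 + a q.1.2 = a q.2.1 + a q.2.2).card := by
    unfold _root_.addEnergy
    refine Finset.card_nbij' (fun q => ((q.1, q.2.1), (q.2.2.1, q.2.2.2)))
      (fun q => (q.1.1, q.1.2, q.2.1, q.2.2)) ?_ ?_ ?_ ?_
    · intro q hq
      simp only [Finset.coe_filter, Set.mem_ofPred_eq, Finset.mem_product] at hq ⊢
      tauto
    · intro q hq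
      simp only [Finset.coe_filter, Set.mem_ofPred_eq, Finset.mem_product] at hq ⊢
      tauto
    · intro q _
      rfl
    · intro q _
      rfl
  rw [h1]
  refine (card_coincidences_le (Icc 1 N ×ˢ Icc 1 N) (fun p : ℕ × ℕ => a p.1 + a p.2)
    (fun p => f p.1) M fun p _ => hf p.1).trans (Nat.mul_le_mul_left _ ?_)
  set Q := ((Icc 1 N ×ˢ Icc 1 N) ×ˢ (Icc 1 N ×ˢ Icc 1 N)).filter
    fun q => a q.1.1 + a q.1.2 = a q.2.1 + a q.2.2 ∧ f q.1.1 = f q.2.1 with hQ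
  rw [← Finset.card_filter_add_card_filter_not (s := Q) (fun q => q.1.1 = q.2.1)]
  refine Nat.add_le_add ?_ ?_
  · have : (Icc 1 N ×ˢ Icc 1 N).card = N ^ 2 := by simp [sq]
    rw [← this]
    refine Finset.card_le_card_of_injOn (fun q => q.1) ?_ ?_
    · intro q hq
      simp only [hQ, Finset.coe_filter, Set.mem_ofPred_eq, Finset.mem_filter,
        Finset.mem_product] at hq
      simp only [Finset.mem_coe, Finset.mem_product]
      exact hq.1.1.1
    · rintro ⟨⟨i, j⟩, k, l⟩ hq ⟨⟨i', j'⟩, k', l'⟩ hq' heq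
      simp only [hQ, Finset.coe_filter, Set.mem_ofPred_eq, Finset.mem_filter] at hq hq'
      obtain ⟨⟨-, e, -⟩, rfl⟩ := hq
      obtain ⟨⟨-, e', -⟩, rfl⟩ := hq'
      have hl : j = l := ha (by omega)
      have hl' : j' = l' := ha (by omega)
      simp only [Prod.mk.injEq] at heq ⊢
      grind
  · rw [Finset.card_eq_sum_card_fiberwise (f := fun q => (q.1.1, q.2.1))
      (t := (Icc 1 N ×ˢ Icc 1 N).filter (fun p => p.1 ≠ p.2 ∧ f p.1 = f p.2))]
    · refine Finset.sum_le_sum fun p _ => ?_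
      refine Finset.card_le_card_of_injOn (fun q => (q.2.2, q.1.2)) ?_ ?_
      · rintro ⟨⟨i, j⟩, k, l⟩ hq
        simp only [hQ, Finset.coe_filter, Set.mem_ofPred_eq, Finset.mem_filter,
          Finset.mem_product] at hq ⊢
        obtain ⟨⟨⟨⟨⟨_, h2⟩, _, h4⟩, e, -⟩, -⟩, rfl⟩ := hq
        exact ⟨⟨h4, h2⟩, e⟩
      · rintro ⟨⟨i, j⟩, k, l⟩ hq ⟨⟨i', j'⟩, k', l'⟩ hq' heq
        simp only [Finset.coe_filter, Set.mem_ofPred_eq] at hq hq'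
        have e := hq.2.trans hq'.2.symm
        simp only [Prod.mk.injEq] at heq e ⊢
        tauto
    · rintro ⟨⟨i, j⟩, k, l⟩ hq
      simp only [hQ, Finset.coe_filter, Set.mem_ofPred_eq, Finset.mem_filter,
        Finset.mem_product] at hq ⊢
      tauto

/-- The pairs of a colouring are at most the number of indices plus the number of triples. -/
theorem card_pairs_le (I : Finset ℕ) (f : ℕ → ℕ) :
    ((I ×ˢ I).filter fun p => p.1 ≠ p.2 ∧ f p.1 = f p.2).card ≤ I.card +
      ((I ×ˢ I ×ˢ I).filter fun t => (t.1 ≠ t.2.1 ∧ t.1 ≠ t.2.2 ∧ t.2.1 ≠ t.2.2) ∧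
        f t.1 = f t.2.1 ∧ f t.1 = f t.2.2).card := by
  rw [Finset.card_eq_sum_card_fiberwise (f := fun p : ℕ × ℕ => p.1) (t := I)]
  rotate_left
  · intro p hp
    simp only [Finset.coe_filter, Set.mem_ofPred_eq, Finset.mem_product] at hp
    exact hp.1.1
  rw [Finset.card_eq_sum_card_fiberwise (f := fun t : ℕ × ℕ × ℕ => t.1) (t := I)
    (s := (I ×ˢ I ×ˢ I).filter _)]
  rotate_left
  · intro p hp
    simp only [Finset.coe_filter, Set.mem_ofPred_eq, Finset.mem_product] at hp
    exact hp.1.1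
  rw [Finset.card_eq_sum_ones, ← Finset.sum_add_distrib]
  refine Finset.sum_le_sum fun i hi => ?_
  set C := I.filter fun k => i ≠ k ∧ f i = f k with hC
  have h1 : (((I ×ˢ I).filter fun p => p.1 ≠ p.2 ∧ f p.1 = f p.2).filter
      fun p => p.1 = i).card ≤ C.card := by
    refine Finset.card_le_card_of_injOn (fun p => p.2) ?_ ?_
    · rintro ⟨i', k⟩ hp
      simp only [hC, Finset.coe_filter, Finset.mem_filter, Set.mem_ofPred_eq,
        Finset.mem_product] at hp ⊢
      grind
    · rintro ⟨i', k⟩ hp ⟨i'', k'⟩ hp' heq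
      simp only [Finset.coe_filter, Set.mem_ofPred_eq] at hp hp'
      simp only [Prod.mk.injEq] at heq ⊢
      exact ⟨hp.2.trans hp'.2.symm, heq⟩
  have h2 : C.offDiag.card ≤ (((I ×ˢ I ×ˢ I).filter fun t =>
      (t.1 ≠ t.2.1 ∧ t.1 ≠ t.2.2 ∧ t.2.1 ≠ t.2.2) ∧
        f t.1 = f t.2.1 ∧ f t.1 = f t.2.2).filter fun t => t.1 = i).card := by
    refine Finset.card_le_card_of_injOn (fun p => (i, p.1, p.2)) ?_ ?_
    · rintro ⟨k, l⟩ hp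
      simp only [hC, Finset.mem_coe, Finset.mem_offDiag, Finset.mem_filter,
        Finset.mem_product] at hp ⊢
      grind
    · rintro ⟨k, l⟩ - ⟨k', l'⟩ - heq
      simpa using heq
  have h3 : C.card ≤ 1 + C.offDiag.card := by
    rw [Finset.offDiag_card]
    rcases Nat.lt_or_ge C.card 2 with h | h
    · omega
    · have : 2 * C.card ≤ C.card * C.card := Nat.mul_le_mul_right _ h
      omega
  omega

/-- If the difference `a i - a k` has many representations, then most of them extend by a third
index of the same colour to a triple with distinct entries. -/
theorem exists_triples (a : ℕ → ℕ) (ha : Function.Injective a) (f : ℕ → ℕ) (M N : ℕ)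
    (hf : ∀ n, f n < M) {i k : ℕ} (hik : i ≠ k) :
    ∃ S : Finset (ℕ × ℕ × ℕ), differenceCount a N i k ≤ S.card + 2 * M ∧
      ∀ t ∈ S, (t.1 ∈ Icc 1 N ∧ t.2.1 ∈ Icc 1 N ∧ t.2.2 ∈ Icc 1 N) ∧
        (t.1 ≠ t.2.1 ∧ t.1 ≠ t.2.2 ∧ t.2.1 ≠ t.2.2) ∧
        a i + a t.2.1 = a k + a t.1 ∧ f t.1 = f t.2.2 := by
  set R := (Icc 1 N ×ˢ Icc 1 N).filter fun p => a i + a p.2 = a k + a p.1 with hR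
  set cell := fun p : ℕ × ℕ => (Icc 1 N).filter fun m => f p.1 = f m with hcell
  have hinj : ∀ p ∈ R, ∀ q ∈ R, p.1 = q.1 → p = q := by
    rintro ⟨l, j⟩ hp ⟨l', j'⟩ hq rfl
    simp only [hR, Finset.mem_filter] at hp hq
    have : j = j' := ha (by omega)
    rw [this]
  have hbad : (R.filter fun p => (cell p).card ≤ 2).card ≤ 2 * M := by
    have := Finset.card_le_mul_card_image_of_maps_to
      (s := R.filter fun p => (cell p).card ≤ 2) (t := range M) (f := fun p => f p.1)
      (fun p _ => Finset.mem_range.mpr (hf p.1)) 2 ?_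
    · simpa using this
    · intro m _
      rcases ((R.filter fun p => (cell p).card ≤ 2).filter
        fun p => f p.1 = m).eq_empty_or_nonempty with h | ⟨p, hp⟩
      · simp [h]
      · simp only [Finset.mem_filter] at hp
        refine le_trans ?_ hp.1.2
        refine Finset.card_le_card_of_injOn (fun q => q.1) ?_ ?_
        · intro q hq
          simp only [hR, hcell, Finset.coe_filter, Set.mem_ofPred_eq, Finset.mem_filter,
            Finset.mem_product] at hq ⊢
          exact ⟨hq.1.1.1.1, hp.2.trans hq.2.symm⟩
        · intro q hq q' hq' heq
          simp only [Finset.coe_filter, Set.mem_ofPred_eq, Finset.mem_filter] at hq hq'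
          exact hinj q hq.1.1 q' hq'.1.1 heq
  have hthird : ∀ p ∈ R.filter (fun p => ¬ (cell p).card ≤ 2),
      ∃ m ∈ cell p, m ≠ p.1 ∧ m ≠ p.2 := by
    intro p hp
    simp only [Finset.mem_filter, not_le] at hp
    obtain ⟨m, hm, hm'⟩ := Finset.exists_mem_notMem_of_card_lt_card
      (s := {p.1, p.2}) (t := cell p) (lt_of_le_of_lt Finset.card_le_two hp.2)
    simp only [Finset.mem_insert, Finset.mem_singleton, not_or] at hm'
    exact ⟨m, hm, hm'⟩
  choose! third hthird_mem hthird_ne using hthird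
  refine ⟨(R.filter fun p => ¬ (cell p).card ≤ 2).image fun p => (p.1, p.2, third p), ?_, ?_⟩
  · rw [Finset.card_image_of_injective]
    · have := Finset.card_filter_add_card_filter_not (s := R) (fun p => (cell p).card ≤ 2)
      have hd : differenceCount a N i k = R.card := rfl
      omega
    · rintro ⟨p, p'⟩ ⟨q, q'⟩ h
      simp only [Prod.mk.injEq] at h ⊢
      exact ⟨h.1, h.2.1⟩
  · intro t ht
    obtain ⟨p, hp, rfl⟩ := Finset.mem_image.mp ht
    have hm := hthird_mem p hp
    have hne := hthird_ne p hp
    simp only [hR, hcell, Finset.mem_filter, Finset.mem_product] at hp hm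
    refine ⟨⟨hp.1.1.1, hp.1.1.2, hm.1⟩, ⟨?_, hne.1.symm, hne.2.symm⟩, hp.1.2, hm.2⟩
    intro h
    have h' := hp.1.2
    simp only at h
    rw [h] at h'
    exact hik (ha (by omega))

/-- If the additive energy is infinitely often at least `c N ^ 3`, then no dilation of the sequence
has Poissonian triple correlations. -/
theorem not_hasPoissonianCorr_three_of_large_energy (a : ℕ → ℕ) (ha : Function.Injective a)
    {c : ℝ} (hc : 0 < c) (hE : ∃ᶠ N : ℕ in atTop, c * (N : ℝ) ^ 3 ≤ (addEnergy a N : ℝ))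
    (x : ℝ) : ¬ HasPoissonianCorr (fun n => Int.fract ((a n : ℝ) * x)) 3 := by
  intro h
  set X : ℕ → ℝ := fun n => Int.fract ((a n : ℝ) * x) with hX
  have hX0 : ∀ n, 0 ≤ X n := fun n => Int.fract_nonneg _
  have hX1 : ∀ n, X n < 1 := fun n => Int.fract_lt_one _
  have hfloor : ∀ M : ℕ, 0 < M → ∀ n, ⌊(M : ℝ) * X n⌋₊ < M := by
    intro M hM n
    have hM' : (0 : ℝ) < M := by exact_mod_cast hM
    rw [Nat.floor_lt (mul_nonneg hM'.le (hX0 n))]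
    nlinarith [hX1 n]
  have hsplit : ∀ b : ℝ, 0 < b → ∀ᶠ N : ℕ in atTop,
      2 ≤ ⌊b * (N : ℝ)⌋₊ ∧ b * N ≤ 2 * (⌊b * (N : ℝ)⌋₊ : ℝ) := by
    intro b hb
    have htend : Tendsto (fun N : ℕ => b * (N : ℝ)) atTop atTop :=
      tendsto_natCast_atTop_atTop.const_mul_atTop hb
    filter_upwards [htend.eventually_ge_atTop 2] with N hN
    have h2 : 2 ≤ ⌊b * (N : ℝ)⌋₊ := Nat.le_floor (by exact_mod_cast hN)
    have h2' : (2 : ℝ) ≤ ⌊b * (N : ℝ)⌋₊ := by exact_mod_cast h2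
    exact ⟨h2, by linarith [Nat.lt_floor_add_one (b * (N : ℝ))]⟩
  set s : ℝ := 4 / c with hs
  have hspos : 0 < s := by positivity
  set K : ℝ := 4 * s ^ 2 + 2 with hK
  have hKpos : 0 < K := by positivity
  set L : ℝ := 8 * K with hL
  set ε : ℝ := 1 / (64 * K ^ 2) with hε
  have hεpos : 0 < ε := by positivity
  have hboxes : ∀ᶠ N : ℕ in atTop, ∀ m ∈ Finset.Icc ⌊-s / ε⌋ ⌊s / ε⌋,
      ∀ S : Finset (ℕ × ℕ × ℕ),
      (∀ t ∈ S, (t.1 ∈ Icc 1 N ∧ t.2.1 ∈ Icc 1 N ∧ t.2.2 ∈ Icc 1 N) ∧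
        (t.1 ≠ t.2.1 ∧ t.1 ≠ t.2.2 ∧ t.2.1 ≠ t.2.2) ∧
        (N : ℝ) * sdist (X t.1 - X t.2.1) ∈ Set.Icc (m * ε) ((m + 1) * ε) ∧
        (N : ℝ) * sdist (X t.1 - X t.2.2) ∈ Set.Icc (-L) L) →
      (S.card : ℝ) ≤ (((m + 1) * ε - m * ε) * (L - -L) + 1 / (8 * K)) * N := by
    rw [Filter.eventually_all_finset]
    intro m _
    exact h.eventually_card_le (by nlinarith) (by linarith) (by positivity)
  have hsquare := h.eventually_card_le (u := -s) (v := s) (u' := -s) (v' := s) (η := 1)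
    (by linarith) (by linarith) one_pos
  obtain ⟨N, hEN, hN0, hboxN, hsqN, ⟨hM2, hMle⟩, hM2', hMle'⟩ := (hE.and_eventually
    ((eventually_gt_atTop 0).and (hboxes.and (hsquare.and ((hsplit (c / 2) (by positivity)).and
      (hsplit (1 / (4 * K)) (by positivity))))))).exists
  have hN : (0 : ℝ) < N := by exact_mod_cast hN0
  have hMup := Nat.floor_le (show 0 ≤ c / 2 * (N : ℝ) by positivity)
  have hMup' := Nat.floor_le (show 0 ≤ 1 / (4 * K) * (N : ℝ) by positivity)
  set M := ⌊c / 2 * (N : ℝ)⌋₊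
  set M' := ⌊1 / (4 * K) * (N : ℝ)⌋₊
  have hNM : (N : ℝ) ≤ s * M := by
    rw [hs, div_mul_eq_mul_div, le_div_iff₀ hc]
    linarith
  have hNM' : (N : ℝ) ≤ L * M' := by
    rw [div_mul_eq_mul_div, div_le_iff₀ (by positivity)] at hMle'
    rw [hL]
    linarith
  have hclose : ∀ i k : ℕ, ⌊(M : ℝ) * X i⌋₊ = ⌊(M : ℝ) * X k⌋₊ →
      (N : ℝ) * sdist (X i - X k) ∈ Set.Icc (-s) s := fun i k hik =>
    mul_sdist_mem_of_floor_mul_eq hM2 hNM (hX0 i) (hX0 k) hik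
  set T := (Icc 1 N ×ˢ Icc 1 N).filter
    (fun p => p.1 ≠ p.2 ∧ ⌊(M : ℝ) * X p.1⌋₊ = ⌊(M : ℝ) * X p.2⌋₊) with hT
  have hTcard : (T.card : ℝ) ≤ K * N := by
    have h1 := Nat.cast_le (α := ℝ).mpr
      (card_pairs_le (Icc 1 N) (fun n => ⌊(M : ℝ) * X n⌋₊))
    have h2 := hsqN ((Icc 1 N ×ˢ Icc 1 N ×ˢ Icc 1 N).filter fun t =>
      (t.1 ≠ t.2.1 ∧ t.1 ≠ t.2.2 ∧ t.2.1 ≠ t.2.2) ∧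
        ⌊(M : ℝ) * X t.1⌋₊ = ⌊(M : ℝ) * X t.2.1⌋₊ ∧
        ⌊(M : ℝ) * X t.1⌋₊ = ⌊(M : ℝ) * X t.2.2⌋₊) (by
      intro t ht
      simp only [Finset.mem_filter, Finset.mem_product] at ht
      exact ⟨ht.1, ht.2.1, hclose _ _ ht.2.2.1, hclose _ _ ht.2.2.2⟩)
    push_cast at h1
    rw [Nat.card_Icc] at h1
    have h3 : ((N + 1 - 1 : ℕ) : ℝ) = N := by simp
    rw [h3] at h1
    rw [hK]
    nlinarith
  have henergy : (N : ℝ) ^ 2 ≤ ∑ p ∈ T, (differenceCount a N p.1 p.2 : ℝ) := by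
    have h1 : (addEnergy a N : ℝ) ≤
        M * ((N : ℝ) ^ 2 + ∑ p ∈ T, (differenceCount a N p.1 p.2 : ℝ)) := by
      exact_mod_cast addEnergy_le a ha (fun n => ⌊(M : ℝ) * X n⌋₊) M N (hfloor M (by omega))
    have h2 : (0 : ℝ) ≤ ∑ p ∈ T, (differenceCount a N p.1 p.2 : ℝ) :=
      Finset.sum_nonneg fun _ _ => Nat.cast_nonneg _
    have h3 : c / 2 * N * (2 * (N : ℝ) ^ 2) ≤
        c / 2 * N * ((N : ℝ) ^ 2 + ∑ p ∈ T, (differenceCount a N p.1 p.2 : ℝ)) :=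
      calc c / 2 * N * (2 * (N : ℝ) ^ 2) = c * (N : ℝ) ^ 3 := by ring
        _ ≤ _ := hEN.trans h1
        _ ≤ _ := by gcongr
    have h4 := le_of_mul_le_mul_left h3 (by positivity)
    linarith
  obtain ⟨⟨i, k⟩, hikT, hik⟩ : ∃ p ∈ T, (N : ℝ) / K ≤ differenceCount a N p.1 p.2 := by
    by_contra! hcon
    have hTne : T.Nonempty := by
      by_contra hempty
      rw [Finset.not_nonempty_iff_eq_empty] at hempty
      rw [hempty, Finset.sum_empty] at henergy
      nlinarith
    have h1 := Finset.sum_lt_sum_of_nonempty hTne hcon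
    rw [Finset.sum_const, nsmul_eq_mul] at h1
    have h2 : (T.card : ℝ) * (N / K) ≤ K * N * (N / K) := by gcongr
    have h3 : K * N * (N / K) = (N : ℝ) ^ 2 := by field_simp
    linarith
  simp only [hT, Finset.mem_filter] at hikT
  obtain ⟨S, hScard, hS⟩ := exists_triples a ha (fun n => ⌊(M' : ℝ) * X n⌋₊) M' N
    (hfloor M' (by omega)) hikT.2.1
  have hτ := hclose i k hikT.2.2
  set τ := (N : ℝ) * sdist (X i - X k) with hτdef
  have hfloor_le : (⌊τ / ε⌋ : ℝ) * ε ≤ τ := by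
    rw [← le_div_iff₀ hεpos]
    exact Int.floor_le _
  have hfloor_ge : τ ≤ (⌊τ / ε⌋ + 1 : ℝ) * ε := by
    rw [← div_le_iff₀ hεpos]
    exact (Int.lt_floor_add_one _).le
  have hfinal := hboxN ⌊τ / ε⌋ (Finset.mem_Icc.mpr
    ⟨Int.floor_le_floor (div_le_div_of_nonneg_right hτ.1 hεpos.le),
      Int.floor_le_floor (div_le_div_of_nonneg_right hτ.2 hεpos.le)⟩) S (by
    intro t ht
    obtain ⟨hmem, hne, hdiff, hcell⟩ := hS t ht
    refine ⟨hmem, hne, ?_, mul_sdist_mem_of_floor_mul_eq hM2' hNM' (hX0 _) (hX0 _) hcell⟩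
    have hdiff' : (a i : ℝ) + a t.2.1 = a k + a t.1 := by exact_mod_cast hdiff
    have heq : sdist (X t.1 - X t.2.1) = sdist (X i - X k) := by
      refine sdist_congr ?_
      simp only [hX, fract_fract_sub_fract]
      congr 1
      linear_combination (-x) * hdiff'
    rw [heq]
    exact ⟨hfloor_le, hfloor_ge⟩)
  have hScard' : (differenceCount a N i k : ℝ) ≤ S.card + 2 * M' := by exact_mod_cast hScard
  have hwidth : (((⌊τ / ε⌋ : ℝ) + 1) * ε - ⌊τ / ε⌋ * ε) * (L - -L) + 1 / (8 * K) =
      3 / (8 * K) := by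
    rw [hL, hε]
    field_simp
    ring
  rw [hwidth] at hfinal
  have hNK : 0 < (N : ℝ) / K := by positivity
  have e1 : 3 / (8 * K) * (N : ℝ) = 3 / 8 * (N / K) := by field_simp
  have e2 : 1 / (4 * K) * (N : ℝ) = 1 / 4 * (N / K) := by field_simp
  rw [e1] at hfinal
  rw [e2] at hMup'
  simp only at hik
  linarith

/-- If the additive energy of `(a_n)` satisfies `E(𝒜_N) = Ω(N³)`, then the set
of `x ∈ [0,1]` for which `({a_n x})` fails to have Poissonian triple correlations has positive
Lebesgue measure. -/
theorem large_energy_implies_not_poissonian_triple_on_positive_measure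
    (a : ℕ → ℕ) (ha : StrictMono a) (hapos : ∀ n, 0 < a n)
    (c : ℝ) (hc : 0 < c)
    (hE : ∃ᶠ N : ℕ in atTop, c * (N : ℝ) ^ 3 ≤ (addEnergy a N : ℝ)) :
    0 < volume {x ∈ Set.Icc (0:ℝ) 1 |
      ¬ HasPoissonianCorr (fun n => Int.fract ((a n : ℝ) * x)) 3} := by
  have hset : {x ∈ Set.Icc (0:ℝ) 1 |
      ¬ HasPoissonianCorr (fun n => Int.fract ((a n : ℝ) * x)) 3} = Set.Icc 0 1 :=
    Set.sep_eq_self_iff_mem_true.mpr fun x _ =>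
      not_hasPoissonianCorr_three_of_large_energy a ha.injective hc hE x
  rw [hset, Real.volume_Icc]
  simp
end

section
/- Let k ≥ 2 and let (x_n)_{n≥1} ⊆ [0,1] have Poissonian k-th order correlations. Then the k-th moment I_k^*(s,N) = ∫_0^1 F(t,s,N)^k dt satisfies limsup_{N→∞} I_k^*(s,N) = s^k + O_k(s^{k-1}) as s → ∞; that is, there exist constants C > 0 and s_0 > 0 depending only on k such that for all s ≥ s_0, |limsup_{N→∞} I_k^*(s,N) − s^k| ≤ C·s^{k-1}. -/
open Finset Filter MeasureTheory
open scoped Classical ENNReal NNReal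

/-- `F(t,s,N)`: the number of `n ≤ N` with `‖x_n − t‖ ≤ s/(2N)`. -/
noncomputable def Fcnt (x : ℕ → ℝ) (s : ℝ) (N : ℕ) (t : ℝ) : ℕ :=
  ((Finset.Icc 1 N).filter fun n => nint (x n - t) ≤ s / (2 * N)).card

lemma nint_le_iff_exists {w δ : ℝ} : nint w ≤ δ ↔ ∃ n : ℤ, |w - n| ≤ δ :=
  ⟨fun h => ⟨round w, h⟩, fun ⟨n, hn⟩ => (round_le w n).trans hn⟩

lemma measurable_nint : Measurable nint := by
  have : nint = fun x : ℝ => min (Int.fract x) (1 - Int.fract x) := by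
    ext x; exact abs_sub_round_eq_min x
  rw [this]
  exact measurable_fract.min (measurable_const.sub measurable_fract)

lemma nint_neg (w : ℝ) : nint (-w) = nint w := by
  have key : ∀ w : ℝ, nint (-w) ≤ nint w := fun w =>
    nint_le_iff_exists.2 ⟨-round w, by
      rw [nint, ← abs_neg]; push_cast; apply le_of_eq; congr 1; ring⟩
  exact le_antisymm (key w) (by simpa using key (-w))

lemma nint_add_int (w : ℝ) (n : ℤ) : nint (w + n) = nint w := by
  simp [nint, round_add_intCast]

lemma nint_le_iff_abs_le {w δ : ℝ} (hδ : δ < 1 / 4) (hw : |w| ≤ 3 / 4) :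
    nint w ≤ δ ↔ |w| ≤ δ := by
  refine nint_le_iff_exists.trans ⟨fun ⟨n, hn⟩ => ?_, fun h => ⟨0, by simpa using h⟩⟩
  have hn0 : n = 0 := by
    rw [abs_le] at hn hw
    have h1 : (n : ℝ) < 1 := by linarith
    have h2 : (-1 : ℝ) < n := by linarith
    have h3 : n < 1 := by exact_mod_cast h1
    have h4 : -1 < n := by exact_mod_cast h2
    omega
  simpa [hn0] using hn

lemma abs_sdist_le (z : ℝ) : |sdist z| ≤ 1 / 2 := by
  have h0 := Int.fract_nonneg z
  have h1 := Int.fract_lt_one z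
  unfold sdist
  split_ifs with h <;> rw [abs_le] <;> constructor <;> linarith

lemma exists_eq_sdist_add_int (z : ℝ) : ∃ n : ℤ, z = sdist z + n := by
  have h := Int.fract_add_floor z
  unfold sdist
  split_ifs
  · exact ⟨⌊z⌋, h.symm⟩
  · exact ⟨⌊z⌋ + 1, by push_cast; linarith⟩

lemma nint_sub_le_iff {z v δ : ℝ} (hδ : δ < 1 / 4) (hv : |v| ≤ δ) :
    nint (z - v) ≤ δ ↔ |sdist z - v| ≤ δ := by
  obtain ⟨n, hn⟩ := exists_eq_sdist_add_int z
  have : nint (z - v) = nint (sdist z - v) := by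
    conv_lhs => rw [hn]
    rw [show sdist z + n - v = sdist z - v + n by ring, nint_add_int]
  rw [this]
  refine nint_le_iff_abs_le hδ ?_
  have := abs_sub (sdist z) v
  linarith [abs_sdist_le z]

/-- Translating and rescaling the time variable turns the event that all points `y j` lie close
to `t` into a box condition on the rescaled differences. -/
lemma integral_all_near_eq (m N : ℕ) (y : Fin (m + 1) → ℝ) {s : ℝ} (hs : 0 < s)
    (hN : 2 * s < N) :
    ∫ t in (0 : ℝ)..1, (if ∀ j, nint (y j - t) ≤ s / (2 * N) then (1 : ℝ) else 0) =
      (N : ℝ)⁻¹ * ∫ u : ℝ, (if |u| ≤ s / 2 ∧ ∀ r : Fin m, (N : ℝ) * sdist (y 0 - y r.succ) ∈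
        Set.Icc (u - s / 2) (u + s / 2) then (1 : ℝ) else 0) := by
  have hN0 : (0 : ℝ) < N := by linarith
  set g : ℝ → ℝ := fun t => if ∀ j, nint (y j - t) ≤ s / (2 * N) then (1 : ℝ) else 0 with hg
  set h : ℝ → ℝ := fun u => if |u| ≤ s / 2 ∧ ∀ r : Fin m, (N : ℝ) * sdist (y 0 - y r.succ) ∈
        Set.Icc (u - s / 2) (u + s / 2) then (1 : ℝ) else 0 with hh
  have hper : Function.Periodic g 1 := fun t => by
    have : ∀ j, nint (y j - (t + 1)) = nint (y j - t) := fun j => by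
      have := nint_add_int (y j - (t + 1)) 1
      rw [← this]; congr 1; push_cast; ring
    simp only [hg, this]
  have hgh : ∀ v ∈ Set.uIcc (-(1 / 2) : ℝ) (1 / 2), g (y 0 - v) = h (N * v) := by
    intro v hv
    rw [Set.uIcc_of_le (by norm_num)] at hv
    have hv' : |v| ≤ 1 / 2 := abs_le.2 hv
    have hδ : s / (2 * N) < 1 / 4 := by
      rw [div_lt_iff₀ (by positivity)]; linarith
    have hsc : ∀ a : ℝ, |a| ≤ s / (2 * N) ↔ |N * a| ≤ s / 2 := fun a => by
      rw [abs_mul, abs_of_pos hN0, le_div_iff₀ (by positivity), le_div_iff₀ (by norm_num)]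
      constructor <;> intro h <;> linarith
    have h0 : nint (y 0 - (y 0 - v)) ≤ s / (2 * N) ↔ |N * v| ≤ s / 2 := by
      rw [sub_sub_cancel, nint_le_iff_abs_le hδ (by linarith), hsc]
    simp only [hg, hh]
    refine if_congr ?_ rfl rfl
    rw [Fin.forall_fin_succ, h0]
    refine and_congr_right fun hv0 => forall_congr' fun r => ?_
    rw [← nint_neg, show -(y r.succ - (y 0 - v)) = (y 0 - y r.succ) - v by ring,
      nint_sub_le_iff hδ ((hsc v).2 hv0), hsc, abs_le, Set.mem_Icc, mul_sub]
    constructor <;> rintro ⟨h1, h2⟩ <;> constructor <;> linarith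
  have h1 : ∫ t in (0 : ℝ)..1, g t = ∫ v in (-(1 / 2) : ℝ)..(1 / 2), g (y 0 - v) := by
    rw [intervalIntegral.integral_comp_sub_left]
    have := hper.intervalIntegral_add_eq 0 (y 0 - 1 / 2)
    rw [zero_add] at this
    rw [this]
    congr 1
    ring
  rw [h1, intervalIntegral.integral_congr hgh,
    intervalIntegral.integral_comp_mul_left h hN0.ne', smul_eq_mul]
  congr 1
  refine intervalIntegral.integral_eq_integral_of_support_subset fun u hu => ?_
  have : |u| ≤ s / 2 := by
    by_contra hcon
    exact hu (if_neg fun hc => hcon hc.1)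
  rw [abs_le] at this
  constructor <;> linarith [this.1, this.2]

lemma pow_succ_le_descFactorial_add (n k : ℕ) :
    n ^ (k + 1) ≤ n.descFactorial (k + 1) + (k + 1) ^ 2 * n ^ k := by
  induction k with
  | zero => simp
  | succ k ih =>
    have h1 : n * n.descFactorial (k + 1) ≤
        n.descFactorial (k + 2) + (k + 1) * n.descFactorial (k + 1) := by
      rw [Nat.descFactorial_succ n (k + 1), ← add_mul]
      exact Nat.mul_le_mul_right _ (by omega)
    have h2 := Nat.descFactorial_le_pow n (k + 1)
    have h3 : n ^ (k + 2) = n * n ^ (k + 1) := by ring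
    have h4 := Nat.mul_le_mul_left n ih
    have h5 : n * n ^ k = n ^ (k + 1) := by ring
    nlinarith [Nat.zero_le (n ^ (k + 1)), Nat.zero_le (k * n ^ (k + 1))]

lemma card_injective_tuples (S : Finset ℕ) (k : ℕ) :
    ((Fintype.piFinset fun _ : Fin k => S).filter Function.Injective).card =
      S.card.descFactorial k := by
  have := Fintype.card_embedding_eq (α := Fin k) (β := S)
  rw [Fintype.card_coe, Fintype.card_fin] at this
  rw [← this, ← Finset.card_univ]
  symm
  refine Finset.card_bij (fun e _ j => (e j : ℕ)) ?_ ?_ ?_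
  · intro e _
    simp only [Finset.mem_filter, Fintype.mem_piFinset]
    exact ⟨fun j => (e j).2, fun a b hab => e.injective (Subtype.ext hab)⟩
  · intro e _ e' _ hee
    ext j
    exact congrFun hee j
  · intro i hi
    simp only [Finset.mem_filter, Fintype.mem_piFinset] at hi
    exact ⟨⟨fun j => ⟨i j, hi.1 j⟩, fun a b hab => hi.2 (congrArg Subtype.val hab)⟩,
      Finset.mem_univ _, rfl⟩

lemma descFactorial_Fcnt (x : ℕ → ℝ) (s : ℝ) (N k : ℕ) (t : ℝ) :
    ((Fcnt x s N t).descFactorial k : ℝ) =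
      ∑ i ∈ (Fintype.piFinset fun _ : Fin k => Finset.Icc 1 N).filter Function.Injective,
        if ∀ j, nint (x (i j) - t) ≤ s / (2 * N) then (1 : ℝ) else 0 := by
  rw [Finset.sum_boole, Fcnt, ← card_injective_tuples]
  congr 2
  ext i
  simp only [Finset.mem_filter, Fintype.mem_piFinset, forall_and]
  tauto

lemma measurable_Fcnt (x : ℕ → ℝ) (s : ℝ) (N : ℕ) :
    Measurable fun t => (Fcnt x s N t : ℝ) := by
  simp only [Fcnt, ← Finset.sum_boole]
  refine Finset.measurable_sum _ fun n _ => Measurable.ite ?_ measurable_const measurable_const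
  exact measurableSet_le (measurable_nint.comp (measurable_const.sub measurable_id))
    measurable_const

lemma Fcnt_le (x : ℕ → ℝ) (s : ℝ) (N : ℕ) (t : ℝ) : Fcnt x s N t ≤ N :=
  (Finset.card_filter_le _ _).trans_eq (by simp)

lemma intervalIntegrable_of_measurable_of_bounded {f : ℝ → ℝ} (hf : Measurable f) {C : ℝ}
    (hC : ∀ t, |f t| ≤ C) (a b : ℝ) : IntervalIntegrable f volume a b :=
  (intervalIntegrable_const (c := C)).mono_fun hf.aestronglyMeasurable
    (ae_of_all _ fun t => by
      simpa [Real.norm_eq_abs] using (hC t).trans (le_abs_self C))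

lemma intervalIntegrable_Fcnt_pow (x : ℕ → ℝ) (s : ℝ) (N k : ℕ) :
    IntervalIntegrable (fun t => (Fcnt x s N t : ℝ) ^ k) volume 0 1 := by
  refine intervalIntegrable_of_measurable_of_bounded (C := (N : ℝ) ^ k)
    ((measurable_Fcnt x s N).pow_const k) (fun t => ?_) _ _
  rw [abs_of_nonneg (by positivity)]
  have : (Fcnt x s N t : ℝ) ≤ N := by exact_mod_cast Fcnt_le x s N t
  gcongr

lemma measurable_all_near {m : ℕ} (y : Fin m → ℝ) (δ : ℝ) :
    Measurable fun t => if ∀ j, nint (y j - t) ≤ δ then (1 : ℝ) else 0 := by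
  refine Measurable.ite ?_ measurable_const measurable_const
  rw [Set.ofPred_forall]
  exact MeasurableSet.iInter fun j =>
    measurableSet_le (measurable_nint.comp (measurable_const.sub measurable_id)) measurable_const

lemma intervalIntegrable_all_near {m : ℕ} (y : Fin m → ℝ) (δ : ℝ) :
    IntervalIntegrable (fun t => if ∀ j, nint (y j - t) ≤ δ then (1 : ℝ) else 0) volume 0 1 :=
  intervalIntegrable_of_measurable_of_bounded (C := 1) (measurable_all_near y δ)
    (fun t => by split_ifs <;> simp) _ _

lemma intervalIntegrable_descFactorial_Fcnt (x : ℕ → ℝ) (s : ℝ) (N k : ℕ) :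
    IntervalIntegrable (fun t => ((Fcnt x s N t).descFactorial k : ℝ)) volume 0 1 := by
  simp only [descFactorial_Fcnt]
  simpa only [Finset.sum_fn] using IntervalIntegrable.sum
    ((Fintype.piFinset fun _ : Fin k => Finset.Icc 1 N).filter Function.Injective)
    fun i _ => intervalIntegrable_all_near (fun j => x (i j)) (s / (2 * N))

lemma measurable_window_box (m : ℕ) (d : Fin m → ℝ) (s : ℝ) :
    Measurable fun u : ℝ => if |u| ≤ s / 2 ∧ ∀ r, d r ∈ Set.Icc (u - s / 2) (u + s / 2)
      then (1 : ℝ) else 0 := by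
  refine Measurable.ite (MeasurableSet.inter
    (measurableSet_le measurable_id.abs measurable_const) ?_) measurable_const measurable_const
  change MeasurableSet {u : ℝ | ∀ r, d r ∈ Set.Icc (u - s / 2) (u + s / 2)}
  rw [Set.ofPred_forall]
  exact MeasurableSet.iInter fun r => MeasurableSet.inter
    (measurableSet_le (measurable_id.sub_const _) measurable_const)
    (measurableSet_le measurable_const (measurable_id.add_const _))

lemma integrable_window_box (m : ℕ) (d : Fin m → ℝ) (s : ℝ) :
    Integrable fun u : ℝ => if |u| ≤ s / 2 ∧ ∀ r, d r ∈ Set.Icc (u - s / 2) (u + s / 2)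
      then (1 : ℝ) else 0 := by
  refine Integrable.mono' (g := (Set.Icc (-(s / 2)) (s / 2)).indicator fun _ => (1 : ℝ))
    ((integrable_indicator_iff measurableSet_Icc).2 (by simp))
    (measurable_window_box m d s).aestronglyMeasurable (ae_of_all _ fun u => ?_)
  by_cases hu : |u| ≤ s / 2
  · rw [Set.indicator_of_mem (Set.mem_Icc.2 (abs_le.1 hu))]
    split_ifs <;> simp
  · rw [if_neg fun h => hu h.1]
    simpa using Set.indicator_nonneg (fun _ _ => zero_le_one) u

lemma corrBoxCount_window (x : ℕ → ℝ) (m N : ℕ) (s u : ℝ) :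
    ∑ i ∈ (Fintype.piFinset fun _ : Fin (m + 1) => Finset.Icc 1 N).filter Function.Injective,
      (if |u| ≤ s / 2 ∧ ∀ r : Fin m, (N : ℝ) * sdist (x (i 0) - x (i r.succ)) ∈
        Set.Icc (u - s / 2) (u + s / 2) then (1 : ℝ) else 0) =
    (Set.Icc (-(s / 2)) (s / 2)).indicator
      (fun u => (corrBoxCount x (m + 1) N (fun _ => u - s / 2) (fun _ => u + s / 2) : ℝ)) u := by
  by_cases hu : |u| ≤ s / 2
  · rw [Set.indicator_of_mem (Set.mem_Icc.2 (abs_le.1 hu))]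
    simp only [hu, true_and]
    rw [Finset.sum_boole, Finset.filter_filter]
    rfl
  · rw [Set.indicator_of_notMem fun h => hu (abs_le.2 (Set.mem_Icc.1 h))]
    simp [hu]

lemma corrBoxCount_mono (x : ℕ → ℝ) (k N : ℕ) {a b a' b' : Fin (k - 1) → ℝ}
    (ha : a' ≤ a) (hb : b ≤ b') : corrBoxCount x k N a b ≤ corrBoxCount x k N a' b' := by
  refine Finset.card_le_card (Finset.monotone_filter_right _ fun i _ hi => ⟨hi.1, fun r => ?_⟩)
  exact Set.Icc_subset_Icc (ha r) (hb r) (hi.2 r)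

lemma integral_descFactorial_Fcnt (x : ℕ → ℝ) (m N : ℕ) {s : ℝ} (hs : 0 < s)
    (hN : 2 * s < N) :
    ∫ t in (0 : ℝ)..1, ((Fcnt x s N t).descFactorial (m + 1) : ℝ) =
      ∫ u : ℝ, (Set.Icc (-(s / 2)) (s / 2)).indicator (fun u =>
        (corrBoxCount x (m + 1) N (fun _ => u - s / 2) (fun _ => u + s / 2) : ℝ) / N) u := by
  simp only [descFactorial_Fcnt]
  rw [intervalIntegral.integral_finsetSum
    fun i _ => intervalIntegrable_all_near (fun j => x (i j)) _]
  rw [Finset.sum_congr rfl fun i _ => integral_all_near_eq m N (fun j => x (i j)) hs hN,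
    ← Finset.mul_sum, ← integral_finsetSum _ fun i _ => integrable_window_box m _ s,
    ← integral_const_mul]
  refine integral_congr_ae (ae_of_all _ fun u => ?_)
  beta_reduce
  rw [corrBoxCount_window, Set.indicator_apply, Set.indicator_apply]
  split_ifs
  · exact (div_eq_inv_mul _ _).symm
  · simp

/-- The factorial moments of the counting function converge to those of a Poisson variable. -/
lemma tendsto_integral_descFactorial_Fcnt {x : ℕ → ℝ} {m : ℕ}
    (hx : HasPoissonianCorr x (m + 1)) {s : ℝ} (hs : 0 < s) :
    Tendsto (fun N : ℕ => ∫ t in (0 : ℝ)..1, ((Fcnt x s N t).descFactorial (m + 1) : ℝ))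
      atTop (nhds (s ^ (m + 1))) := by
  have hlim : ∫ u : ℝ, (Set.Icc (-(s / 2)) (s / 2)).indicator (fun _ => s ^ m) u
      = s ^ (m + 1) := by
    rw [integral_indicator measurableSet_Icc, setIntegral_const, Real.volume_real_Icc_of_le
      (by linarith), smul_eq_mul]
    ring
  rw [← hlim]
  have hN : ∀ᶠ N : ℕ in atTop, 2 * s < (N : ℝ) :=
    tendsto_natCast_atTop_atTop.eventually_gt_atTop _
  refine Tendsto.congr' (hN.mono fun N h => (integral_descFactorial_Fcnt x m N hs h).symm) ?_
  have hbig : ∀ᶠ N : ℕ in atTop,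
      (corrBoxCount x (m + 1) N (fun _ => -s) (fun _ => s) : ℝ) / N ≤ (2 * s) ^ m + 1 := by
    have h := hx (fun _ => -s) (fun _ => s) fun _ => by linarith
    have h2 : ∏ _r : Fin (m + 1 - 1), (s - -s) = (2 * s) ^ m := by
      simp [two_mul]
    rw [h2] at h
    exact (h.eventually_lt_const (lt_add_one _)).mono fun _ => le_of_lt
  refine tendsto_integral_filter_of_dominated_convergence
    ((Set.Icc (-(s / 2)) (s / 2)).indicator fun _ => (2 * s) ^ m + 1) ?_ ?_ ?_ ?_
  · refine Eventually.of_forall fun N => Measurable.aestronglyMeasurable ?_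
    have : ((Set.Icc (-(s / 2)) (s / 2)).indicator fun u : ℝ =>
        (corrBoxCount x (m + 1) N (fun _ => u - s / 2) (fun _ => u + s / 2) : ℝ) / N) =
        fun u => (∑ i ∈ (Fintype.piFinset fun _ : Fin (m + 1) => Finset.Icc 1 N).filter
          Function.Injective, (if |u| ≤ s / 2 ∧ ∀ r : Fin m,
            (N : ℝ) * sdist (x (i 0) - x (i r.succ)) ∈
              Set.Icc (u - s / 2) (u + s / 2) then (1 : ℝ) else 0)) / N := by
      ext u
      rw [corrBoxCount_window, Set.indicator_apply, Set.indicator_apply]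
      split_ifs <;> simp
    rw [this]
    exact (Finset.measurable_sum _ fun i _ => measurable_window_box m _ s).div_const _
  · refine hbig.mono fun N h => ae_of_all _ fun u => ?_
    by_cases hu : u ∈ Set.Icc (-(s / 2)) (s / 2)
    · rw [Set.indicator_of_mem hu, Set.indicator_of_mem hu, Real.norm_of_nonneg (by positivity)]
      refine le_trans ?_ h
      gcongr
      exact corrBoxCount_mono x _ N (fun _ => by linarith [hu.1]) (fun _ => by linarith [hu.2])
    · simp [Set.indicator_of_notMem hu]
  · exact (integrable_indicator_iff measurableSet_Icc).2 (by simp)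
  · refine ae_of_all _ fun u => ?_
    by_cases hu : u ∈ Set.Icc (-(s / 2)) (s / 2)
    · simp only [Set.indicator_of_mem hu]
      have h := hx (fun _ => u - s / 2) (fun _ => u + s / 2) fun _ => by linarith
      have h2 : ∏ _r : Fin (m + 1 - 1), (u + s / 2 - (u - s / 2)) = s ^ m := by
        simp
      rwa [h2] at h
    · simp only [Set.indicator_of_notMem hu, tendsto_const_nhds]

/-- A power is controlled by the falling factorial, up to a lower-order term at scale `s`. -/
lemma pow_le_descFactorial_add_mul (n m : ℕ) {c s : ℝ} (hc : c = ((m : ℝ) + 1) ^ 2)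
    (hs : 2 * c ≤ s) :
    (n : ℝ) ^ (m + 1) ≤ ((n.descFactorial (m + 1) : ℝ) + c * s ^ m) * (1 + 2 * c / s) := by
  have hc0 : 0 < c := by rw [hc]; positivity
  have hs0 : 0 < s := by linarith
  have h1 : (n : ℝ) ^ (m + 1) ≤ n.descFactorial (m + 1) + c * (n : ℝ) ^ m := by
    rw [hc]; exact_mod_cast pow_succ_le_descFactorial_add n m
  have h2 : (n : ℝ) ^ m ≤ s ^ m + (n : ℝ) ^ (m + 1) / s := by
    rcases le_total (n : ℝ) s with h | h
    · have : (n : ℝ) ^ m ≤ s ^ m := by gcongr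
      have : 0 ≤ (n : ℝ) ^ (m + 1) / s := by positivity
      linarith
    · have : (n : ℝ) ^ m ≤ (n : ℝ) ^ (m + 1) / s := by
        rw [le_div_iff₀ hs0, pow_succ]; gcongr
      have : 0 ≤ s ^ m := by positivity
      linarith
  set P := (n : ℝ) ^ (m + 1)
  set A := (n.descFactorial (m + 1) : ℝ) + c * s ^ m
  have hA : 0 ≤ A := by positivity
  set e := c / s with he
  have he0 : 0 < e := by positivity
  have he1 : e ≤ 1 / 2 := by rw [he, div_le_iff₀ hs0]; linarith
  have h3 : P * (1 - e) ≤ A := by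
    have : c * (P / s) = P * e := by rw [he]; ring
    have := mul_le_mul_of_nonneg_left h2 hc0.le
    simp only [A]
    nlinarith
  have h4 : 2 * c / s = 2 * e := by rw [he]; ring
  rw [h4]
  have hP : 0 ≤ P := by positivity
  have h5 := mul_le_mul_of_nonneg_right h3 (show 0 ≤ 1 + 2 * e by linarith)
  nlinarith [mul_nonneg hP (mul_nonneg he0.le (show 0 ≤ 1 - 2 * e by linarith))]

/-- If `(x_n)` has Poissonian `k`-th order correlations, then
`limsup_N I_k^*(s,N) = s^k + O_k(s^{k-1})` as `s → ∞`: there are constants `C, s₀ > 0`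
depending only on `k` with `|limsup_N I_k^*(s,N) − s^k| ≤ C·s^{k-1}` for all `s ≥ s₀`. -/
theorem limsup_kth_moment_eq_pow_add_bigO
    (k : ℕ) (hk : 2 ≤ k) :
    ∃ C > (0:ℝ), ∃ s₀ > (0:ℝ),
      ∀ x : ℕ → ℝ, (∀ n, x n ∈ Set.Icc (0 : ℝ) 1) → HasPoissonianCorr x k →
        ∀ s : ℝ, s₀ ≤ s →
          |Filter.limsup (fun N : ℕ => ∫ t in (0:ℝ)..1, (Fcnt x s N t : ℝ) ^ k) atTop
            - s ^ k| ≤ C * s ^ (k - 1) := by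
  obtain ⟨m, rfl⟩ : ∃ m, k = m + 1 := ⟨k - 1, by omega⟩
  rw [Nat.add_sub_cancel]
  obtain ⟨c, hc⟩ : ∃ c : ℝ, c = ((m : ℝ) + 1) ^ 2 := ⟨_, rfl⟩
  have hc0 : 0 < c := by rw [hc]; positivity
  refine ⟨4 * c, by positivity, 2 * c, by positivity, fun x _ hx s hs => ?_⟩
  have hs0 : 0 < s := by linarith
  have hA := tendsto_integral_descFactorial_Fcnt hx hs0
  have hB := (hA.add_const (c * s ^ m)).mul_const (1 + 2 * c / s)
  have hlow : ∀ N : ℕ, ∫ t in (0 : ℝ)..1, ((Fcnt x s N t).descFactorial (m + 1) : ℝ) ≤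
      ∫ t in (0 : ℝ)..1, (Fcnt x s N t : ℝ) ^ (m + 1) := fun N =>
    intervalIntegral.integral_mono_on zero_le_one (intervalIntegrable_descFactorial_Fcnt x s N _)
      (intervalIntegrable_Fcnt_pow x s N _)
      fun t _ => by exact_mod_cast Nat.descFactorial_le_pow _ _
  have hup : ∀ N : ℕ, ∫ t in (0 : ℝ)..1, (Fcnt x s N t : ℝ) ^ (m + 1) ≤
      ((∫ t in (0 : ℝ)..1, ((Fcnt x s N t).descFactorial (m + 1) : ℝ)) + c * s ^ m) *
        (1 + 2 * c / s) := fun N => by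
    have hi := intervalIntegrable_descFactorial_Fcnt x s N (m + 1)
    refine (intervalIntegral.integral_mono_on zero_le_one (intervalIntegrable_Fcnt_pow x s N _)
      ((hi.add intervalIntegrable_const).mul_const (1 + 2 * c / s))
      fun t _ => pow_le_descFactorial_add_mul (Fcnt x s N t) m hc hs).trans_eq ?_
    rw [intervalIntegral.integral_mul_const,
      intervalIntegral.integral_add hi intervalIntegrable_const]
    simp
  have hbdd : IsBoundedUnder (· ≤ ·) atTop
      fun N : ℕ => ∫ t in (0 : ℝ)..1, (Fcnt x s N t : ℝ) ^ (m + 1) :=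
    hB.isBoundedUnder_le.mono_le (Eventually.of_forall hup)
  have hbdd' : IsBoundedUnder (· ≥ ·) atTop
      fun N : ℕ => ∫ t in (0 : ℝ)..1, (Fcnt x s N t : ℝ) ^ (m + 1) :=
    hA.isBoundedUnder_ge.mono_ge (Eventually.of_forall hlow)
  have h1 := limsup_le_limsup (Eventually.of_forall hlow)
    hA.isBoundedUnder_ge.isCoboundedUnder_le hbdd
  have h2 := limsup_le_limsup (Eventually.of_forall hup)
    hbdd'.isCoboundedUnder_le hB.isBoundedUnder_le
  rw [hA.limsup_eq] at h1
  rw [hB.limsup_eq] at h2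
  have hpow : 0 < s ^ m := by positivity
  have h3 : (s ^ (m + 1) + c * s ^ m) * (1 + 2 * c / s) =
      s ^ (m + 1) + 3 * c * s ^ m + (2 * c / s) * (c * s ^ m) := by
    field_simp
    ring
  have h4 : 2 * c / s ≤ 1 := (div_le_one hs0).2 hs
  have h5 : (2 * c / s) * (c * s ^ m) ≤ c * s ^ m :=
    mul_le_of_le_one_left (by positivity) h4
  rw [abs_le]
  constructor <;> nlinarith [mul_pos hc0 hpow]
end
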